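/- Let U be a nonnegative solution of the extension problem on the punctured half-ball 𝔅_2^+, with trace u(x) = U(x,0). Then u is asymptotically radially symmetric at the origin: there exist constants C > 0 and r₀ ∈ (0, 1/2) such that |u(x) − ū(|x|)| ≤ C |x| ū(|x|) for all x with 0 < |x| < r₀, where ū(r) denotes the average of u over the sphere {y ∈ ℝⁿ : |y| = r} (with respect to the normalized surface measure). -/

import Mathlib

open scoped Topology MeasureTheory RealInnerProductSpace
open Filter MeasureTheory

noncomputable section

/-- Points of `ℝ^{n+1}`, written `X = (x, t)` with `x ∈ ℝⁿ` and `t ∈ ℝ`. -/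
abbrev Pt (n : ℕ) := EuclideanSpace ℝ (Fin n) × ℝ

/-- The Euclidean norm on `ℝ^{n+1} = ℝⁿ × ℝ`. -/
def enorm' {n : ℕ} (X : Pt n) : ℝ := Real.sqrt (‖X.1‖ ^ 2 + X.2 ^ 2)

/-- Partial derivative in the last (`t`) direction. -/
def dt {n : ℕ} (U : Pt n → ℝ) (X : Pt n) : ℝ := fderiv ℝ U X (0, 1)

/-- Second derivative in the direction `v`. -/
def d2 {n : ℕ} (U : Pt n → ℝ) (X v : Pt n) : ℝ :=
  fderiv ℝ (fun Y => fderiv ℝ U Y v) X v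

/-- The Laplacian on `ℝ^{n+1}`. -/
def lapl {n : ℕ} (U : Pt n → ℝ) (X : Pt n) : ℝ :=
  (∑ i : Fin n, d2 U X (EuclideanSpace.single i (1 : ℝ), (0 : ℝ))) + d2 U X (0, 1)

/-- `U` is a nonnegative solution of the extension problem on the punctured half-ball
`𝔅_R^+`: it is nonnegative and continuous on `{|X| ≤ R, t ≥ 0} \ {0}`, `C²` on `𝔅_R^+`,
satisfies `ΔU + ((1-2σ)/t) ∂_t U = 0` there, and satisfies the nonlinear Neumann condition
`lim_{t→0⁺} t^{1-2σ} ∂_t U(x,t) = -u(x)^{(n+2σ)/(n-2σ)}` for `x ∈ B_R \ {0}`. -/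
def ExtSol (n : ℕ) (σ R : ℝ) (U : Pt n → ℝ) : Prop :=
  (∀ X : Pt n, enorm' X ≤ R → 0 ≤ X.2 → X ≠ 0 → 0 ≤ U X) ∧
  ContinuousOn U ({X : Pt n | enorm' X ≤ R ∧ 0 ≤ X.2} \ {0}) ∧
  ContDiffOn ℝ 2 U {X : Pt n | enorm' X < R ∧ 0 < X.2} ∧
  (∀ X : Pt n, enorm' X < R → 0 < X.2 →
    lapl U X + ((1 - 2 * σ) / X.2) * dt U X = 0) ∧
  (∀ x : EuclideanSpace ℝ (Fin n), ‖x‖ < R → x ≠ 0 →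
    Tendsto (fun t : ℝ => t ^ (1 - 2 * σ) * dt U (x, t)) (𝓝[>] 0)
      (𝓝 (-(U (x, 0) ^ (((n : ℝ) + 2 * σ) / ((n : ℝ) - 2 * σ))))))

/-- The average of `u` over the sphere `{y : |y| = r}` with respect to the normalized
surface measure (the normalized `(n-1)`-dimensional Hausdorff measure). -/
def sphAvg (n : ℕ) (u : EuclideanSpace ℝ (Fin n) → ℝ) (r : ℝ) : ℝ :=
  ⨍ y in Metric.sphere (0 : EuclideanSpace ℝ (Fin n)) r, u y ∂(μH[(n : ℝ) - 1])

/-! ### Calculus for the degenerate operator -/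

/-- The operator `Δ + ((1-2σ)/t) ∂_t`. -/
def Lop {n : ℕ} (σ : ℝ) (U : Pt n → ℝ) (X : Pt n) : ℝ :=
  lapl U X + ((1 - 2 * σ) / X.2) * dt U X

/-- The standard basis of `ℝ^{n+1}`, with `none` indexing the last direction. -/
def bv {n : ℕ} (o : Option (Fin n)) : Pt n :=
  o.elim (0, 1) (fun i => (EuclideanSpace.single i (1 : ℝ), 0))

lemma lapl_eq_sum {n : ℕ} (U : Pt n → ℝ) (X : Pt n) : lapl U X = ∑ o, d2 U X (bv o) := by
  rw [Fintype.sum_option, lapl, add_comm]; rfl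

section Derivatives

variable {n : ℕ} {U V : Pt n → ℝ} {X v : Pt n}

lemma ContDiffAt.eventually_hasFDerivAt (hU : ContDiffAt ℝ 2 U X) :
    ∀ᶠ Y in 𝓝 X, HasFDerivAt U (fderiv ℝ U Y) Y := by
  filter_upwards [hU.eventually (by simp)] with Y hY
  exact (hY.differentiableAt (by simp)).hasFDerivAt

lemma ContDiffAt.hasFDerivAt_fderiv (hU : ContDiffAt ℝ 2 U X) :
    HasFDerivAt (fderiv ℝ U) (fderiv ℝ (fderiv ℝ U) X) X :=
  ((hU.fderiv_right (m := 1) (by norm_num)).differentiableAt (by simp)).hasFDerivAt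

lemma d2_eq (hU : ContDiffAt ℝ 2 U X) : d2 U X v = fderiv ℝ (fderiv ℝ U) X v v := by
  have h := hU.hasFDerivAt_fderiv.clm_apply (hasFDerivAt_const v X)
  rw [d2, h.fderiv]; simp

lemma hasDerivAt_line (X v : Pt n) (s : ℝ) : HasDerivAt (fun s : ℝ => X + s • v) v s := by
  simpa using ((hasDerivAt_id s).smul_const v).const_add X

lemma tendsto_line (X v : Pt n) : Tendsto (fun s : ℝ => X + s • v) (𝓝 0) (𝓝 X) := by
  have h := (hasDerivAt_line X v 0).continuousAt.tendsto
  simpa using h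

lemma ContDiffAt.line_deriv (hU : ContDiffAt ℝ 2 U X) (v : Pt n) :
    ∀ᶠ s in 𝓝 (0 : ℝ), HasDerivAt (fun s : ℝ => U (X + s • v)) (fderiv ℝ U (X + s • v) v) s := by
  filter_upwards [(tendsto_line X v).eventually hU.eventually_hasFDerivAt] with s hs
  exact hs.comp_hasDerivAt s (hasDerivAt_line X v s)

lemma ContDiffAt.line_deriv2 (hU : ContDiffAt ℝ 2 U X) (v : Pt n) :
    HasDerivAt (fun s : ℝ => fderiv ℝ U (X + s • v) v) (d2 U X v) 0 := by
  have h := hU.hasFDerivAt_fderiv.clm_apply (hasFDerivAt_const v X)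
  have h' : HasFDerivAt (fun Y => fderiv ℝ U Y v) (fderiv ℝ (fun Y => fderiv ℝ U Y v) X)
      (X + (0 : ℝ) • v) := by
    simpa using h.differentiableAt.hasFDerivAt
  exact h'.comp_hasDerivAt 0 (hasDerivAt_line X v 0)

lemma fderiv_eq_of_line {f' : ℝ → ℝ} (hU : ContDiffAt ℝ 2 U X)
    (h1 : ∀ᶠ s in 𝓝 (0 : ℝ), HasDerivAt (fun s : ℝ => U (X + s • v)) (f' s) s) :
    fderiv ℝ U X v = f' 0 := by
  have h := (hU.line_deriv v).self_of_nhds.unique h1.self_of_nhds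
  simpa using h

lemma d2_eq_of_line {f' : ℝ → ℝ} {d : ℝ} (hU : ContDiffAt ℝ 2 U X)
    (h1 : ∀ᶠ s in 𝓝 (0 : ℝ), HasDerivAt (fun s : ℝ => U (X + s • v)) (f' s) s)
    (h2 : HasDerivAt f' d 0) : d2 U X v = d := by
  refine (hU.line_deriv2 v).unique (h2.congr_of_eventuallyEq ?_)
  filter_upwards [h1, hU.line_deriv v] with s hs hs'
  exact hs'.unique hs

lemma d2_add (hU : ContDiffAt ℝ 2 U X) (hV : ContDiffAt ℝ 2 V X) :
    d2 (fun Y => U Y + V Y) X v = d2 U X v + d2 V X v := by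
  refine d2_eq_of_line (hU.add hV) ?_ ((hU.line_deriv2 v).add (hV.line_deriv2 v))
  filter_upwards [hU.line_deriv v, hV.line_deriv v] with s h1 h2 using h1.add h2

lemma d2_const_mul (c : ℝ) (hU : ContDiffAt ℝ 2 U X) :
    d2 (fun Y => c * U Y) X v = c * d2 U X v := by
  refine d2_eq_of_line (contDiffAt_const.mul hU) ?_ ((hU.line_deriv2 v).const_mul c)
  filter_upwards [hU.line_deriv v] with s h1 using h1.const_mul c

lemma d2_mul (hU : ContDiffAt ℝ 2 U X) (hV : ContDiffAt ℝ 2 V X) :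
    d2 (fun Y => U Y * V Y) X v =
      d2 U X v * V X + 2 * (fderiv ℝ U X v * fderiv ℝ V X v) + U X * d2 V X v := by
  have h1 : HasDerivAt (fun s : ℝ => U (X + s • v)) (fderiv ℝ U X v) 0 := by
    simpa using (hU.line_deriv v).self_of_nhds
  have h2 : HasDerivAt (fun s : ℝ => V (X + s • v)) (fderiv ℝ V X v) 0 := by
    simpa using (hV.line_deriv v).self_of_nhds
  refine d2_eq_of_line (hU.mul hV)
    (f' := fun s => fderiv ℝ U (X + s • v) v * V (X + s • v)
      + U (X + s • v) * fderiv ℝ V (X + s • v) v) ?_ ?_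
  · filter_upwards [hU.line_deriv v, hV.line_deriv v] with s h1 h2 using h1.mul h2
  · refine (((hU.line_deriv2 v).mul h2).add (h1.mul (hV.line_deriv2 v))).congr_deriv ?_
    simp only [zero_smul, add_zero]; ring

lemma d2_comp {g g' : ℝ → ℝ} {g'' : ℝ} (hU : ContDiffAt ℝ 2 U X)
    (hgU : ContDiffAt ℝ 2 (fun Y => g (U Y)) X)
    (hg : ∀ᶠ y in 𝓝 (U X), HasDerivAt g (g' y) y) (hg' : HasDerivAt g' g'' (U X)) :
    d2 (fun Y => g (U Y)) X v = g'' * fderiv ℝ U X v ^ 2 + g' (U X) * d2 U X v := by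
  have h1 : HasDerivAt (fun s : ℝ => U (X + s • v)) (fderiv ℝ U X v) 0 := by
    simpa using (hU.line_deriv v).self_of_nhds
  have ht : Tendsto (fun s : ℝ => U (X + s • v)) (𝓝 0) (𝓝 (U X)) := by
    simpa using h1.continuousAt.tendsto
  refine d2_eq_of_line hgU
    (f' := fun s => g' (U (X + s • v)) * fderiv ℝ U (X + s • v) v) ?_ ?_
  · filter_upwards [hU.line_deriv v, ht.eventually hg] with s h1 h2 using h2.comp s h1
  · have h3 : HasDerivAt g' g'' (U (X + (0 : ℝ) • v)) := by simpa using hg'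
    refine ((h3.comp (0 : ℝ) h1).mul (hU.line_deriv2 v)).congr_deriv ?_
    simp only [zero_smul, add_zero, Function.comp]; ring

lemma fderiv_comp_real {g : ℝ → ℝ} {g' : ℝ} (hU : ContDiffAt ℝ 2 U X)
    (hg : HasDerivAt g g' (U X)) :
    fderiv ℝ (fun Y => g (U Y)) X v = g' * fderiv ℝ U X v := by
  have h := hg.comp_hasFDerivAt X hU.eventually_hasFDerivAt.self_of_nhds
  have : fderiv ℝ (fun Y => g (U Y)) X = g' • fderiv ℝ U X := h.fderiv
  rw [this]; simp

lemma IsLocalMin.d2_nonneg (hU : ContDiffAt ℝ 2 U X) (h : IsLocalMin U X) : 0 ≤ d2 U X v := by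
  by_contra! hneg
  set f : ℝ → ℝ := fun s => U (X + s • v) with hf
  have hd : deriv f =ᶠ[𝓝 0] fun s => fderiv ℝ U (X + s • v) v :=
    (hU.line_deriv v).mono fun s hs => hs.deriv
  have hdd : deriv (deriv f) 0 = d2 U X v := by
    rw [hd.deriv_eq]; exact (hU.line_deriv2 v).deriv
  have hc : ContinuousAt f 0 := (hU.line_deriv v).self_of_nhds.continuousAt
  have hmin : IsLocalMin f 0 := by
    have := (tendsto_line X v).eventually h
    filter_upwards [this] with s hs
    simpa [hf] using hs
  have hmax : IsLocalMax f 0 :=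
    isLocalMax_of_deriv_deriv_neg (by rw [hdd]; exact hneg) hmin.deriv_eq_zero hc
  have hconst : f =ᶠ[𝓝 0] fun _ => f 0 := by
    filter_upwards [hmin, hmax] with s h1 h2 using le_antisymm h2 h1
  have : deriv (deriv f) 0 = 0 := by
    have h1 : deriv f =ᶠ[𝓝 0] deriv (fun _ : ℝ => f 0) := hconst.deriv
    rw [h1.deriv_eq]; simp
  rw [hdd] at this
  exact hneg.ne this

lemma IsLocalMin.Lop_nonneg (σ : ℝ) (hU : ContDiffAt ℝ 2 U X) (h : IsLocalMin U X) :
    0 ≤ Lop σ U X := by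
  have : dt U X = 0 := by rw [dt, h.fderiv_eq_zero]; rfl
  rw [Lop, this, lapl_eq_sum]
  rw [mul_zero, add_zero]
  exact Finset.sum_nonneg fun o _ => h.d2_nonneg hU (v := bv o)

variable (σ : ℝ)

lemma Lop_add (hU : ContDiffAt ℝ 2 U X) (hV : ContDiffAt ℝ 2 V X) :
    Lop σ (fun Y => U Y + V Y) X = Lop σ U X + Lop σ V X := by
  have h : dt (fun Y => U Y + V Y) X = dt U X + dt V X := by
    simp only [dt]
    rw [fderiv_fun_add (hU.differentiableAt (by simp)) (hV.differentiableAt (by simp))]; rfl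
  simp only [Lop, lapl_eq_sum, h, d2_add hU hV, Finset.sum_add_distrib]; ring

lemma Lop_const_mul (c : ℝ) (hU : ContDiffAt ℝ 2 U X) :
    Lop σ (fun Y => c * U Y) X = c * Lop σ U X := by
  have h : dt (fun Y => c * U Y) X = c * dt U X := by
    simp only [dt]
    rw [fderiv_const_mul (hU.differentiableAt (by simp))]; rfl
  simp only [Lop, lapl_eq_sum, h, d2_const_mul c hU, ← Finset.mul_sum]; ring

lemma Lop_sub (hU : ContDiffAt ℝ 2 U X) (hV : ContDiffAt ℝ 2 V X) :
    Lop σ (fun Y => U Y - V Y) X = Lop σ U X - Lop σ V X := by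
  have h := Lop_add σ hU (contDiffAt_const.mul hV : ContDiffAt ℝ 2 (fun Y => (-1 : ℝ) * V Y) X)
  rw [Lop_const_mul σ _ hV] at h
  have e : (fun Y => U Y - V Y) = fun Y => U Y + (-1 : ℝ) * V Y := by ext Y; ring
  rw [e, h]; ring

lemma Lop_const (c : ℝ) : Lop σ (fun _ : Pt n => c) X = 0 := by
  simp [Lop, lapl, dt, d2]

lemma Lop_comp {g g' : ℝ → ℝ} {g'' : ℝ} (hU : ContDiffAt ℝ 2 U X)
    (hgU : ContDiffAt ℝ 2 (fun Y => g (U Y)) X)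
    (hg : ∀ᶠ y in 𝓝 (U X), HasDerivAt g (g' y) y) (hg' : HasDerivAt g' g'' (U X)) :
    Lop σ (fun Y => g (U Y)) X =
      g'' * ∑ o, fderiv ℝ U X (bv o) ^ 2 + g' (U X) * Lop σ U X := by
  simp only [Lop, lapl_eq_sum, d2_comp hU hgU hg hg', dt,
    fderiv_comp_real hU hg.self_of_nhds, Finset.sum_add_distrib, Finset.mul_sum]
  rw [mul_add, Finset.mul_sum]; ring

end Derivatives

section Barriers

variable {n : ℕ} (σ : ℝ) {X : Pt n}

lemma Lop_fun_t {g g' : ℝ → ℝ} {g'' : ℝ} (hgU : ContDiffAt ℝ 2 (fun Y : Pt n => g Y.2) X)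
    (hg : ∀ᶠ y in 𝓝 X.2, HasDerivAt g (g' y) y) (hg' : HasDerivAt g' g'' X.2) :
    Lop σ (fun Y : Pt n => g Y.2) X = g'' + (1 - 2 * σ) / X.2 * g' X.2 := by
  have hs : ContDiffAt ℝ 2 (fun Y : Pt n => Y.2) X := contDiffAt_snd
  have hf : ∀ (Y : Pt n), fderiv ℝ (fun Y : Pt n => Y.2) Y = ContinuousLinearMap.snd ℝ _ _ :=
    fun Y => fderiv_snd
  have hL : Lop σ (fun Y : Pt n => Y.2) X = (1 - 2 * σ) / X.2 := by
    simp [Lop, lapl, dt, d2, hf]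
  rw [Lop_comp σ hs hgU hg hg', hL, Fintype.sum_option]
  simp [hf, bv]; ring

lemma contDiffAt_rpow_t (p : ℝ) (hX : 0 < X.2) :
    ContDiffAt ℝ 2 (fun Y : Pt n => Y.2 ^ p) X :=
  contDiffAt_snd.rpow_const_of_ne hX.ne'

lemma Lop_rpow_t (hX : 0 < X.2) : Lop σ (fun Y : Pt n => Y.2 ^ (2 * σ)) X = 0 := by
  rw [Lop_fun_t σ (g := fun y => y ^ (2 * σ)) (g' := fun y => 2 * σ * y ^ (2 * σ - 1))
    (g'' := 2 * σ * ((2 * σ - 1) * X.2 ^ (2 * σ - 1 - 1))) (contDiffAt_rpow_t _ hX)]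
  · rw [Real.rpow_sub_one hX.ne' (2 * σ - 1)]; field_simp; ring
  · filter_upwards [lt_mem_nhds hX] with y hy
    exact Real.hasDerivAt_rpow_const (Or.inl hy.ne')
  · exact (Real.hasDerivAt_rpow_const (Or.inl hX.ne')).const_mul _

lemma Lop_sq_t (hX : 0 < X.2) : Lop σ (fun Y : Pt n => Y.2 ^ 2) X = 4 - 4 * σ := by
  rw [Lop_fun_t σ (g := fun y => y ^ 2) (g' := fun y => 2 * y) (g'' := 2)
    (contDiffAt_snd.pow 2)]
  · field_simp; ring
  · exact Eventually.of_forall fun y => by simpa using hasDerivAt_pow 2 y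
  · simpa using (hasDerivAt_id X.2).const_mul (2 : ℝ)

/-- The squared distance to the point `(c, τ)`. -/
def sqd (c : EuclideanSpace ℝ (Fin n)) (τ : ℝ) (X : Pt n) : ℝ := ‖X.1 - c‖ ^ 2 + (X.2 - τ) ^ 2

variable (c : EuclideanSpace ℝ (Fin n)) (τ : ℝ)

lemma contDiff_sqd : ContDiff ℝ 2 (sqd c τ) := by
  unfold sqd
  exact ((contDiff_fst.sub contDiff_const).norm_sq ℝ).add
    ((contDiff_snd.sub contDiff_const).pow 2)

lemma hasDerivAt_sqd_line (v : Pt n) (s : ℝ) :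
    HasDerivAt (fun s : ℝ => sqd c τ (X + s • v))
      (2 * (⟪X.1 + s • v.1 - c, v.1⟫ + (X.2 + s * v.2 - τ) * v.2)) s := by
  have h1 : HasDerivAt (fun s : ℝ => X.1 + s • v.1 - c) v.1 s := by
    simpa using (((hasDerivAt_id s).smul_const v.1).const_add X.1).sub_const c
  have h2 : HasDerivAt (fun s : ℝ => (X.2 + s * v.2 - τ)) v.2 s := by
    simpa using (((hasDerivAt_id s).mul_const v.2).const_add X.2).sub_const τ
  refine (h1.norm_sq.add (h2.pow 2)).congr_deriv ?_
  push_cast; ring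

lemma fderiv_sqd (v : Pt n) :
    fderiv ℝ (sqd c τ) X v = 2 * (⟪X.1 - c, v.1⟫ + (X.2 - τ) * v.2) := by
  rw [fderiv_eq_of_line (contDiff_sqd c τ).contDiffAt
    (Eventually.of_forall (hasDerivAt_sqd_line c τ v))]
  simp

lemma d2_sqd (v : Pt n) : d2 (sqd c τ) X v = 2 * (‖v.1‖ ^ 2 + v.2 ^ 2) := by
  refine d2_eq_of_line (contDiff_sqd c τ).contDiffAt
    (Eventually.of_forall (hasDerivAt_sqd_line c τ v)) ?_
  have h1 : HasDerivAt (fun s : ℝ => X.1 + s • v.1 - c) v.1 0 := by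
    simpa using (((hasDerivAt_id (0 : ℝ)).smul_const v.1).const_add X.1).sub_const c
  have h2 : HasDerivAt (fun s : ℝ => (X.2 + s * v.2 - τ)) v.2 0 := by
    simpa using (((hasDerivAt_id (0 : ℝ)).mul_const v.2).const_add X.2).sub_const τ
  refine (((h1.inner ℝ (hasDerivAt_const (0 : ℝ) v.1)).add (h2.mul_const v.2)).const_mul
    2).congr_deriv ?_
  simp only [inner_zero_right, real_inner_self_eq_norm_sq]; ring

lemma sum_fderiv_sqd_sq : ∑ o, fderiv ℝ (sqd c τ) X (bv o) ^ 2 = 4 * sqd c τ X := by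
  rw [Fintype.sum_option]
  simp only [fderiv_sqd, bv, Option.elim, sqd, EuclideanSpace.norm_sq_eq]
  simp [EuclideanSpace.inner_single_right, mul_pow, ← Finset.mul_sum]; ring

lemma Lop_sqd :
    Lop σ (sqd c τ) X = 2 * (n + 1) + (1 - 2 * σ) / X.2 * (2 * (X.2 - τ)) := by
  rw [Lop, lapl_eq_sum, Fintype.sum_option, dt, fderiv_sqd]
  simp [d2_sqd, bv]; ring

lemma Lop_sqd_zero (hX : 0 < X.2) : Lop σ (sqd c 0) X = 2 * (n + 2 - 2 * σ) := by
  rw [Lop_sqd σ c 0]; field_simp; ring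

lemma contDiff_nsq : ContDiff ℝ 2 (fun Y : Pt n => ‖Y.1 - c‖ ^ 2) :=
  (contDiff_fst.sub contDiff_const).norm_sq ℝ

lemma Lop_nsq (hX : 0 < X.2) : Lop σ (fun Y : Pt n => ‖Y.1 - c‖ ^ 2) X = 2 * n := by
  have e : (fun Y : Pt n => ‖Y.1 - c‖ ^ 2) = fun Y => sqd c 0 Y - Y.2 ^ 2 := by
    ext Y; simp [sqd]
  rw [e, Lop_sub σ (contDiff_sqd c 0).contDiffAt (contDiffAt_snd.pow 2), Lop_sqd_zero σ c hX,
    Lop_sq_t σ hX]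
  ring

lemma contDiffAt_sqd_rpow (p : ℝ) (hX : 0 < sqd c τ X) :
    ContDiffAt ℝ 2 (fun Y => sqd c τ Y ^ p) X :=
  (contDiff_sqd c τ).contDiffAt.rpow_const_of_ne hX.ne'

lemma Lop_sqd_rpow (hX : 0 < X.2) (hs : 0 < sqd c 0 X) :
    Lop σ (fun Y => sqd c 0 Y ^ (-((n - 2 * σ) / 2))) X = 0 := by
  set p : ℝ := -((n - 2 * σ) / 2) with hp
  rw [Lop_comp σ (g := fun y => y ^ p) (g' := fun y => p * y ^ (p - 1))
    (g'' := p * ((p - 1) * sqd c 0 X ^ (p - 1 - 1))) (contDiff_sqd c 0).contDiffAt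
    (contDiffAt_sqd_rpow c 0 p hs), Lop_sqd_zero σ c hX, sum_fderiv_sqd_sq,
    Real.rpow_sub_one hs.ne' (p - 1)]
  · field_simp; rw [hp]; ring
  · filter_upwards [lt_mem_nhds hs] with y hy
    exact Real.hasDerivAt_rpow_const (Or.inl hy.ne')
  · exact (Real.hasDerivAt_rpow_const (Or.inl hs.ne')).const_mul _

end Barriers

/-! ### Conormal derivatives and the maximum principle -/

/-- The weighted normal derivative of `U` at the boundary point `(x, 0)`, as a limit of
difference quotients. -/
def FluxAt {n : ℕ} (σ : ℝ) (U : Pt n → ℝ) (x : EuclideanSpace ℝ (Fin n)) (l : ℝ) : Prop :=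
  Tendsto (fun t : ℝ => (U (x, t) - U (x, 0)) / t ^ (2 * σ)) (𝓝[>] 0) (𝓝 l)

section Flux

variable {n : ℕ} {σ : ℝ} {U V : Pt n → ℝ} {x : EuclideanSpace ℝ (Fin n)} {l m : ℝ}

lemma FluxAt.add (hU : FluxAt σ U x l) (hV : FluxAt σ V x m) :
    FluxAt σ (fun Y => U Y + V Y) x (l + m) :=
  (Tendsto.add hU hV).congr fun t => by ring

lemma FluxAt.const_mul (c : ℝ) (hU : FluxAt σ U x l) : FluxAt σ (fun Y => c * U Y) x (c * l) :=
  (Tendsto.const_mul c hU).congr fun t => by ring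

lemma FluxAt.sub (hU : FluxAt σ U x l) (hV : FluxAt σ V x m) :
    FluxAt σ (fun Y => U Y - V Y) x (l - m) :=
  (Tendsto.sub hU hV).congr fun t => by ring

lemma fluxAt_rpow_t (hσ : 0 < σ) : FluxAt σ (fun Y : Pt n => Y.2 ^ (2 * σ)) x 1 := by
  refine tendsto_const_nhds.congr' ?_
  filter_upwards [self_mem_nhdsWithin] with t ht
  have : 0 < t ^ (2 * σ) := Real.rpow_pos_of_pos ht _
  rw [Real.zero_rpow (by positivity), sub_zero, div_self this.ne']

lemma tendsto_rpow_nhdsGT_zero {q : ℝ} (hq : 0 < q) :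
    Tendsto (fun t : ℝ => t ^ q) (𝓝[>] 0) (𝓝 0) := by
  have := (Real.continuousAt_rpow_const (0 : ℝ) q (Or.inr hq.le)).tendsto
  rw [Real.zero_rpow hq.ne'] at this
  exact this.mono_left nhdsWithin_le_nhds

lemma fluxAt_of_isBigO (hσ : σ < 1)
    (h : (fun t : ℝ => U (x, t) - U (x, 0)) =O[𝓝[>] 0] fun t : ℝ => t ^ 2) :
    FluxAt σ U x 0 := by
  have h2 : (fun t : ℝ => t ^ 2) =o[𝓝[>] 0] fun t : ℝ => t ^ (2 * σ) := by
    rw [Asymptotics.isLittleO_iff_tendsto']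
    · have : Tendsto (fun t : ℝ => t ^ (2 - 2 * σ)) (𝓝[>] 0) (𝓝 0) :=
        tendsto_rpow_nhdsGT_zero (by linarith)
      refine this.congr' ?_
      filter_upwards [self_mem_nhdsWithin] with t ht
      rw [Real.rpow_sub ht, Real.rpow_two]
    · filter_upwards [self_mem_nhdsWithin] with t ht h0
      exact absurd h0 (Real.rpow_pos_of_pos ht _).ne'
  exact (h.trans_isLittleO h2).tendsto_div_nhds_zero

lemma fluxAt_of_hasDerivAt (hσ : σ < 1) {g : ℝ → ℝ} {g' : ℝ} (hg : HasDerivAt g g' 0)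
    (h : ∀ t, U (x, t) = g (t ^ 2)) : FluxAt σ U x 0 := by
  refine fluxAt_of_isBigO hσ ?_
  have h1 := hg.isBigO_sub
  have h2 : Tendsto (fun t : ℝ => t ^ 2) (𝓝[>] 0) (𝓝 0) := by
    have : Tendsto (fun t : ℝ => t ^ 2) (𝓝 0) (𝓝 (0 ^ 2)) := (continuous_pow 2).tendsto 0
    rw [zero_pow two_ne_zero] at this
    exact this.mono_left nhdsWithin_le_nhds
  have h3 := h1.comp_tendsto h2
  refine (h3.congr (fun t => ?_) (fun t => ?_))
  · simp [h]
  · simp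

lemma fluxAt_sqd (hσ : σ < 1) (c : EuclideanSpace ℝ (Fin n)) : FluxAt σ (sqd c 0) x 0 :=
  fluxAt_of_hasDerivAt hσ (g := fun s => ‖x - c‖ ^ 2 + s) ((hasDerivAt_id 0).const_add _)
    fun t => by simp [sqd]

lemma fluxAt_nsq (hσ : σ < 1) (c : EuclideanSpace ℝ (Fin n)) :
    FluxAt σ (fun Y : Pt n => ‖Y.1 - c‖ ^ 2) x 0 :=
  fluxAt_of_hasDerivAt hσ (g := fun _ => ‖x - c‖ ^ 2) (hasDerivAt_const 0 _) fun t => by simp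

lemma fluxAt_const (hσ : σ < 1) (c : ℝ) : FluxAt σ (fun _ : Pt n => c) x 0 :=
  fluxAt_of_hasDerivAt hσ (g := fun _ => c) (hasDerivAt_const 0 _) fun t => by simp

lemma fluxAt_sq_t (hσ : σ < 1) : FluxAt σ (fun Y : Pt n => Y.2 ^ 2) x 0 :=
  fluxAt_of_hasDerivAt hσ (g := fun s => s) (hasDerivAt_id 0) fun t => by simp

lemma fluxAt_sqd_rpow (hσ : σ < 1) {c : EuclideanSpace ℝ (Fin n)} (hx : x ≠ c) (p : ℝ) :
    FluxAt σ (fun Y => sqd c 0 Y ^ p) x 0 := by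
  have h0 : 0 < ‖x - c‖ ^ 2 := by have := sub_ne_zero.2 hx; positivity
  refine fluxAt_of_hasDerivAt hσ (g := fun s => (‖x - c‖ ^ 2 + s) ^ p)
    (((hasDerivAt_id (0 : ℝ)).const_add _).rpow_const (Or.inl (by simpa using h0.ne'))) ?_
  intro t; simp [sqd]

lemma FluxAt.nonneg (h : FluxAt σ U x l) {K : Set (Pt n)}
    (hK : ∀ᶠ t in 𝓝[>] (0 : ℝ), (x, t) ∈ K) (hmin : ∀ Y ∈ K, U (x, 0) ≤ U Y) : 0 ≤ l := by
  refine ge_of_tendsto h ?_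
  filter_upwards [hK, self_mem_nhdsWithin] with t ht ht0
  have : 0 < t ^ (2 * σ) := Real.rpow_pos_of_pos ht0 _
  have := hmin _ ht
  exact div_nonneg (by linarith) (by positivity)

end Flux

/-- `V` is a supersolution at the point `X` of `K`, either in the interior or at the flat part of
the boundary, where its weighted normal derivative is at most `b`. -/
def SuperAt {n : ℕ} (σ : ℝ) (K : Set (Pt n)) (V : Pt n → ℝ) (b : ℝ) (X : Pt n) : Prop :=
  (0 < X.2 ∧ K ∈ 𝓝 X ∧ ContDiffAt ℝ 2 V X ∧ Lop σ V X ≤ 0) ∨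
  (X.2 = 0 ∧ (∀ᶠ t in 𝓝[>] (0 : ℝ), (X.1, t) ∈ K) ∧ ∃ l ≤ b, FluxAt σ V X.1 l)

section MaxPrinciple

variable {n : ℕ} {σ : ℝ}

lemma SuperAt.not_min {K : Set (Pt n)} {V φ : Pt n → ℝ} {b k : ℝ} {X : Pt n}
    (h : SuperAt σ K V b X) (hk : 0 < k)
    (hφ : 0 < X.2 → ContDiffAt ℝ 2 φ X ∧ Lop σ φ X < 0)
    (hφ' : X.2 = 0 → ∃ l, b + k * l < 0 ∧ FluxAt σ φ X.1 l)
    {K' : Set (Pt n)} (hK' : ∀ᶠ Y in 𝓝 X, Y ∈ K → Y ∈ K') :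
    ¬ ∀ Y ∈ K', V X + k * φ X ≤ V Y + k * φ Y := by
  intro hmin
  rcases h with ⟨h0, hK, hV, hL⟩ | ⟨h0, hK, l, hl, hf⟩
  · obtain ⟨h1, h2⟩ := hφ h0
    have h3 : IsLocalMin (fun Y => V Y + k * φ Y) X := by
      filter_upwards [hK, hK'] with Y hY hY' using hmin Y (hY' hY)
    have h4 := h3.Lop_nonneg σ (hV.add (contDiffAt_const.mul h1))
    rw [Lop_add σ hV (contDiffAt_const.mul h1), Lop_const_mul σ k h1] at h4
    nlinarith
  · obtain ⟨m, hm, hf'⟩ := hφ' h0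
    have hX : X = (X.1, 0) := by rw [← h0]
    have ht : Tendsto (fun t : ℝ => (X.1, t)) (𝓝[>] 0) (𝓝 X) := by
      have : Tendsto (fun t : ℝ => (X.1, t)) (𝓝 0) (𝓝 (X.1, 0)) :=
        (Continuous.prodMk continuous_const continuous_id).tendsto 0
      rw [← hX] at this
      exact this.mono_left nhdsWithin_le_nhds
    have h3 := (hf.add (hf'.const_mul k)).nonneg (K := K')
      (by filter_upwards [hK, ht.eventually hK'] with t h1 h2 using h2 h1)
      (by rw [← hX]; exact hmin)
    linarith

lemma sqd_zero_pos {X : Pt n} (hX : X ≠ 0) : 0 < sqd 0 0 X := by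
  have : X.1 ≠ 0 ∨ X.2 ≠ 0 := by
    by_contra! h
    exact hX (Prod.ext h.1 h.2)
  simp only [sqd, sub_zero]
  rcases this with h | h <;> positivity

/-- Maximum principle: a supersolution which is bounded below near the origin is nonnegative. -/
lemma nonneg_of_superAt (hn : 2 ≤ n) (hσ : σ ∈ Set.Ioo (0 : ℝ) 1) {K : Set (Pt n)}
    {V : Pt n → ℝ} {B : ℝ} (hK : IsCompact K) (h02 : ∀ X ∈ K, 0 ≤ X.2 ∧ X.2 ≤ 2)
    (hV : ContinuousOn V (K \ {0})) (hB : ∀ X ∈ K, X ≠ 0 → -B ≤ V X)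
    (h : ∀ X ∈ K, X ≠ 0 → V X < 0 → SuperAt σ K V 0 X) : ∀ X ∈ K, X ≠ 0 → 0 ≤ V X := by
  obtain ⟨hσ0, hσ1⟩ := hσ
  intro X₀ hX₀ hX₀0
  by_contra! hneg
  have hn' : (2 : ℝ) ≤ n := by exact_mod_cast hn
  set γ : ℝ := (n - 2 * σ) / 2 with hγ
  have hγ0 : 0 < γ := by rw [hγ]; linarith
  set φ : Pt n → ℝ := fun X => sqd 0 0 X ^ (-γ) + 9 - X.2 ^ (2 * σ) - X.2 ^ 2 with hφ
  have hφpos : ∀ X ∈ K, X ≠ 0 → sqd 0 0 X ^ (-γ) < φ X := by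
    intro X hX hX0
    obtain ⟨h1, h2⟩ := h02 X hX
    have h3 : X.2 ^ (2 * σ) ≤ 4 := by
      calc X.2 ^ (2 * σ) ≤ 2 ^ (2 * σ) := Real.rpow_le_rpow h1 h2 (by linarith)
        _ ≤ 2 ^ (2 : ℝ) := Real.rpow_le_rpow_of_exponent_le (by norm_num) (by linarith)
        _ = 4 := by norm_num
    simp only [hφ]; nlinarith
  have hs0 := sqd_zero_pos hX₀0
  have hφ0 : 0 < φ X₀ := (Real.rpow_pos_of_pos hs0 _).trans (hφpos _ hX₀ hX₀0)
  obtain ⟨ε, hε, hε'⟩ : ∃ ε > 0, V X₀ + ε * φ X₀ < 0 :=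
    ⟨-V X₀ / (2 * φ X₀), by apply div_pos <;> linarith, by field_simp; linarith⟩
  obtain ⟨ρ, hρ0, hρ1, hρ2⟩ : ∃ ρ > 0, ρ ≤ sqd 0 0 X₀ ∧ B ≤ ε * ρ ^ (-γ) := by
    have h1 := (tendsto_rpow_neg_nhdsGT_zero (y := -γ) (by linarith)).eventually_ge_atTop (B / ε)
    obtain ⟨ρ, h2, h3, h4⟩ := (h1.and ((eventually_mem_nhdsWithin).and
      (mem_nhdsWithin_of_mem_nhds (Iic_mem_nhds hs0)))).exists
    refine ⟨ρ, h3, h4, ?_⟩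
    rw [div_le_iff₀ hε] at h2; linarith
  set K' := K ∩ {X | ρ ≤ sqd 0 0 X} with hK'
  have hcs : Continuous (sqd (0 : EuclideanSpace ℝ (Fin n)) 0) := (contDiff_sqd 0 0).continuous
  have hK'c : IsCompact K' := hK.inter_right (isClosed_le continuous_const hcs)
  have hne : ∀ X ∈ K', X ≠ 0 := by
    rintro X hX rfl
    have : ρ ≤ sqd 0 0 (0 : Pt n) := hX.2
    simp [sqd] at this; linarith
  have hcont : ContinuousOn (fun X => V X + ε * φ X) K' := by
    refine (hV.mono fun X hX => ⟨hX.1, hne X hX⟩).add (continuousOn_const.mul ?_)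
    refine ((ContinuousOn.add ?_ continuousOn_const).sub ?_).sub ?_
    · exact hcs.continuousOn.rpow_const fun X hX => Or.inl (sqd_zero_pos (hne X hX)).ne'
    · exact continuous_snd.continuousOn.rpow_const fun X hX => Or.inr (by linarith)
    · fun_prop
  obtain ⟨X₁, hX₁, hmin⟩ := hK'c.exists_isMinOn ⟨X₀, hX₀, hρ1⟩ hcont
  have hX₁0 := hne X₁ hX₁
  have hs1 := sqd_zero_pos hX₁0
  have h1 : V X₁ + ε * φ X₁ < 0 := lt_of_le_of_lt (hmin ⟨hX₀, hρ1⟩) hε'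
  have h2 := hφpos X₁ hX₁.1 hX₁0
  have h3 := Real.rpow_pos_of_pos hs1 (-γ)
  have hV1 : V X₁ < 0 := by nlinarith
  have hρX : ρ < sqd 0 0 X₁ := by
    refine lt_of_le_of_ne hX₁.2 fun he => ?_
    rw [← he] at h2
    have := hB X₁ hX₁.1 hX₁0
    nlinarith
  refine (h X₁ hX₁.1 hX₁0 hV1).not_min hε (φ := φ) ?_ ?_ (K' := K') ?_ hmin
  · intro ht
    have c1 := contDiffAt_sqd_rpow 0 0 (-γ) hs1
    have c2 : ContDiffAt ℝ 2 (fun X : Pt n => sqd 0 0 X ^ (-γ) + 9) X₁ := c1.add contDiffAt_const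
    have c3 := contDiffAt_rpow_t (X := X₁) (2 * σ) ht
    have c4 : ContDiffAt ℝ 2 (fun Y : Pt n => Y.2 ^ 2) X₁ := contDiffAt_snd.pow 2
    refine ⟨(c2.sub c3).sub c4, ?_⟩
    rw [hφ, Lop_sub σ (c2.sub c3) c4, Lop_sub σ c2 c3, Lop_add σ c1 contDiffAt_const, Lop_const,
      Lop_sqd_rpow σ 0 ht hs1, Lop_rpow_t σ ht, Lop_sq_t σ ht]
    linarith
  · intro ht
    have hx : X₁.1 ≠ 0 := fun hx => hX₁0 (Prod.ext hx ht)
    exact ⟨_, by nlinarith, (((fluxAt_sqd_rpow hσ1 hx (-γ)).add (fluxAt_const hσ1 9)).sub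
      (fluxAt_rpow_t hσ0)).sub (fluxAt_sq_t hσ1)⟩
  · filter_upwards [hcs.continuousAt.eventually (lt_mem_nhds hρX)] with Y hY hYK
    exact ⟨hYK, hY.le⟩

lemma exists_mul_rpow_le (hσ : σ ∈ Set.Ioo (0 : ℝ) 1) {M : ℝ} (hM : 0 < M) :
    ∃ B > 0, ∀ t : ℝ, 0 ≤ t → M * t ^ (2 * σ) ≤ 1 / 2 + B * t ^ 2 := by
  obtain ⟨hσ0, hσ1⟩ := hσ
  set t₀ : ℝ := (1 / (2 * M)) ^ (1 / (2 * σ)) with ht₀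
  have h0 : 0 < t₀ := by positivity
  have h1 : t₀ ^ (2 * σ) = 1 / (2 * M) := by
    rw [ht₀, ← Real.rpow_mul (by positivity), one_div_mul_cancel (by positivity), Real.rpow_one]
  refine ⟨M * t₀ ^ (2 * σ - 2), by positivity, fun t ht => ?_⟩
  rcases le_total t t₀ with h | h
  · have : t ^ (2 * σ) ≤ 1 / (2 * M) := h1 ▸ Real.rpow_le_rpow ht h (by linarith)
    have h2 : M * t ^ (2 * σ) ≤ M * (1 / (2 * M)) := by gcongr
    have h3 : M * (1 / (2 * M)) = 1 / 2 := by field_simp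
    have : 0 ≤ M * t₀ ^ (2 * σ - 2) * t ^ 2 := by positivity
    linarith
  · have ht' : 0 < t := h0.trans_le h
    have h2 : t ^ (2 * σ - 2) ≤ t₀ ^ (2 * σ - 2) :=
      Real.rpow_le_rpow_of_nonpos h0 h (by linarith)
    have h3 : t ^ (2 * σ) = t ^ (2 * σ - 2) * t ^ 2 := by
      rw [← Real.rpow_two, ← Real.rpow_add ht']; ring_nf
    rw [h3, ← mul_assoc]
    have : M * t ^ (2 * σ - 2) * t ^ 2 ≤ M * t₀ ^ (2 * σ - 2) * t ^ 2 := by gcongr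
    linarith

/-- Maximum principle in thin spherical shells, allowing a linear boundary term. -/
lemma exists_thin_shell (hσ : σ ∈ Set.Ioo (0 : ℝ) 1) {C : ℝ} (hC : 0 ≤ C) :
    ∃ θ₀ > 0, ∀ (K : Set (Pt n)) (c : EuclideanSpace ℝ (Fin n)) (l : ℝ) (V : Pt n → ℝ),
      IsCompact K → (∀ X ∈ K, 0 ≤ X.2 ∧ l ≤ sqd c 0 X ∧ sqd c 0 X ≤ l + θ₀) →
      ContinuousOn V K → (∀ X ∈ K, V X < 0 → SuperAt σ K V (-C * V X) X) →
      ∀ X ∈ K, 0 ≤ V X := by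
  obtain ⟨B, hB0, hB⟩ := exists_mul_rpow_le hσ (M := 2 * C + 1) (by linarith)
  obtain ⟨hσ0, hσ1⟩ := hσ
  refine ⟨1 / (B + 1), by positivity, fun K c l V hK hKs hV h X₀ hX₀ => ?_⟩
  by_contra! hneg
  set θ : ℝ := 1 / (B + 1) with hθ
  have hθ0 : 0 < θ := by positivity
  have hBθ : B < 1 / θ := by rw [hθ, one_div_one_div]; linarith
  set φ : Pt n → ℝ := fun X => (-(1 / θ)) * sqd c 0 X + (2 + l / θ) - (2 * C + 1) * X.2 ^ (2 * σ)
    + B * X.2 ^ 2 with hφ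
  have hφ1 : ∀ X ∈ K, 1 / 2 ≤ φ X := by
    intro X hX
    obtain ⟨h1, h2, h3⟩ := hKs X hX
    have h4 := hB X.2 h1
    have h5 : (sqd c 0 X - l) / θ ≤ 1 := by rw [div_le_one hθ0]; linarith
    have h6 : φ X = 2 - (sqd c 0 X - l) / θ - (2 * C + 1) * X.2 ^ (2 * σ) + B * X.2 ^ 2 := by
      simp only [hφ]; ring
    linarith
  have hφ2 : ∀ X ∈ K, X.2 = 0 → φ X ≤ 2 := by
    intro X hX h0
    obtain ⟨h1, h2, h3⟩ := hKs X hX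
    have h5 : 0 ≤ (sqd c 0 X - l) / θ := div_nonneg (by linarith) hθ0.le
    have h6 : φ X = 2 - (sqd c 0 X - l) / θ := by
      simp only [hφ, h0]; rw [Real.zero_rpow (by positivity)]; ring
    linarith
  have hcs : Continuous (sqd c 0) := (contDiff_sqd c 0).continuous
  have hφc : Continuous φ := by
    refine (((continuous_const.mul hcs).add continuous_const).sub
      (continuous_const.mul ?_)).add (by fun_prop)
    exact continuous_snd.rpow_const fun X => Or.inr (by linarith)
  obtain ⟨X₁, hX₁, hmin⟩ := hK.exists_isMinOn ⟨X₀, hX₀⟩ (f := fun X => V X / φ X)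
    (hV.div hφc.continuousOn fun X hX => by have := hφ1 X hX; linarith)
  have hp1 := hφ1 X₁ hX₁
  have hlt : V X₁ / φ X₁ < 0 := lt_of_le_of_lt (hmin hX₀)
    (div_neg_of_neg_of_pos hneg (by have := hφ1 X₀ hX₀; linarith))
  set k := -(V X₁ / φ X₁) with hk
  have hk0 : 0 < k := by linarith
  have hVk : V X₁ = -k * φ X₁ := by rw [hk]; field_simp
  have hV1 : V X₁ < 0 := by rw [hVk]; nlinarith
  refine (h X₁ hX₁ hV1).not_min hk0 (φ := φ) ?_ ?_ (K' := K) ?_ ?_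
  · intro ht
    have c1 : ContDiffAt ℝ 2 (sqd c 0) X₁ := (contDiff_sqd c 0).contDiffAt
    have c1' : ContDiffAt ℝ 2 (fun X => (-(1 / θ)) * sqd c 0 X) X₁ := contDiffAt_const.mul c1
    have c2 : ContDiffAt ℝ 2 (fun _ : Pt n => (2 + l / θ)) X₁ := contDiffAt_const
    have c3 := contDiffAt_rpow_t (X := X₁) (2 * σ) ht
    have c3' : ContDiffAt ℝ 2 (fun X : Pt n => (2 * C + 1) * X.2 ^ (2 * σ)) X₁ :=
      contDiffAt_const.mul c3
    have c4 : ContDiffAt ℝ 2 (fun Y : Pt n => Y.2 ^ 2) X₁ := contDiffAt_snd.pow 2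
    have c4' : ContDiffAt ℝ 2 (fun Y : Pt n => B * Y.2 ^ 2) X₁ := contDiffAt_const.mul c4
    refine ⟨((c1'.add c2).sub c3').add c4', ?_⟩
    rw [hφ, Lop_add σ ((c1'.add c2).sub c3') c4', Lop_sub σ (c1'.add c2) c3', Lop_add σ c1' c2,
      Lop_const_mul σ _ c1, Lop_const_mul σ _ c3, Lop_const_mul σ _ c4, Lop_const,
      Lop_sqd_zero σ c ht, Lop_rpow_t σ ht, Lop_sq_t σ ht]
    have hn : (0 : ℝ) ≤ n := Nat.cast_nonneg n
    nlinarith [mul_nonneg (hB0.trans hBθ).le hn,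
      mul_pos (sub_pos.2 hBθ) (sub_pos.2 hσ1)]
  · intro ht
    refine ⟨_, ?_, ((((fluxAt_sqd hσ1 c).const_mul (-(1 / θ))).add (fluxAt_const hσ1 _)).sub
      ((fluxAt_rpow_t hσ0).const_mul _)).add ((fluxAt_sq_t hσ1).const_mul _)⟩
    have h2 := hφ2 X₁ hX₁ ht
    rw [hVk]
    nlinarith [mul_nonneg hC hk0.le, mul_nonneg (mul_nonneg hC hk0.le) (sub_nonneg.2 h2)]
  · exact Eventually.of_forall fun Y hY => hY
  · intro Y hY
    have h1 : V X₁ / φ X₁ ≤ V Y / φ Y := hmin hY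
    have hpY := hφ1 Y hY
    rw [le_div_iff₀ (by linarith)] at h1
    rw [hVk]
    have : -k * φ Y ≤ V Y := by rw [hk]; linarith
    linarith

end MaxPrinciple

/-! ### Solutions of the extension problem -/

/-- The critical exponent `(n+2σ)/(n-2σ)`. -/
def pexp (n : ℕ) (σ : ℝ) : ℝ := (n + 2 * σ) / (n - 2 * σ)

/-- The exponent `(n-2σ)/2`. -/
def gexp (n : ℕ) (σ : ℝ) : ℝ := (n - 2 * σ) / 2

/-- The properties of solutions on the punctured half-ball of radius `2` which are used below,
with the conormal derivative expressed through difference quotients. -/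
structure Sol (n : ℕ) (σ : ℝ) (U : Pt n → ℝ) : Prop where
  two_le : 2 ≤ n
  mem_Ioo : σ ∈ Set.Ioo (0 : ℝ) 1
  nonneg : ∀ X, sqd 0 0 X ≤ 4 → 0 ≤ X.2 → X ≠ 0 → 0 ≤ U X
  cont : ContinuousOn U {X | sqd 0 0 X ≤ 4 ∧ 0 ≤ X.2 ∧ X ≠ 0}
  smooth : ∀ X, sqd 0 0 X < 4 → 0 < X.2 → ContDiffAt ℝ 2 U X
  Lop_eq : ∀ X, sqd 0 0 X < 4 → 0 < X.2 → Lop σ U X = 0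
  flux : ∀ x, ‖x‖ < 2 → x ≠ 0 → FluxAt σ U x (-(U (x, 0) ^ pexp n σ) / (2 * σ))

section

variable {n : ℕ} {σ : ℝ} {U : Pt n → ℝ}

lemma enorm'_sq (X : Pt n) : enorm' X ^ 2 = sqd 0 0 X := by
  rw [enorm', Real.sq_sqrt (by positivity)]; simp [sqd]

lemma enorm'_le_two (X : Pt n) : enorm' X ≤ 2 ↔ sqd 0 0 X ≤ 4 := by
  rw [← enorm'_sq, show (4 : ℝ) = 2 ^ 2 by norm_num,
    sq_le_sq₀ (show 0 ≤ enorm' X from Real.sqrt_nonneg _) (by norm_num)]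

lemma enorm'_lt_two (X : Pt n) : enorm' X < 2 ↔ sqd 0 0 X < 4 := by
  rw [← enorm'_sq, show (4 : ℝ) = 2 ^ 2 by norm_num,
    sq_lt_sq₀ (show 0 ≤ enorm' X from Real.sqrt_nonneg _) (by norm_num)]

lemma continuous_sqd (c : EuclideanSpace ℝ (Fin n)) (τ : ℝ) : Continuous (sqd c τ) :=
  (contDiff_sqd c τ).continuous

lemma isOpen_upper : IsOpen {X : Pt n | sqd 0 0 X < 4 ∧ 0 < X.2} :=
  (isOpen_lt (continuous_sqd 0 0) continuous_const).inter
    (isOpen_lt continuous_const continuous_snd)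

lemma hasDerivAt_vertical {X : Pt n} (hX : ContDiffAt ℝ 2 U X) :
    HasDerivAt (fun t : ℝ => U (X.1, t)) (dt U X) X.2 := by
  have h : HasFDerivAt U (fderiv ℝ U X) (X.1, X.2) := hX.eventually_hasFDerivAt.self_of_nhds
  exact h.comp_hasDerivAt X.2 ((hasDerivAt_const X.2 X.1).prodMk (hasDerivAt_id X.2))

lemma tendsto_vertical (x : EuclideanSpace ℝ (Fin n)) (t : ℝ) :
    Tendsto (fun s : ℝ => (x, s)) (𝓝 t) (𝓝 (x, t)) :=
  (Continuous.prodMk continuous_const continuous_id).tendsto t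

/-- A solution in the sense of `ExtSol` is a solution in the sense of `Sol`. -/
lemma ExtSol.sol (hn : 2 ≤ n) (hσ : σ ∈ Set.Ioo (0 : ℝ) 1) (hU : ExtSol n σ 2 U) :
    Sol n σ U := by
  obtain ⟨h1, h2, h3, h4, h5⟩ := hU
  have hset : {X : Pt n | enorm' X < 2 ∧ 0 < X.2} = {X : Pt n | sqd 0 0 X < 4 ∧ 0 < X.2} := by
    ext X; simp only [Set.mem_ofPred_eq, enorm'_lt_two]
  rw [hset] at h3
  have hsm : ∀ X, sqd 0 0 X < 4 → 0 < X.2 → ContDiffAt ℝ 2 U X := fun X ha hb =>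
    h3.contDiffAt (isOpen_upper.mem_nhds ⟨ha, hb⟩)
  have hc : ContinuousOn U {X | sqd 0 0 X ≤ 4 ∧ 0 ≤ X.2 ∧ X ≠ 0} := by
    refine h2.mono fun X hX => ⟨⟨(enorm'_le_two X).2 hX.1, hX.2.1⟩, hX.2.2⟩
  refine ⟨hn, hσ, fun X hX => h1 X ((enorm'_le_two X).2 hX), hc, hsm,
    fun X hX => h4 X ((enorm'_lt_two X).2 hX), fun x hx hx0 => ?_⟩
  have hσ0 := hσ.1
  have hx4 : sqd 0 0 (x, (0 : ℝ)) < 4 := by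
    simp [sqd]; nlinarith [norm_nonneg x]
  have hlt : ∀ᶠ t in 𝓝[>] (0 : ℝ), sqd 0 0 (x, t) < 4 := by
    exact ((tendsto_vertical x 0).mono_left nhdsWithin_le_nhds).eventually
      ((continuous_sqd 0 0).continuousAt.eventually (gt_mem_nhds hx4))
  have hne : ∀ t : ℝ, (x, t) ≠ (0 : Pt n) := fun t h => hx0 (congrArg Prod.fst h)
  refine HasDerivAt.lhopital_zero_nhdsGT (f' := fun t => dt U (x, t))
    (g' := fun t => 2 * σ * t ^ (2 * σ - 1)) ?_ ?_ ?_ ?_ ?_ ?_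
  · filter_upwards [hlt, self_mem_nhdsWithin] with t ht ht0
    exact (hasDerivAt_vertical (X := (x, t)) (hsm (x, t) ht ht0)).sub_const _
  · filter_upwards [self_mem_nhdsWithin] with t ht
    exact Real.hasDerivAt_rpow_const (Or.inl (ne_of_gt ht))
  · filter_upwards [self_mem_nhdsWithin] with t ht
    have : 0 < t ^ (2 * σ - 1) := Real.rpow_pos_of_pos ht _
    positivity
  · have hw : ContinuousWithinAt U {X | sqd 0 0 X ≤ 4 ∧ 0 ≤ X.2 ∧ X ≠ 0} (x, 0) :=
      hc _ ⟨hx4.le, le_rfl, hne 0⟩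
    have ht : Tendsto (fun t : ℝ => (x, t)) (𝓝[>] 0)
        (𝓝[{X | sqd 0 0 X ≤ 4 ∧ 0 ≤ X.2 ∧ X ≠ 0}] (x, 0)) := by
      refine tendsto_nhdsWithin_iff.2 ⟨(tendsto_vertical x 0).mono_left nhdsWithin_le_nhds, ?_⟩
      filter_upwards [hlt, self_mem_nhdsWithin] with t h1 h2 using ⟨h1.le, le_of_lt h2, hne t⟩
    simpa using (hw.tendsto.comp ht).sub_const (U (x, 0))
  · exact tendsto_rpow_nhdsGT_zero (by linarith)
  · have h6 := (h5 x hx hx0).div_const (2 * σ)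
    refine h6.congr' ?_
    filter_upwards [self_mem_nhdsWithin] with t ht
    have ht' : (0 : ℝ) < t := ht
    rw [show (1 : ℝ) - 2 * σ = -(2 * σ - 1) by ring, Real.rpow_neg ht'.le]
    have : 0 < t ^ (2 * σ - 1) := Real.rpow_pos_of_pos ht _
    field_simp

end

/-! ### Changes of variables -/

section ChangeOfVariables

variable {n : ℕ} {U : Pt n → ℝ} {X : Pt n}

/-- The Euclidean inner product on `ℝ^{n+1}`. -/
def ip (X Y : Pt n) : ℝ := ⟪X.1, Y.1⟫ + X.2 * Y.2

lemma ip_bv_none (Z : Pt n) : ip (bv none) Z = Z.2 := by simp [ip, bv]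

lemma ip_bv_some (i : Fin n) (Z : Pt n) : ip (bv (some i)) Z = Z.1 i := by
  simp [ip, bv, EuclideanSpace.inner_single_left]

lemma sum_ip_smul_bv (Z : Pt n) : ∑ o, ip (bv o) Z • bv o = Z := by
  rw [Fintype.sum_option]
  simp only [ip_bv_none, ip_bv_some]
  refine Prod.ext ?_ ?_
  · simp only [bv, Option.elim, Prod.fst_add, Prod.fst_sum, Prod.smul_fst, smul_zero, zero_add]
    ext j
    simp [Finset.sum_apply, Pi.single_apply]
  · simp [bv, Prod.snd_sum]

lemma sum_ip_sq (Z : Pt n) : ∑ o, ip (bv o) Z ^ 2 = ‖Z.1‖ ^ 2 + Z.2 ^ 2 := by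
  rw [Fintype.sum_option]
  simp only [ip_bv_none, ip_bv_some, EuclideanSpace.norm_sq_eq, Real.norm_eq_abs, sq_abs]
  ring

lemma sum_reflected (B : Pt n →L[ℝ] Pt n →L[ℝ] ℝ) (Z : Pt n) {k : ℝ}
    (hk : k * (‖Z.1‖ ^ 2 + Z.2 ^ 2) = 2) :
    ∑ o, B (bv o - (k * ip (bv o) Z) • Z) (bv o - (k * ip (bv o) Z) • Z) =
      ∑ o, B (bv o) (bv o) := by
  have h1 : ∑ o, ip (bv o) Z * B (bv o) Z = B Z Z := by
    conv_rhs => rw [← congrArg (fun W => B W Z) (sum_ip_smul_bv Z)]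
    simp [map_sum]
  have h2 : ∑ o, ip (bv o) Z * B Z (bv o) = B Z Z := by
    conv_rhs => rw [← congrArg (fun W => B Z W) (sum_ip_smul_bv Z)]
    simp only [map_sum, map_smul, smul_eq_mul]
  have h3 : ∀ o, B (bv o - (k * ip (bv o) Z) • Z) (bv o - (k * ip (bv o) Z) • Z) =
      B (bv o) (bv o) - k * (ip (bv o) Z * B (bv o) Z) - k * (ip (bv o) Z * B Z (bv o))
        + k ^ 2 * B Z Z * ip (bv o) Z ^ 2 := by
    intro o
    simp only [map_sub, map_smul, sub_apply, smul_apply,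
      smul_eq_mul]
    ring
  simp only [h3, Finset.sum_add_distrib, Finset.sum_sub_distrib, ← Finset.mul_sum, h1, h2,
    sum_ip_sq]
  linear_combination k * B Z Z * hk

lemma line_comp_map {I : Pt n → Pt n} {v : Pt n} {φ' : ℝ → Pt n}
    (hU : ContDiffAt ℝ 2 U (I X))
    (h0 : HasDerivAt (fun s : ℝ => I (X + s • v)) (φ' 0) 0)
    (h1 : ∀ᶠ s in 𝓝 (0 : ℝ), HasDerivAt (fun s : ℝ => I (X + s • v)) (φ' s) s) :
    ∀ᶠ s in 𝓝 (0 : ℝ), HasDerivAt (fun s : ℝ => U (I (X + s • v)))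
      (fderiv ℝ U (I (X + s • v)) (φ' s)) s := by
  have ht : Tendsto (fun s : ℝ => I (X + s • v)) (𝓝 0) (𝓝 (I X)) := by
    simpa using h0.continuousAt.tendsto
  filter_upwards [h1, ht.eventually hU.eventually_hasFDerivAt] with s hs1 hs2
  exact hs2.comp_hasDerivAt s hs1

lemma d2_comp_map {I : Pt n → Pt n} {v : Pt n} {φ' : ℝ → Pt n} {φ'' : Pt n}
    (hU : ContDiffAt ℝ 2 U (I X)) (hUI : ContDiffAt ℝ 2 (fun Y => U (I Y)) X)
    (h1 : ∀ᶠ s in 𝓝 (0 : ℝ), HasDerivAt (fun s : ℝ => I (X + s • v)) (φ' s) s)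
    (h2 : HasDerivAt φ' φ'' 0) :
    d2 (fun Y => U (I Y)) X v =
      fderiv ℝ (fderiv ℝ U) (I X) (φ' 0) (φ' 0) + fderiv ℝ U (I X) φ'' := by
  have h0 := h1.self_of_nhds
  refine d2_eq_of_line hUI (line_comp_map hU h0 h1) ?_
  have hI : I X = I (X + (0 : ℝ) • v) := by simp
  have h3 := hU.hasFDerivAt_fderiv
  rw [hI] at h3
  have h4 : HasDerivAt (fun s : ℝ => fderiv ℝ U (I (X + s • v)))
      (fderiv ℝ (fderiv ℝ U) (I (X + (0 : ℝ) • v)) (φ' 0)) 0 := h3.comp_hasDerivAt (0 : ℝ) h0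
  rw [hI]
  exact h4.clm_apply h2

lemma fderiv_comp_map {I : Pt n → Pt n} {v : Pt n} {φ' : ℝ → Pt n}
    (hU : ContDiffAt ℝ 2 U (I X)) (hUI : ContDiffAt ℝ 2 (fun Y => U (I Y)) X)
    (h1 : ∀ᶠ s in 𝓝 (0 : ℝ), HasDerivAt (fun s : ℝ => I (X + s • v)) (φ' s) s) :
    fderiv ℝ (fun Y => U (I Y)) X v = fderiv ℝ U (I X) (φ' 0) := by
  rw [fderiv_eq_of_line hUI (line_comp_map hU h1.self_of_nhds h1)]
  simp

/-- Reflection in the hyperplane through `c` orthogonal to the unit vector `e`. -/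
def mirror (c e : EuclideanSpace ℝ (Fin n)) (X : Pt n) : Pt n :=
  (X.1 - (2 * ⟪X.1 - c, e⟫) • e, X.2)

variable {c e : EuclideanSpace ℝ (Fin n)}

lemma contDiff_mirror : ContDiff ℝ 2 (mirror c e) := by
  unfold mirror
  exact (contDiff_fst.sub ((contDiff_const.mul
    ((contDiff_fst.sub contDiff_const).inner ℝ contDiff_const)).smul contDiff_const)).prodMk
    contDiff_snd

lemma sqd_mirror (he : ‖e‖ = 1) (X : Pt n) : sqd c 0 (mirror c e X) = sqd c 0 X := by
  have h : X.1 - (2 * ⟪X.1 - c, e⟫) • e - c = (X.1 - c) - (2 * ⟪X.1 - c, e⟫) • e := by abel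
  simp only [sqd, mirror]
  rw [h, norm_sub_sq_real, norm_smul, inner_smul_right, he, Real.norm_eq_abs, mul_one, sq_abs]
  ring

lemma Lop_mirror (σ : ℝ) (he : ‖e‖ = 1) (hU : ContDiffAt ℝ 2 U (mirror c e X)) :
    Lop σ (fun Y => U (mirror c e Y)) X = Lop σ U (mirror c e X) := by
  have hUI : ContDiffAt ℝ 2 (fun Y => U (mirror c e Y)) X := hU.comp X contDiff_mirror.contDiffAt
  set Z : Pt n := (e, 0) with hZ
  have hl : ∀ v : Pt n, ∀ s : ℝ, HasDerivAt (fun s : ℝ => mirror c e (X + s • v))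
      (v - (2 * ip v Z) • Z) s := by
    intro v s
    have : (fun s : ℝ => mirror c e (X + s • v)) =
        fun s : ℝ => mirror c e X + s • (v - (2 * ip v Z) • Z) := by
      ext1 s
      refine Prod.ext ?_ ?_
      · simp only [mirror, hZ, ip, Prod.fst_add, Prod.smul_fst, Prod.fst_sub, inner_add_left,
          inner_sub_left, inner_smul_left, mul_zero, add_zero, RCLike.conj_to_real]
        module
      · simp [mirror, hZ]
    rw [this]
    exact hasDerivAt_line _ _ s
  have hdt : dt (fun Y => U (mirror c e Y)) X = dt U (mirror c e X) := by
    rw [dt, fderiv_comp_map hU hUI (Eventually.of_forall (hl _)), dt]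
    simp [ip, hZ]
  have h2 : ∀ v, d2 (fun Y => U (mirror c e Y)) X v = fderiv ℝ (fderiv ℝ U) (mirror c e X)
      (v - (2 * ip v Z) • Z) (v - (2 * ip v Z) • Z) := by
    intro v
    rw [d2_comp_map hU hUI (Eventually.of_forall (hl v)) (hasDerivAt_const _ _)]
    simp
  simp only [Lop, lapl_eq_sum, hdt, h2]
  rw [sum_reflected _ Z (by simp [hZ, he])]
  simp only [d2_eq hU]
  rfl

lemma Lop_two_var (σ : ℝ) (he : ‖e‖ = 1) {g : ℝ → ℝ → ℝ} {g₁ g₂ : ℝ → ℝ} {g₁₁ g₂₂ : ℝ}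
    (hU : ContDiffAt ℝ 2 (fun Y : Pt n => g ⟪Y.1 - c, e⟫ Y.2) X)
    (h1 : ∀ᶠ x in 𝓝 ⟪X.1 - c, e⟫, HasDerivAt (fun x => g x X.2) (g₁ x) x)
    (h11 : HasDerivAt g₁ g₁₁ ⟪X.1 - c, e⟫)
    (h2 : ∀ᶠ t in 𝓝 X.2, HasDerivAt (fun t => g ⟪X.1 - c, e⟫ t) (g₂ t) t)
    (h22 : HasDerivAt g₂ g₂₂ X.2) :
    Lop σ (fun Y : Pt n => g ⟪Y.1 - c, e⟫ Y.2) X =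
      g₁₁ + g₂₂ + (1 - 2 * σ) / X.2 * g₂ X.2 := by
  set ξ := ⟪X.1 - c, e⟫ with hξ
  have hvert : ∀ᶠ s in 𝓝 (0 : ℝ), HasDerivAt
      (fun s : ℝ => (fun Y : Pt n => g ⟪Y.1 - c, e⟫ Y.2) (X + s • ((0, 1) : Pt n)))
      (g₂ (X.2 + s)) s := by
    have ht : Tendsto (fun s : ℝ => X.2 + s) (𝓝 0) (𝓝 X.2) := by
      simpa using (continuous_const_add X.2).tendsto 0
    filter_upwards [ht.eventually h2] with s hs
    simpa using hs.comp_const_add X.2 s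
  have h22' : HasDerivAt (fun s : ℝ => g₂ (X.2 + s)) g₂₂ 0 := by
    apply HasDerivAt.comp_const_add; simpa using h22
  have hi : ∀ i : Fin n, d2 (fun Y : Pt n => g ⟪Y.1 - c, e⟫ Y.2) X (bv (some i)) =
      e i ^ 2 * g₁₁ := by
    intro i
    have hlin : ∀ s : ℝ, ⟪(X + s • bv (some i)).1 - c, e⟫ = ξ + s * e i := by
      intro s
      simp only [bv, Option.elim, Prod.fst_add, Prod.smul_fst, add_sub_right_comm, inner_add_left,
        inner_smul_left, EuclideanSpace.inner_single_left, hξ]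
      simp
    have hd : ∀ s : ℝ, HasDerivAt (fun s : ℝ => ξ + s * e i) (e i) s := fun s => by
      simpa using ((hasDerivAt_id s).mul_const (e i)).const_add ξ
    have ht : Tendsto (fun s : ℝ => ξ + s * e i) (𝓝 0) (𝓝 ξ) := by
      simpa using (hd 0).continuousAt.tendsto
    refine d2_eq_of_line hU (f' := fun s => e i * g₁ (ξ + s * e i)) ?_ ?_
    · filter_upwards [ht.eventually h1] with s hs
      have := hs.comp s (hd s)
      simp only [hlin]
      rw [mul_comm]
      simpa [bv, Function.comp_def] using this
    · have h0 : HasDerivAt g₁ g₁₁ (ξ + 0 * e i) := by simpa using h11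
      refine ((h0.comp (0 : ℝ) (hd 0)).const_mul (e i)).congr_deriv ?_
      ring
  have hsum : ∑ i, e i ^ 2 = 1 := by
    have := EuclideanSpace.norm_sq_eq e
    simp only [he, Real.norm_eq_abs, sq_abs] at this
    linarith
  rw [Lop, lapl_eq_sum, Fintype.sum_option, dt, fderiv_eq_of_line hU hvert,
    show bv (none : Option (Fin n)) = (0, 1) from rfl, d2_eq_of_line hU hvert h22']
  simp only [hi, ← Finset.sum_mul, hsum]
  simp
  ring

end ChangeOfVariables

/-! ### A Hölder estimate for differences under reflections -/

section Edge

/-- A corner profile used in the barrier for odd reflections. -/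
def edge (σ β x t : ℝ) : ℝ := x ^ β * t ^ (2 * σ) * (x ^ 2 + t ^ 2) ^ (-σ)

variable {n : ℕ} {σ β x t : ℝ}

lemma rpow_two_mul_div_le_one (hσ : 0 < σ) (ht : 0 ≤ t) :
    t ^ (2 * σ) * (x ^ 2 + t ^ 2) ^ (-σ) ≤ 1 := by
  have h1 : t ^ (2 * σ) = (t ^ 2) ^ σ := by rw [Real.rpow_mul ht, Real.rpow_two]
  rw [h1, Real.rpow_neg (by positivity), ← div_eq_mul_inv]
  refine div_le_one_of_le₀ ?_ (by positivity)
  exact Real.rpow_le_rpow (by positivity) (by nlinarith [sq_nonneg x]) hσ.le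

lemma edge_nonneg (hx : 0 ≤ x) (ht : 0 ≤ t) : 0 ≤ edge σ β x t := by
  unfold edge; positivity

lemma edge_le (hσ : 0 < σ) (hx : 0 ≤ x) (ht : 0 ≤ t) : edge σ β x t ≤ x ^ β := by
  rw [edge, mul_assoc]
  exact mul_le_of_le_one_right (by positivity) (rpow_two_mul_div_le_one hσ ht)

lemma hasDerivAt_edge_left (hx : 0 < x) :
    HasDerivAt (fun x => edge σ β x t) (edge σ β x t * (β / x - 2 * σ * x / (x ^ 2 + t ^ 2))) x := by
  have hρ : 0 < x ^ 2 + t ^ 2 := by positivity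
  have h1 : HasDerivAt (fun x : ℝ => x ^ β) (β * x ^ (β - 1)) x :=
    Real.hasDerivAt_rpow_const (Or.inl hx.ne')
  have h2 : HasDerivAt (fun x : ℝ => x ^ 2 + t ^ 2) (2 * x) x := by
    simpa using (hasDerivAt_pow 2 x).add_const (t ^ 2)
  have h3 := h2.rpow_const (p := -σ) (Or.inl hρ.ne')
  refine ((h1.mul_const (t ^ (2 * σ))).mul h3).congr_deriv ?_
  rw [Real.rpow_sub_one hx.ne', Real.rpow_sub_one hρ.ne', edge]
  field_simp
  ring

lemma hasDerivAt_edge_right (hx : 0 < x) (ht : 0 < t) :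
    HasDerivAt (fun t => edge σ β x t)
      (edge σ β x t * (2 * σ / t - 2 * σ * t / (x ^ 2 + t ^ 2))) t := by
  have hρ : 0 < x ^ 2 + t ^ 2 := by positivity
  have h1 : HasDerivAt (fun t : ℝ => t ^ (2 * σ)) (2 * σ * t ^ (2 * σ - 1)) t :=
    Real.hasDerivAt_rpow_const (Or.inl ht.ne')
  have h2 : HasDerivAt (fun t : ℝ => x ^ 2 + t ^ 2) (2 * t) t := by
    simpa using (hasDerivAt_pow 2 t).const_add (x ^ 2)
  have h3 := h2.rpow_const (p := -σ) (Or.inl hρ.ne')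
  refine ((h1.const_mul (x ^ β)).mul h3).congr_deriv ?_
  rw [Real.rpow_sub_one ht.ne', Real.rpow_sub_one hρ.ne', edge]
  field_simp
  ring

variable {c e : EuclideanSpace ℝ (Fin n)} {X : Pt n}

lemma continuous_height : Continuous (fun X : Pt n => ⟪X.1 - c, e⟫) := by fun_prop

lemma contDiffAt_edge (hx : 0 < ⟪X.1 - c, e⟫) (ht : 0 < X.2) :
    ContDiffAt ℝ 2 (fun Y : Pt n => edge σ β ⟪Y.1 - c, e⟫ Y.2) X := by
  have h1 : ContDiffAt ℝ 2 (fun Y : Pt n => ⟪Y.1 - c, e⟫) X :=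
    ((contDiff_fst.sub contDiff_const).inner ℝ contDiff_const).contDiffAt
  unfold edge
  refine ((h1.rpow_const_of_ne hx.ne').mul (contDiffAt_rpow_t _ ht)).mul
    (((h1.pow 2).add (contDiffAt_snd.pow 2)).rpow_const_of_ne ?_)
  positivity

lemma contDiffAt_height_rpow (hx : 0 < ⟪X.1 - c, e⟫) :
    ContDiffAt ℝ 2 (fun Y : Pt n => ⟪Y.1 - c, e⟫ ^ β) X :=
  ((contDiff_fst.sub contDiff_const).inner ℝ contDiff_const).contDiffAt.rpow_const_of_ne hx.ne'

lemma Lop_height_rpow (he : ‖e‖ = 1) (hx : 0 < ⟪X.1 - c, e⟫) :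
    Lop σ (fun Y : Pt n => ⟪Y.1 - c, e⟫ ^ β) X = β * (β - 1) * ⟪X.1 - c, e⟫ ^ (β - 2) := by
  rw [Lop_two_var σ he (g := fun x _ => x ^ β) (g₁ := fun x => β * x ^ (β - 1)) (g₂ := fun _ => 0)
    (g₁₁ := β * ((β - 1) * ⟪X.1 - c, e⟫ ^ (β - 1 - 1))) (g₂₂ := 0) (contDiffAt_height_rpow hx)]
  · rw [show β - 1 - 1 = β - 2 by ring]; ring
  · filter_upwards [lt_mem_nhds hx] with y hy
    exact Real.hasDerivAt_rpow_const (Or.inl hy.ne')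
  · exact (Real.hasDerivAt_rpow_const (Or.inl hx.ne')).const_mul _
  · exact Eventually.of_forall fun t => hasDerivAt_const t _
  · exact hasDerivAt_const _ _

lemma Lop_edge (he : ‖e‖ = 1) (hx : 0 < ⟪X.1 - c, e⟫) (ht : 0 < X.2) :
    Lop σ (fun Y : Pt n => edge σ β ⟪Y.1 - c, e⟫ Y.2) X =
      edge σ β ⟪X.1 - c, e⟫ X.2 * (β * (β - 1) / ⟪X.1 - c, e⟫ ^ 2
        - (2 * σ + 4 * σ * β) / (⟪X.1 - c, e⟫ ^ 2 + X.2 ^ 2)) := by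
  have hU := contDiffAt_edge (σ := σ) (β := β) hx ht
  set x := ⟪X.1 - c, e⟫
  set t := X.2
  have hρ : 0 < x ^ 2 + t ^ 2 := by positivity
  have hx2 : HasDerivAt (fun x : ℝ => x ^ 2 + t ^ 2) (2 * x) x := by
    simpa using (hasDerivAt_pow 2 x).add_const (t ^ 2)
  have ht2 : HasDerivAt (fun t : ℝ => x ^ 2 + t ^ 2) (2 * t) t := by
    simpa using (hasDerivAt_pow 2 t).const_add (x ^ 2)
  have h11 := (hasDerivAt_edge_left (σ := σ) (β := β) (t := t) hx).mul
    (((hasDerivAt_const x β).div (hasDerivAt_id x) hx.ne').sub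
      (((hasDerivAt_id x).const_mul (2 * σ)).div hx2 hρ.ne'))
  have h22 := (hasDerivAt_edge_right (σ := σ) (β := β) hx ht).mul
    (((hasDerivAt_const t (2 * σ)).div (hasDerivAt_id t) ht.ne').sub
      (((hasDerivAt_id t).const_mul (2 * σ)).div ht2 hρ.ne'))
  rw [Lop_two_var σ he (g := edge σ β) hU ?_ h11 ?_ h22]
  · have htX : X.2 = t := rfl
    simp only [Pi.sub_apply, Pi.div_apply, Pi.mul_apply, id, htX]
    field_simp
    ring
  · filter_upwards [lt_mem_nhds hx] with y hy using hasDerivAt_edge_left hy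
  · filter_upwards [lt_mem_nhds ht] with y hy using hasDerivAt_edge_right hx hy

lemma fluxAt_edge (hσ : σ ∈ Set.Ioo (0 : ℝ) 1) {y : EuclideanSpace ℝ (Fin n)}
    (hx : 0 < ⟪y - c, e⟫) :
    FluxAt σ (fun Y : Pt n => edge σ β ⟪Y.1 - c, e⟫ Y.2) y (⟪y - c, e⟫ ^ (β - 2 * σ)) := by
  set x := ⟪y - c, e⟫ with hxdef
  have h1 : Tendsto (fun t : ℝ => x ^ β * (x ^ 2 + t ^ 2) ^ (-σ)) (𝓝[>] 0)
      (𝓝 (x ^ β * (x ^ 2 + 0 ^ 2) ^ (-σ))) := by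
    have : ContinuousAt (fun t : ℝ => x ^ β * (x ^ 2 + t ^ 2) ^ (-σ)) 0 := by
      refine continuousAt_const.mul (ContinuousAt.rpow_const (by fun_prop) (Or.inl ?_))
      positivity
    exact this.tendsto.mono_left nhdsWithin_le_nhds
  have h2 : x ^ β * (x ^ 2 + 0 ^ 2) ^ (-σ) = x ^ (β - 2 * σ) := by
    rw [Real.rpow_sub hx, zero_pow two_ne_zero, add_zero, Real.rpow_neg (by positivity),
      Real.rpow_mul hx.le, Real.rpow_two, div_eq_mul_inv]
  rw [h2] at h1
  refine h1.congr' ?_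
  filter_upwards [self_mem_nhdsWithin] with t ht
  have : 0 < t ^ (2 * σ) := Real.rpow_pos_of_pos ht _
  have h0 : (0 : ℝ) ^ (2 * σ) = 0 := Real.zero_rpow (by have := hσ.1; positivity)
  simp only [edge, h0, ← hxdef]
  rw [mul_zero, zero_mul, sub_zero, eq_div_iff this.ne']
  ring

lemma continuousOn_edge (hσ : 0 < σ) (hβ : 0 < β) :
    ContinuousOn (fun Y : Pt n => edge σ β ⟪Y.1 - c, e⟫ Y.2) {Y | 0 ≤ ⟪Y.1 - c, e⟫ ∧ 0 ≤ Y.2} := by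
  intro X hX
  rcases hX.1.eq_or_lt with h0 | hx
  · have hz : edge σ β ⟪X.1 - c, e⟫ X.2 = 0 := by
      rw [edge, ← h0, Real.zero_rpow hβ.ne']; ring
    rw [ContinuousWithinAt, hz]
    have h1 : ContinuousAt (fun Y : Pt n => ⟪Y.1 - c, e⟫ ^ β) X :=
      continuous_height.continuousAt.rpow_const (Or.inr hβ.le)
    have h2 := h1.tendsto.mono_left
      (nhdsWithin_le_nhds (s := {Y : Pt n | 0 ≤ ⟪Y.1 - c, e⟫ ∧ 0 ≤ Y.2}))
    rw [← h0, Real.zero_rpow hβ.ne'] at h2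
    refine squeeze_zero' ?_ ?_ h2
    · filter_upwards [self_mem_nhdsWithin] with Y hY using edge_nonneg hY.1 hY.2
    · filter_upwards [self_mem_nhdsWithin] with Y hY using edge_le hσ hY.1 hY.2
  · refine ContinuousAt.continuousWithinAt ?_
    unfold edge
    have h1 : ContinuousAt (fun Y : Pt n => ⟪Y.1 - c, e⟫) X := continuous_height.continuousAt
    have h2 : ContinuousAt (fun Y : Pt n => Y.2) X := continuousAt_snd
    refine ((h1.rpow_const (Or.inl hx.ne')).mul (h2.rpow_const (Or.inr (by positivity)))).mul
      (((h1.pow 2).add (h2.pow 2)).rpow_const (Or.inl ?_))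
    change ⟪X.1 - c, e⟫ ^ 2 + X.2 ^ 2 ≠ 0
    positivity

lemma Lop_barrier_le (hσ : 0 < σ) (hβ : β ∈ Set.Ioo (0 : ℝ) 1) (he : ‖e‖ = 1)
    (hx : 0 < ⟪X.1 - c, e⟫) (ht : 0 < X.2) :
    Lop σ (fun Y : Pt n => (1 + (2 * σ + 4 * σ * β + 1) / (β * (1 - β))) * ⟪Y.1 - c, e⟫ ^ β
      - edge σ β ⟪Y.1 - c, e⟫ Y.2) X ≤ -⟪X.1 - c, e⟫ ^ (β - 2) := by
  obtain ⟨hβ0, hβ1⟩ := hβ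
  have c1 := contDiffAt_height_rpow (β := β) hx
  rw [Lop_sub σ (contDiffAt_const.mul c1) (contDiffAt_edge hx ht), Lop_const_mul σ _ c1,
    Lop_height_rpow he hx, Lop_edge he hx ht]
  have hq := edge_le (β := β) (x := ⟪X.1 - c, e⟫) hσ hx.le ht.le
  have hq0 := edge_nonneg (σ := σ) (β := β) hx.le ht.le
  set x := ⟪X.1 - c, e⟫
  set q := edge σ β x X.2
  have hx2 : x ^ (β - 2) = x ^ β / x ^ 2 := by rw [Real.rpow_sub hx, Real.rpow_two]
  have h1 : q * (β * (1 - β) / x ^ 2 + (2 * σ + 4 * σ * β) / (x ^ 2 + X.2 ^ 2)) ≤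
      x ^ β * (β * (1 - β) / x ^ 2 + (2 * σ + 4 * σ * β) / x ^ 2) := by
    have : 0 < 1 - β := by linarith
    gcongr
    nlinarith [sq_nonneg X.2]
  have h2 : (1 + (2 * σ + 4 * σ * β + 1) / (β * (1 - β))) * (β * (β - 1) * x ^ (β - 2)) =
      -(β * (1 - β) + (2 * σ + 4 * σ * β + 1)) * (x ^ β / x ^ 2) := by
    have : 1 - β ≠ 0 := by linarith
    rw [hx2]; field_simp; ring
  rw [h2, hx2]
  have h3 : q * (β * (β - 1) / x ^ 2 - (2 * σ + 4 * σ * β) / (x ^ 2 + X.2 ^ 2)) =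
    -(q * (β * (1 - β) / x ^ 2 + (2 * σ + 4 * σ * β) / (x ^ 2 + X.2 ^ 2))) := by ring
  rw [h3]
  have h4 : x ^ β * (β * (1 - β) / x ^ 2 + (2 * σ + 4 * σ * β) / x ^ 2) =
    (β * (1 - β) + (2 * σ + 4 * σ * β)) * (x ^ β / x ^ 2) := by ring
  linarith

end Edge

section ReflectionEstimate

variable {n : ℕ} {σ : ℝ} {U : Pt n → ℝ}

lemma sqd_nonneg (c : EuclideanSpace ℝ (Fin n)) (τ : ℝ) (X : Pt n) : 0 ≤ sqd c τ X := by
  unfold sqd; positivity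

lemma norm_sub_le_of_sqd {c : EuclideanSpace ℝ (Fin n)} {X : Pt n} {a : ℝ} (ha : 0 ≤ a)
    (h : sqd c 0 X ≤ a ^ 2) : ‖X.1 - c‖ ≤ a :=
  abs_le_of_sq_le_sq' (by simp only [sqd] at h; nlinarith [sq_nonneg (X.2 - 0)]) ha |>.2

lemma abs_le_of_sqd {c : EuclideanSpace ℝ (Fin n)} {X : Pt n} {a : ℝ} (ha : 0 ≤ a)
    (h : sqd c 0 X ≤ a ^ 2) : |X.2| ≤ a :=
  abs_le_of_sq_le_sq (by simp only [sqd, sub_zero] at h; nlinarith [sq_nonneg ‖X.1 - c‖]) ha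

lemma sqd_triangle {c c' : EuclideanSpace ℝ (Fin n)} {X : Pt n} {a b : ℝ} (ha : 0 ≤ a)
    (h : sqd c 0 X ≤ a ^ 2) (hb : ‖c - c'‖ ≤ b) : sqd c' 0 X ≤ (a + b) ^ 2 := by
  have h1 := norm_sub_le_of_sqd ha h
  have h2 : ‖X.1 - c'‖ ≤ ‖X.1 - c‖ + b := (norm_sub_le_norm_sub_add_norm_sub _ c _).trans (by gcongr)
  have h0 : 0 ≤ b := (norm_nonneg _).trans hb
  simp only [sqd, sub_zero] at *
  nlinarith [norm_nonneg (X.1 - c'), norm_nonneg (X.1 - c), mul_le_mul_of_nonneg_right h1 h0]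

lemma isCompact_halfBall (c : EuclideanSpace ℝ (Fin n)) (r : ℝ) :
    IsCompact {X : Pt n | sqd c 0 X ≤ r ∧ 0 ≤ X.2} := by
  refine Metric.isCompact_of_isClosed_isBounded ((isClosed_le (continuous_sqd c 0)
    continuous_const).inter (isClosed_le continuous_const continuous_snd)) ?_
  rw [Metric.isBounded_iff_subset_closedBall (c, 0)]
  refine ⟨√r, fun X hX => ?_⟩
  have hr : 0 ≤ r := (sqd_nonneg c 0 X).trans hX.1
  have h : sqd c 0 X ≤ √r ^ 2 := by rw [Real.sq_sqrt hr]; exact hX.1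
  rw [Metric.mem_closedBall, Prod.dist_eq, dist_eq_norm, Real.dist_eq, sub_zero]
  exact max_le (norm_sub_le_of_sqd (Real.sqrt_nonneg r) h) (abs_le_of_sqd (Real.sqrt_nonneg r) h)

lemma FluxAt.mirror {c e y : EuclideanSpace ℝ (Fin n)} {l : ℝ}
    (h : FluxAt σ U (mirror c e (y, 0)).1 l) : FluxAt σ (fun Y => U (mirror c e Y)) y l := h

lemma Sol.exists_radius {x : EuclideanSpace ℝ (Fin n)} (hx : ‖x‖ < 2) (hx0 : x ≠ 0) :
    ∃ r > 0, r ≤ 1 / 2 ∧ ∀ X : Pt n, sqd x 0 X ≤ (2 * r) ^ 2 → sqd 0 0 X < 4 ∧ X.1 ≠ 0 := by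
  have h0 : 0 < ‖x‖ := norm_pos_iff.2 hx0
  refine ⟨min (1 / 2) (min (‖x‖ / 4) ((2 - ‖x‖) / 4)), ?_, min_le_left _ _, ?_⟩
  · refine lt_min (by norm_num) (lt_min (by linarith) (by linarith))
  set r := min (1 / 2) (min (‖x‖ / 4) ((2 - ‖x‖) / 4)) with hr
  have hr1 : r ≤ ‖x‖ / 4 := (min_le_right _ _).trans (min_le_left _ _)
  have hr2 : r ≤ (2 - ‖x‖) / 4 := (min_le_right _ _).trans (min_le_right _ _)
  have hr0 : 0 < r := lt_min (by norm_num) (lt_min (by linarith) (by linarith))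
  intro X hX
  refine ⟨?_, fun h => ?_⟩
  · have h1 := sqd_triangle (c' := 0) (b := ‖x‖) (by linarith) hX (by simp)
    nlinarith
  · have h1 := norm_sub_le_of_sqd (by linarith) hX
    rw [h, zero_sub, norm_neg] at h1
    linarith

lemma Sol.two_n_pos (S : Sol n σ U) : 0 < (n : ℝ) - 2 * σ := by
  have h1 : (2 : ℝ) ≤ n := by exact_mod_cast S.two_le
  have := S.mem_Ioo.2
  linarith

lemma Sol.pexp_pos (S : Sol n σ U) : 0 < pexp n σ := by
  have h1 := S.two_n_pos
  have := S.mem_Ioo.1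
  have : (0 : ℝ) ≤ n := Nat.cast_nonneg n
  unfold pexp
  positivity

/-- Differences of `U` under reflections are controlled by a power of the distance to the
hyperplane which is better than `σ`. -/
lemma Sol.mirror_estimate (S : Sol n σ U) {x : EuclideanSpace ℝ (Fin n)} (hx : ‖x‖ < 2)
    (hx0 : x ≠ 0) : ∃ C : ℝ, ∃ r > 0, ∀ c e : EuclideanSpace ℝ (Fin n), ‖c - x‖ ≤ r → ‖e‖ = 1 →
      ∀ s t : ℝ, 0 ≤ s → 0 ≤ t → s ^ 2 + t ^ 2 ≤ r ^ 2 →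
        U (c + s • e, t) - U (c - s • e, t) ≤ C * (s ^ (2 * σ / (1 + σ)) + s ^ 2 + t ^ 2) := by
  obtain ⟨hσ0, hσ1⟩ := S.mem_Ioo
  obtain ⟨r, hr0, hr12, hr⟩ := Sol.exists_radius hx hx0
  set K₀ := {X : Pt n | sqd x 0 X ≤ (2 * r) ^ 2 ∧ 0 ≤ X.2} with hK₀
  have hne : ∀ X ∈ K₀, X ≠ 0 := fun X hX h => (hr X hX.1).2 (by rw [h]; rfl)
  have hcK : ContinuousOn U K₀ :=
    S.cont.mono fun X hX => ⟨(hr X hX.1).1.le, hX.2, hne X hX⟩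
  obtain ⟨M, hM⟩ := (isCompact_halfBall x ((2 * r) ^ 2)).bddAbove_image hcK
  have hUM : ∀ X ∈ K₀, U X ≤ M := fun X hX => hM (Set.mem_image_of_mem U hX)
  have hU0 : ∀ X ∈ K₀, 0 ≤ U X := fun X hX => S.nonneg X (hr X hX.1).1.le hX.2 (hne X hX)
  have hM0 : 0 ≤ M := by
    have hx' : (x, (0 : ℝ)) ∈ K₀ := ⟨by simp [sqd]; positivity, le_rfl⟩
    exact (hU0 _ hx').trans (hUM _ hx')
  set β : ℝ := 2 * σ / (1 + σ) with hβ
  have hβ0 : 0 < β := by positivity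
  have hβ1 : β < 1 := by rw [hβ, div_lt_one (by linarith)]; linarith
  have hβ2 : β ≤ 2 * σ := div_le_self (by linarith) (by linarith)
  set p := pexp n σ with hp
  have hp0 : 0 < p := S.pexp_pos
  set Cb : ℝ := 1 + (2 * σ + 4 * σ * β + 1) / (β * (1 - β)) with hCb
  have hCb1 : 1 ≤ Cb := by
    have : 0 < 1 - β := by linarith
    rw [hCb]; have : 0 ≤ (2 * σ + 4 * σ * β + 1) / (β * (1 - β)) := by positivity
    linarith
  set N : ℝ := M / r ^ 2 with hN
  have hN0 : 0 ≤ N := by positivity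
  have hn2 : (2 : ℝ) ≤ n := by exact_mod_cast S.two_le
  set A : ℝ := M ^ p / (2 * σ) + N * (2 * (n + 2 - 2 * σ)) with hA
  have hA1 : 0 ≤ M ^ p / (2 * σ) := by positivity
  have hA2 : 0 ≤ N * (2 * (n + 2 - 2 * σ)) := mul_nonneg hN0 (by linarith)
  have hA0 : 0 ≤ A := by linarith
  refine ⟨A * Cb + N, r, hr0, fun c e hc he s t hs ht hst => ?_⟩
  set K := {X : Pt n | sqd c 0 X ≤ r ^ 2 ∧ 0 ≤ X.2} ∩ {X | 0 ≤ ⟪X.1 - c, e⟫} with hK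
  have hKK₀ : ∀ X, sqd c 0 X ≤ r ^ 2 → 0 ≤ X.2 → X ∈ K₀ := fun X h1 h2 =>
    ⟨(sqd_triangle hr0.le h1 hc).trans (by rw [two_mul]), h2⟩
  have hKm : ∀ X ∈ K, mirror c e X ∈ K₀ := fun X hX =>
    hKK₀ _ (by rw [sqd_mirror he]; exact hX.1.1) hX.1.2
  have hKK : ∀ X ∈ K, X ∈ K₀ := fun X hX => hKK₀ _ hX.1.1 hX.1.2
  have hKh : ∀ X ∈ K, ⟪X.1 - c, e⟫ ≤ 1 / 2 := fun X hX => by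
    have h1 := norm_sub_le_of_sqd hr0.le hX.1.1
    have h2 := real_inner_le_norm (X.1 - c) e
    rw [he, mul_one] at h2
    linarith
  set b : Pt n → ℝ := fun Y => Cb * ⟪Y.1 - c, e⟫ ^ β - edge σ β ⟪Y.1 - c, e⟫ Y.2 with hb
  have hb0 : ∀ X ∈ K, 0 ≤ b X ∧ b X ≤ Cb * ⟪X.1 - c, e⟫ ^ β := fun X hX => by
    have h1 := edge_le (β := β) hσ0 hX.2 hX.1.2
    have h2 := edge_nonneg (σ := σ) (β := β) hX.2 hX.1.2
    have h3 : 0 ≤ ⟪X.1 - c, e⟫ ^ β := Real.rpow_nonneg hX.2 _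
    simp only [hb]
    constructor <;> nlinarith
  have hmain : ∀ X ∈ K, X ≠ 0 →
      0 ≤ (A * b X + N * sqd c 0 X) - (U X - U (mirror c e X)) := by
    refine nonneg_of_superAt (B := M) S.two_le S.mem_Ioo
      ((isCompact_halfBall c (r ^ 2)).inter_right (isClosed_le continuous_const continuous_height))
      ?_ ?_ ?_ ?_
    · intro X hX
      have h1 := abs_le_of_sqd hr0.le hX.1.1
      exact ⟨hX.1.2, by linarith [le_abs_self X.2]⟩
    · have c1 : ContinuousOn (fun X => U (mirror c e X)) K :=
        hcK.comp contDiff_mirror.continuous.continuousOn hKm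
      have c2 : ContinuousOn b K := by
        refine (continuousOn_const.mul ?_).sub
          ((continuousOn_edge hσ0 hβ0).mono fun X hX => ⟨hX.2, hX.1.2⟩)
        exact continuous_height.continuousOn.rpow_const fun X hX => Or.inr hβ0.le
      refine ContinuousOn.mono (s := K) ?_ Set.sdiff_subset
      exact ((continuousOn_const.mul c2).add
        (continuousOn_const.mul (continuous_sqd c 0).continuousOn)).sub ((hcK.mono hKK).sub c1)
    · intro X hX _
      have h1 := hUM X (hKK X hX)
      have h2 := hU0 _ (hKm X hX)
      have h3 := mul_nonneg hA0 (hb0 X hX).1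
      have h4 := mul_nonneg hN0 (sqd_nonneg c 0 X)
      linarith
    · intro X hX _ hneg
      have h1 := hUM X (hKK X hX)
      have h2 := hU0 _ (hKm X hX)
      have h3 := mul_nonneg hA0 (hb0 X hX).1
      have hlt : sqd c 0 X < r ^ 2 := by
        refine lt_of_le_of_ne hX.1.1 fun h => ?_
        rw [h, hN, div_mul_cancel₀ _ (by positivity)] at hneg
        linarith
      have hpos : 0 < ⟪X.1 - c, e⟫ := by
        refine lt_of_le_of_ne hX.2 fun h => ?_
        have hm : mirror c e X = X := by
          unfold mirror; rw [← h]; simp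
        rw [hm] at hneg
        have h4 := mul_nonneg hN0 (sqd_nonneg c 0 X)
        linarith
      have hle := hKh X hX
      have hXK := hr _ (hKK X hX).1
      have hmK := hr _ (hKm X hX).1
      have hopen : ∀ᶠ Y in 𝓝 X, sqd c 0 Y < r ^ 2 ∧ 0 < ⟪Y.1 - c, e⟫ :=
        ((continuous_sqd c 0).continuousAt.eventually (gt_mem_nhds hlt)).and
          (continuous_height.continuousAt.eventually (lt_mem_nhds hpos))
      rcases hX.1.2.eq_or_lt with h0 | h0
      · refine Or.inr ⟨h0.symm, ?_, ?_⟩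
        · have ht : Tendsto (fun t : ℝ => (X.1, t)) (𝓝[>] 0) (𝓝 X) := by
            have := tendsto_vertical X.1 0
            rw [h0] at this ⊢
            exact this.mono_left nhdsWithin_le_nhds
          filter_upwards [ht.eventually hopen, self_mem_nhdsWithin] with t h1 h2
          exact ⟨⟨h1.1.le, le_of_lt h2⟩, h1.2.le⟩
        · have f1 : FluxAt σ b X.1 (Cb * 0 - ⟪X.1 - c, e⟫ ^ (β - 2 * σ)) := by
            refine FluxAt.sub (FluxAt.const_mul Cb ?_) (fluxAt_edge S.mem_Ioo hpos)
            exact fluxAt_of_hasDerivAt hσ1 (g := fun _ => ⟪X.1 - c, e⟫ ^ β)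
              (hasDerivAt_const 0 _) fun t => by simp
          have e1 : X = (X.1, 0) := Prod.ext rfl h0.symm
          have f2 := S.flux X.1 (by
            have := norm_sub_le_of_sqd (c := 0) (a := 2) (X := X) (by norm_num)
              (by linarith [hXK.1])
            refine lt_of_le_of_ne (by simpa using this) fun h => ?_
            have h5 := hXK.1
            simp only [sqd, sub_zero, h, ← h0] at h5; norm_num at h5) hXK.2
          have f3 := S.flux (mirror c e X).1 (by
            refine lt_of_le_of_ne ?_ fun h => ?_
            · have := norm_sub_le_of_sqd (c := 0) (a := 2) (X := mirror c e X) (by norm_num)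
                (by linarith [hmK.1])
              simpa using this
            · have h5 := hmK.1
              simp only [sqd, sub_zero, h] at h5
              nlinarith [sq_nonneg (mirror c e X).2]) hmK.2
          have e2 : ((mirror c e X).1, (0 : ℝ)) = mirror c e X := Prod.ext rfl h0
          have f4 : FluxAt σ (fun Y => U (mirror c e Y)) X.1
              (-(U (mirror c e X) ^ p) / (2 * σ)) := by
            refine FluxAt.mirror ?_
            rw [← e1]
            rw [e2] at f3
            exact f3
          rw [← e1] at f2
          refine ⟨_, ?_, ((f1.const_mul A).add ((fluxAt_sqd hσ1 c).const_mul N)).sub (f2.sub f4)⟩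
          have g1 : 1 ≤ ⟪X.1 - c, e⟫ ^ (β - 2 * σ) :=
            Real.one_le_rpow_of_pos_of_le_one_of_nonpos hpos (by linarith) (by linarith)
          have g2 : U X ^ p ≤ M ^ p := Real.rpow_le_rpow (hU0 X (hKK X hX)) h1 hp0.le
          have g3 : 0 ≤ U (mirror c e X) ^ p := Real.rpow_nonneg h2 _
          have g4 : U X ^ p / (2 * σ) ≤ M ^ p / (2 * σ) := by gcongr
          have g5 : 0 ≤ U (mirror c e X) ^ p / (2 * σ) := by positivity
          have g6 := mul_le_mul_of_nonneg_left g1 hA0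
          rw [neg_div, neg_div]
          linarith
      · have sU := S.smooth X hXK.1 h0
        have sM := S.smooth (mirror c e X) hmK.1 h0
        have sM' : ContDiffAt ℝ 2 (fun Y => U (mirror c e Y)) X :=
          sM.comp X contDiff_mirror.contDiffAt
        have sq : ContDiffAt ℝ 2 (sqd c 0) X := (contDiff_sqd c 0).contDiffAt
        have sb : ContDiffAt ℝ 2 b X :=
          (contDiffAt_const.mul (contDiffAt_height_rpow hpos)).sub (contDiffAt_edge hpos h0)
        have sb' : ContDiffAt ℝ 2 (fun Y => A * b Y) X := contDiffAt_const.mul sb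
        have sq' : ContDiffAt ℝ 2 (fun Y => N * sqd c 0 Y) X := contDiffAt_const.mul sq
        refine Or.inl ⟨h0, ?_, (sb'.add sq').sub (sU.sub sM'), ?_⟩
        · filter_upwards [hopen, continuous_snd.continuousAt.eventually (lt_mem_nhds h0)]
            with Y h1 h2 using ⟨⟨h1.1.le, le_of_lt h2⟩, h1.2.le⟩
        · rw [Lop_sub σ (sb'.add sq') (sU.sub sM'), Lop_add σ sb' sq', Lop_sub σ sU sM',
            Lop_const_mul σ A sb, Lop_const_mul σ N sq, Lop_sqd_zero σ c h0, Lop_mirror σ he sM,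
            S.Lop_eq X hXK.1 h0, S.Lop_eq _ hmK.1 h0]
          have g1 : Lop σ b X ≤ -⟪X.1 - c, e⟫ ^ (β - 2) :=
            Lop_barrier_le hσ0 ⟨hβ0, hβ1⟩ he hpos h0
          have g2 : 1 ≤ ⟪X.1 - c, e⟫ ^ (β - 2) :=
            Real.one_le_rpow_of_pos_of_le_one_of_nonpos hpos (by linarith) (by linarith)
          have g3 := mul_le_mul_of_nonneg_left (g1.trans (neg_le_neg g2)) hA0
          linarith
  have hip : ⟪(c + s • e, t).1 - c, e⟫ = s := by
    simp [inner_smul_left, he]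
  have hsq : sqd c 0 (c + s • e, t) = s ^ 2 + t ^ 2 := by
    simp [sqd, norm_smul, he]
  have hXK : ((c + s • e, t) : Pt n) ∈ K := ⟨⟨by rw [hsq]; exact hst, ht⟩, by
    change 0 ≤ ⟪(c + s • e, t).1 - c, e⟫; rw [hip]; exact hs⟩
  have hm : mirror c e (c + s • e, t) = (c - s • e, t) := by
    refine Prod.ext ?_ rfl
    simp only [mirror, hip]
    module
  have h1 := hmain _ hXK (hne _ (hKK _ hXK))
  have h2 := (hb0 _ hXK).2
  rw [hm, hsq] at h1
  rw [hip] at h2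
  have h3 := mul_le_mul_of_nonneg_left h2 hA0
  have h4 : 0 ≤ s ^ β := Real.rpow_nonneg hs _
  linarith [mul_nonneg hN0 h4, mul_nonneg (mul_nonneg hA0 (zero_le_one.trans hCb1))
    (add_nonneg (sq_nonneg s) (sq_nonneg t))]

end ReflectionEstimate

/-! ### The Kelvin transform -/

section Kelvin

variable {n : ℕ} {σ : ℝ} {U V : Pt n → ℝ} {X : Pt n} {c : EuclideanSpace ℝ (Fin n)} {L : ℝ}

lemma Lop_mul (hU : ContDiffAt ℝ 2 U X) (hV : ContDiffAt ℝ 2 V X) :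
    Lop σ (fun Y => U Y * V Y) X = Lop σ U X * V X + U X * Lop σ V X
      + 2 * ∑ o, fderiv ℝ U X (bv o) * fderiv ℝ V X (bv o) := by
  have h : dt (fun Y => U Y * V Y) X = dt U X * V X + U X * dt V X := by
    simp only [dt]
    rw [fderiv_fun_mul (hU.differentiableAt (by simp)) (hV.differentiableAt (by simp))]
    simp; ring
  simp only [Lop, lapl_eq_sum, h, d2_mul hU hV, Finset.sum_add_distrib, ← Finset.mul_sum,
    ← Finset.sum_mul]
  ring

/-- Inversion in the sphere of squared radius `L` centred at `(c, 0)`. -/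
def kinv (c : EuclideanSpace ℝ (Fin n)) (L : ℝ) (X : Pt n) : Pt n :=
  (c, 0) + (L / sqd c 0 X) • (X - (c, 0))

/-- The Kelvin transform of `U` with respect to the sphere of squared radius `L` centred at
`(c, 0)`. -/
def kel (σ : ℝ) (c : EuclideanSpace ℝ (Fin n)) (L : ℝ) (U : Pt n → ℝ) (X : Pt n) : ℝ :=
  (L / sqd c 0 X) ^ gexp n σ * U (kinv c L X)

lemma kinv_fst (c : EuclideanSpace ℝ (Fin n)) (L : ℝ) (X : Pt n) :
    (kinv c L X).1 = c + (L / sqd c 0 X) • (X.1 - c) := rfl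

lemma kinv_snd (c : EuclideanSpace ℝ (Fin n)) (L : ℝ) (X : Pt n) :
    (kinv c L X).2 = L / sqd c 0 X * X.2 := by simp [kinv]

lemma sqd_kinv (hX : 0 < sqd c 0 X) : sqd c 0 (kinv c L X) = L ^ 2 / sqd c 0 X := by
  have h : sqd c 0 (kinv c L X) = (L / sqd c 0 X) ^ 2 * sqd c 0 X := by
    conv_lhs => unfold sqd
    rw [kinv_fst, kinv_snd, add_sub_cancel_left, norm_smul, Real.norm_eq_abs, mul_pow, sq_abs,
      sub_zero, mul_pow, ← mul_add]
    simp [sqd]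
  rw [h]; field_simp

lemma contDiffAt_kinv (hX : 0 < sqd c 0 X) : ContDiffAt ℝ 2 (kinv c L) X := by
  unfold kinv
  exact contDiffAt_const.add
    ((contDiffAt_const.div (contDiff_sqd c 0).contDiffAt hX.ne').smul
      (contDiffAt_id.sub contDiffAt_const))

lemma sqd_eq_ip (c : EuclideanSpace ℝ (Fin n)) (X : Pt n) :
    ‖(X - (c, 0)).1‖ ^ 2 + (X - (c, 0)).2 ^ 2 = sqd c 0 X := rfl

lemma fderiv_sqd_eq_ip (v : Pt n) : fderiv ℝ (sqd c 0) X v = 2 * ip v (X - (c, 0)) := by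
  rw [fderiv_sqd, ip, real_inner_comm]; simp; ring

lemma kinv_line (hX : 0 < sqd c 0 X) (v : Pt n) :
    ∀ᶠ s in 𝓝 (0 : ℝ), HasDerivAt (fun s : ℝ => kinv c L (X + s • v))
      ((L / sqd c 0 (X + s • v)) • v
        + (-(L * fderiv ℝ (sqd c 0) (X + s • v) v) / sqd c 0 (X + s • v) ^ 2) •
          (X + s • v - (c, 0))) s := by
  have hpos : ∀ᶠ s in 𝓝 (0 : ℝ), 0 < sqd c 0 (X + s • v) :=
    (tendsto_line X v).eventually
      ((continuous_sqd c 0).continuousAt.eventually (lt_mem_nhds hX))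
  filter_upwards [hpos, ((contDiff_sqd c 0).contDiffAt (x := X)).line_deriv v] with s hs hd
  have h1 := (hasDerivAt_const s L).div hd hs.ne'
  have h2 := (hasDerivAt_line X v s).sub_const ((c, 0) : Pt n)
  refine ((h1.smul h2).const_add ((c, 0) : Pt n)).congr_deriv ?_
  simp

lemma kinv_line2 (hX : 0 < sqd c 0 X) (v : Pt n) :
    HasDerivAt (fun s : ℝ => (L / sqd c 0 (X + s • v)) • v
        + (-(L * fderiv ℝ (sqd c 0) (X + s • v) v) / sqd c 0 (X + s • v) ^ 2) •
          (X + s • v - (c, 0)))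
      ((-(4 * L * ip v (X - (c, 0))) / sqd c 0 X ^ 2) • v
        + (-(2 * L * (‖v.1‖ ^ 2 + v.2 ^ 2)) / sqd c 0 X ^ 2
          + 8 * L * ip v (X - (c, 0)) ^ 2 / sqd c 0 X ^ 3) • (X - (c, 0))) 0 := by
  have hs : HasDerivAt (fun s : ℝ => sqd c 0 (X + s • v)) (2 * ip v (X - (c, 0))) 0 := by
    have := (((contDiff_sqd c 0).contDiffAt (x := X)).line_deriv v).self_of_nhds
    simpa [fderiv_sqd_eq_ip] using this
  have hs2 : HasDerivAt (fun s : ℝ => fderiv ℝ (sqd c 0) (X + s • v) v)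
      (2 * (‖v.1‖ ^ 2 + v.2 ^ 2)) 0 := by
    have := ((contDiff_sqd c 0).contDiffAt (x := X)).line_deriv2 v
    rwa [d2_sqd] at this
  have e : sqd c 0 (X + (0 : ℝ) • v) ≠ 0 := by simpa using hX.ne'
  have h1 := ((hasDerivAt_const (0 : ℝ) L).div hs e).smul_const v
  have h2 := (((hs2.const_mul L).neg.div (hs.pow 2) (pow_ne_zero 2 e)).smul
    ((hasDerivAt_line X v 0).sub_const ((c, 0) : Pt n)))
  refine (h1.add h2).congr_deriv ?_
  simp only [zero_smul, add_zero, fderiv_sqd_eq_ip, Pi.pow_apply, Pi.div_apply, Pi.neg_apply]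
  have hX' := hX.ne'
  generalize ip v (X - (c, 0)) = I
  generalize X - (c, 0) = Z
  match_scalars
  · field_simp; ring
  · field_simp; ring

lemma sum_norm_bv : ∑ o, (‖(bv o : Pt n).1‖ ^ 2 + (bv o : Pt n).2 ^ 2) = n + 1 := by
  rw [Fintype.sum_option]; simp [bv]; ring

lemma sum_ip_mul (T : Pt n →L[ℝ] ℝ) (Z : Pt n) : ∑ o, ip (bv o) Z * T (bv o) = T Z := by
  conv_rhs => rw [← sum_ip_smul_bv Z]
  simp [map_sum]

lemma contDiffAt_comp_kinv (hX : 0 < sqd c 0 X) (hU : ContDiffAt ℝ 2 U (kinv c L X)) :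
    ContDiffAt ℝ 2 (fun Y => U (kinv c L Y)) X := hU.comp X (contDiffAt_kinv hX)

lemma fderiv_comp_kinv (hX : 0 < sqd c 0 X) (hU : ContDiffAt ℝ 2 U (kinv c L X)) (v : Pt n) :
    fderiv ℝ (fun Y => U (kinv c L Y)) X v = L / sqd c 0 X * (fderiv ℝ U (kinv c L X) v
      - 2 / sqd c 0 X * ip v (X - (c, 0)) * fderiv ℝ U (kinv c L X) (X - (c, 0))) := by
  rw [fderiv_comp_map hU (contDiffAt_comp_kinv hX hU) (kinv_line hX v)]
  simp only [zero_smul, add_zero, map_add, map_smul, smul_eq_mul, fderiv_sqd_eq_ip]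
  have hX' := hX.ne'
  field_simp
  ring

lemma lapl_comp_kinv (hX : 0 < sqd c 0 X) (hU : ContDiffAt ℝ 2 U (kinv c L X)) :
    lapl (fun Y => U (kinv c L Y)) X = (L / sqd c 0 X) ^ 2 * lapl U (kinv c L X)
      + L / sqd c 0 X ^ 2 * (2 - 2 * n) * fderiv ℝ U (kinv c L X) (X - (c, 0)) := by
  set Z : Pt n := X - (c, 0) with hZ
  set D := fderiv ℝ U (kinv c L X) with hD
  set B := fderiv ℝ (fderiv ℝ U) (kinv c L X) with hB
  have hX' := hX.ne'
  have h1 : ∀ v, d2 (fun Y => U (kinv c L Y)) X v =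
      (L / sqd c 0 X) ^ 2 * B (v - (2 / sqd c 0 X * ip v Z) • Z) (v - (2 / sqd c 0 X * ip v Z) • Z)
        - 4 * L / sqd c 0 X ^ 2 * (ip v Z * D v)
        - 2 * L / sqd c 0 X ^ 2 * D Z * (‖v.1‖ ^ 2 + v.2 ^ 2)
        + 8 * L / sqd c 0 X ^ 3 * D Z * ip v Z ^ 2 := by
    intro v
    rw [d2_comp_map hU (contDiffAt_comp_kinv hX hU) (kinv_line hX v) (kinv_line2 hX v)]
    have e : (L / sqd c 0 (X + (0 : ℝ) • v)) • v
        + (-(L * fderiv ℝ (sqd c 0) (X + (0 : ℝ) • v) v) / sqd c 0 (X + (0 : ℝ) • v) ^ 2) •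
          (X + (0 : ℝ) • v - (c, 0)) =
        (L / sqd c 0 X) • (v - (2 / sqd c 0 X * ip v Z) • Z) := by
      simp only [zero_smul, add_zero, fderiv_sqd_eq_ip, ← hZ]
      generalize ip v Z = I
      clear_value Z
      match_scalars
      · ring
      · field_simp
    rw [e]
    simp only [map_smul, map_add, smul_apply, smul_eq_mul, ← hZ, ← hD, ← hB]
    ring
  have hs := sum_norm_bv (n := n)
  rw [Finset.sum_add_distrib] at hs
  rw [lapl_eq_sum, lapl_eq_sum]
  simp only [h1, Finset.sum_add_distrib, Finset.sum_sub_distrib, ← Finset.mul_sum]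
  rw [sum_reflected B Z (by rw [hZ, sqd_eq_ip]; field_simp), sum_ip_mul, hs, sum_ip_sq,
    hZ, sqd_eq_ip]
  simp only [d2_eq hU, ← hB]
  field_simp
  ring

lemma kel_eq (hL : 0 ≤ L) : kel σ c L U =
    fun X => (L ^ gexp n σ * sqd c 0 X ^ (-gexp n σ)) * U (kinv c L X) := by
  ext X
  rw [kel, Real.div_rpow hL (sqd_nonneg c 0 X), Real.rpow_neg (sqd_nonneg c 0 X), div_eq_mul_inv]

lemma contDiffAt_kel (hL : 0 ≤ L) (hX : 0 < sqd c 0 X) (hU : ContDiffAt ℝ 2 U (kinv c L X)) :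
    ContDiffAt ℝ 2 (kel σ c L U) X := by
  rw [kel_eq hL]
  exact (contDiffAt_const.mul (contDiffAt_sqd_rpow c 0 _ hX)).mul (contDiffAt_comp_kinv hX hU)

lemma Lop_kel (hL : 0 < L) (hX : 0 < X.2) (hU : ContDiffAt ℝ 2 U (kinv c L X)) :
    Lop σ (kel σ c L U) X =
      (L / sqd c 0 X) ^ (gexp n σ + 2) * Lop σ U (kinv c L X) := by
  have hs : 0 < sqd c 0 X := by unfold sqd; rw [sub_zero]; positivity
  have c1 := contDiffAt_sqd_rpow c 0 (-gexp n σ) hs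
  have c2 : ContDiffAt ℝ 2 (fun X => L ^ gexp n σ * sqd c 0 X ^ (-gexp n σ)) X :=
    contDiffAt_const.mul c1
  have hf : ∀ v, fderiv ℝ (fun X => L ^ gexp n σ * sqd c 0 X ^ (-gexp n σ)) X v =
      L ^ gexp n σ * sqd c 0 X ^ (-gexp n σ) * (-gexp n σ / sqd c 0 X) *
        (2 * ip v (X - (c, 0))) := by
    intro v
    rw [← fderiv_sqd_eq_ip, fderiv_comp_real (g := fun y => L ^ gexp n σ * y ^ (-gexp n σ))
      (contDiff_sqd c 0).contDiffAt
      ((Real.hasDerivAt_rpow_const (Or.inl hs.ne')).const_mul _), Real.rpow_sub_one hs.ne']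
    ring
  have hsum : ∑ o, fderiv ℝ (fun X => L ^ gexp n σ * sqd c 0 X ^ (-gexp n σ)) X (bv o) *
      fderiv ℝ (fun Y => U (kinv c L Y)) X (bv o) =
      L ^ gexp n σ * sqd c 0 X ^ (-gexp n σ) * (2 * gexp n σ / sqd c 0 X) *
        (L / sqd c 0 X) * fderiv ℝ U (kinv c L X) (X - (c, 0)) := by
    set Q := L ^ gexp n σ * sqd c 0 X ^ (-gexp n σ)
    have : ∀ o, fderiv ℝ (fun X => L ^ gexp n σ * sqd c 0 X ^ (-gexp n σ)) X (bv o) *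
        fderiv ℝ (fun Y => U (kinv c L Y)) X (bv o) =
        (Q * (-gexp n σ / sqd c 0 X) * 2 * (L / sqd c 0 X)) *
          (ip (bv o) (X - (c, 0)) * fderiv ℝ U (kinv c L X) (bv o))
        - (Q * (-gexp n σ / sqd c 0 X) * 2 * (L / sqd c 0 X)) * (2 / sqd c 0 X) *
          fderiv ℝ U (kinv c L X) (X - (c, 0)) * ip (bv o) (X - (c, 0)) ^ 2 := by
      intro o
      rw [hf, fderiv_comp_kinv hs hU]; ring
    simp only [this, Finset.sum_sub_distrib, ← Finset.mul_sum]
    rw [sum_ip_mul, sum_ip_sq, sqd_eq_ip]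
    field_simp
    ring
  rw [kel_eq hL.le, Lop_mul c2 (contDiffAt_comp_kinv hs hU), hsum, Lop_const_mul σ _ c1, gexp,
    Lop_sqd_rpow σ c hX hs, Lop, lapl_comp_kinv hs hU, dt, fderiv_comp_kinv hs hU, Lop, kinv_snd,
    Real.rpow_add (by positivity), Real.div_rpow hL.le hs.le, Real.rpow_neg hs.le, dt,
    Real.rpow_two]
  have h2 : ip ((0, 1) : Pt n) (X - (c, 0)) = X.2 := by simp [ip]
  rw [h2]
  field_simp
  ring

end Kelvin

/-! ### The conormal derivative of the Kelvin transform -/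

section KelvinFlux

variable {n : ℕ} {σ : ℝ} {U V : Pt n → ℝ} {c x y : EuclideanSpace ℝ (Fin n)} {L l m : ℝ}

lemma FluxAt.tendsto (hσ : 0 < σ) (h : FluxAt σ U x l) :
    Tendsto (fun t : ℝ => U (x, t)) (𝓝[>] 0) (𝓝 (U (x, 0))) := by
  have h1 := (Tendsto.mul h (tendsto_rpow_nhdsGT_zero (q := 2 * σ) (by positivity))).add_const
    (U (x, 0))
  rw [mul_zero, zero_add] at h1
  refine h1.congr' ?_
  filter_upwards [self_mem_nhdsWithin] with t ht
  have : 0 < t ^ (2 * σ) := Real.rpow_pos_of_pos ht _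
  field_simp
  ring

lemma FluxAt.mul (hσ : 0 < σ) (hU : FluxAt σ U x l) (hV : FluxAt σ V x m) :
    FluxAt σ (fun Y => U Y * V Y) x (l * V (x, 0) + U (x, 0) * m) :=
  ((Tendsto.mul hU (hV.tendsto hσ)).add (Tendsto.const_mul (U (x, 0)) hV)).congr fun t => by ring

lemma Sol.flux_comp_kinv (S : Sol n σ U) (hL : 0 < L) (hy : y ≠ c)
    (h2 : ‖(kinv c L (y, 0)).1‖ < 2) (h0 : (kinv c L (y, 0)).1 ≠ 0) :
    FluxAt σ (fun Y => U (kinv c L Y)) y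
      (-(U (kinv c L (y, 0)) ^ pexp n σ) / (2 * σ) * (L / sqd c 0 (y, 0)) ^ (2 * σ)) := by
  obtain ⟨hσ0, hσ1⟩ := S.mem_Ioo
  obtain ⟨C, r, hr, hC⟩ := S.mirror_estimate h2 h0
  set a : ℝ := ‖y - c‖ with ha
  have ha0 : 0 < a := norm_pos_iff.2 (sub_ne_zero.2 hy)
  set e : EuclideanSpace ℝ (Fin n) := a⁻¹ • (y - c) with he
  have he1 : ‖e‖ = 1 := by
    rw [he, norm_smul, norm_inv, Real.norm_eq_abs, abs_of_pos ha0, ← ha, inv_mul_cancel₀ ha0.ne']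
  have hyc : y - c = a • e := by rw [he, smul_smul, mul_inv_cancel₀ ha0.ne', one_smul]
  have hρ : ∀ t : ℝ, sqd c 0 (y, t) = a ^ 2 + t ^ 2 := fun t => by simp [sqd, ha]
  have hk1 : ∀ t : ℝ, (kinv c L (y, t)).1 = c + (L * a / (a ^ 2 + t ^ 2)) • e := fun t => by
    rw [kinv_fst, hρ, hyc, smul_smul, div_mul_eq_mul_div]
  have hk2 : ∀ t : ℝ, (kinv c L (y, t)).2 = L / (a ^ 2 + t ^ 2) * t := fun t => by
    rw [kinv_snd, hρ]
  set x₁ := (kinv c L (y, 0)).1 with hx₁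
  have hI0 : kinv c L (y, 0) = (x₁, 0) := Prod.ext rfl (by rw [hk2, mul_zero])
  set τ : ℝ → ℝ := fun t => L / (a ^ 2 + t ^ 2) * t with hτ
  have hτt : Tendsto (fun t : ℝ => L / (a ^ 2 + t ^ 2)) (𝓝[>] 0) (𝓝 (L / a ^ 2)) := by
    have : ContinuousAt (fun t : ℝ => L / (a ^ 2 + t ^ 2)) 0 :=
      continuousAt_const.div (by fun_prop) (by positivity)
    have h := this.tendsto
    simp only [ne_eq, OfNat.ofNat_ne_zero, not_false_eq_true, zero_pow, add_zero] at h
    exact h.mono_left nhdsWithin_le_nhds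
  have hτ0 : Tendsto τ (𝓝[>] 0) (𝓝[>] 0) := by
    refine tendsto_nhdsWithin_iff.2 ⟨?_, ?_⟩
    · have := hτt.mul (tendsto_nhdsWithin_of_tendsto_nhds tendsto_id)
      simpa using this
    · filter_upwards [self_mem_nhdsWithin] with t ht
      have : 0 < t := ht
      simp only [hτ, Set.mem_Ioi]; positivity
  have hvert : Tendsto (fun t => (U (x₁, τ t) - U (x₁, 0)) / t ^ (2 * σ)) (𝓝[>] 0)
      (𝓝 (-(U (x₁, 0) ^ pexp n σ) / (2 * σ) * (L / a ^ 2) ^ (2 * σ))) := by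
    have h := (Tendsto.comp (S.flux x₁ h2 h0) hτ0).mul
      ((Real.continuousAt_rpow_const (L / a ^ 2) (2 * σ) (Or.inr (by positivity))).tendsto.comp hτt)
    refine h.congr' ?_
    filter_upwards [self_mem_nhdsWithin] with t ht
    have ht' : 0 < t := ht
    have e1 : (τ t) ^ (2 * σ) = (L / (a ^ 2 + t ^ 2)) ^ (2 * σ) * t ^ (2 * σ) :=
      Real.mul_rpow (by positivity) ht'.le
    have : 0 < (L / (a ^ 2 + t ^ 2)) ^ (2 * σ) := by positivity
    have : 0 < t ^ (2 * σ) := by positivity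
    simp only [Function.comp]
    rw [e1]
    field_simp
  set D : ℝ := L / (2 * a ^ 3) with hD
  set β : ℝ := 2 * σ / (1 + σ) with hβ
  have hβ0 : 0 < β := by positivity
  have hhor : Tendsto (fun t => (U (kinv c L (y, t)) - U (x₁, τ t)) / t ^ (2 * σ)) (𝓝[>] 0)
      (𝓝 0) := by
    have hβσ : 0 < 2 * β - 2 * σ := by
      have : 2 * β - 2 * σ = 2 * σ * (1 - σ) / (1 + σ) := by rw [hβ]; field_simp; ring
      rw [this]
      have : 0 < 1 - σ := by linarith
      positivity
    have hlim : Tendsto (fun t : ℝ => |C| * (D ^ β * t ^ (2 * β - 2 * σ)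
        + D ^ 2 * t ^ (4 - 2 * σ) + (L / a ^ 2) ^ 2 * t ^ (2 - 2 * σ))) (𝓝[>] 0) (𝓝 0) := by
      have := ((((tendsto_rpow_nhdsGT_zero hβσ).const_mul (D ^ β)).add
        ((tendsto_rpow_nhdsGT_zero (q := 4 - 2 * σ) (by linarith)).const_mul (D ^ 2))).add
        ((tendsto_rpow_nhdsGT_zero (q := 2 - 2 * σ) (by linarith)).const_mul
          ((L / a ^ 2) ^ 2))).const_mul |C|
      simpa using this
    have hD0 : 0 < D := by positivity
    have hsmall : ∀ᶠ t in 𝓝[>] (0 : ℝ), D * t ^ 2 ≤ r ∧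
        (D * t ^ 2) ^ 2 + (L / a ^ 2 * t) ^ 2 ≤ r ^ 2 := by
      have c1 : Tendsto (fun t : ℝ => D * t ^ 2) (𝓝[>] 0) (𝓝 0) := by
        have : Continuous fun t : ℝ => D * t ^ 2 := by fun_prop
        simpa using (this.tendsto 0).mono_left (nhdsWithin_le_nhds (s := Set.Ioi 0))
      have c2 : Tendsto (fun t : ℝ => (D * t ^ 2) ^ 2 + (L / a ^ 2 * t) ^ 2) (𝓝[>] 0) (𝓝 0) := by
        have : Continuous fun t : ℝ => (D * t ^ 2) ^ 2 + (L / a ^ 2 * t) ^ 2 := by fun_prop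
        simpa using (this.tendsto 0).mono_left (nhdsWithin_le_nhds (s := Set.Ioi 0))
      exact (c1.eventually (ge_mem_nhds hr)).and (c2.eventually (ge_mem_nhds (by positivity)))
    refine squeeze_zero_norm' ?_ hlim
    filter_upwards [hsmall, self_mem_nhdsWithin] with t hts ht
    have ht0 : 0 < t := ht
    set s : ℝ := (L * a / a ^ 2 - L * a / (a ^ 2 + t ^ 2)) / 2 with hs
    set mid : EuclideanSpace ℝ (Fin n) :=
      c + ((L * a / a ^ 2 + L * a / (a ^ 2 + t ^ 2)) / 2) • e with hmid
    have hs' : s = L * t ^ 2 / (2 * a * (a ^ 2 + t ^ 2)) := by rw [hs]; field_simp; ring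
    have hs0 : 0 ≤ s := by rw [hs']; positivity
    have hsD : s ≤ D * t ^ 2 := by
      rw [hs', hD, div_mul_eq_mul_div]
      refine div_le_div_of_nonneg_left (by positivity) (by positivity) ?_
      have : 0 ≤ a * t ^ 2 := by positivity
      nlinarith
    have hτ' : τ t ≤ L / a ^ 2 * t := by
      simp only [hτ]
      gcongr
      nlinarith [sq_nonneg t]
    have hτ'' : 0 ≤ τ t := by simp only [hτ]; positivity
    have e1 : (mid + s • e, τ t) = (x₁, τ t) := by
      rw [hx₁, hk1, hmid, hs]; congr 1; simp only [ne_eq, OfNat.ofNat_ne_zero, not_false_eq_true,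
        zero_pow, add_zero]; module
    have e2 : (mid - s • e, τ t) = kinv c L (y, t) := by
      refine Prod.ext ?_ (hk2 t).symm
      rw [hk1, hmid, hs]; module
    have hmx : ‖mid - x₁‖ ≤ r := by
      have : mid - x₁ = -(s • e) := by
        have := congrArg Prod.fst e1
        simp only at this
        rw [← this]; abel
      rw [this, norm_neg, norm_smul, he1, mul_one, Real.norm_eq_abs, abs_of_nonneg hs0]
      exact hsD.trans hts.1
    have hst : s ^ 2 + (τ t) ^ 2 ≤ r ^ 2 := le_trans (by gcongr) hts.2
    have b1 := hC mid e hmx he1 s (τ t) hs0 hτ'' hst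
    have b2 := hC mid (-e) hmx (by rwa [norm_neg]) s (τ t) hs0 hτ'' hst
    rw [smul_neg, sub_neg_eq_add, ← sub_eq_add_neg, e1, e2] at b2
    rw [e1, e2] at b1
    have hE : C * (s ^ β + s ^ 2 + τ t ^ 2) ≤
        |C| * ((D * t ^ 2) ^ β + (D * t ^ 2) ^ 2 + (L / a ^ 2 * t) ^ 2) :=
      (mul_le_mul_of_nonneg_right (le_abs_self C) (by positivity)).trans (by gcongr)
    have htσ : 0 < t ^ (2 * σ) := by positivity
    rw [Real.norm_eq_abs, abs_div, abs_of_pos htσ, div_le_iff₀ htσ]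
    have key : |C| * (D ^ β * t ^ (2 * β - 2 * σ) + D ^ 2 * t ^ (4 - 2 * σ)
        + (L / a ^ 2) ^ 2 * t ^ (2 - 2 * σ)) * t ^ (2 * σ) =
        |C| * ((D * t ^ 2) ^ β + (D * t ^ 2) ^ 2 + (L / a ^ 2 * t) ^ 2) := by
      have q1 : t ^ (2 * β - 2 * σ) * t ^ (2 * σ) = (t ^ 2) ^ β := by
        rw [← Real.rpow_add ht0, sub_add_cancel, ← Real.rpow_natCast t 2, ← Real.rpow_mul ht0.le]
        norm_num
      have q2 : t ^ (4 - 2 * σ) * t ^ (2 * σ) = t ^ 4 := by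
        rw [← Real.rpow_add ht0, sub_add_cancel]; exact_mod_cast Real.rpow_natCast t 4
      have q3 : t ^ (2 - 2 * σ) * t ^ (2 * σ) = t ^ 2 := by
        rw [← Real.rpow_add ht0, sub_add_cancel]; exact_mod_cast Real.rpow_natCast t 2
      rw [Real.mul_rpow hD0.le (by positivity), ← q1]
      linear_combination |C| * D ^ 2 * q2 + |C| * (L / a ^ 2) ^ 2 * q3
    rw [key]
    refine abs_le.2 ⟨by linarith, by linarith⟩
  have hsum := hhor.add hvert
  rw [zero_add] at hsum
  unfold FluxAt
  rw [hρ, hI0]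
  simp only [ne_eq, OfNat.ofNat_ne_zero, not_false_eq_true, zero_pow, add_zero]
  refine hsum.congr fun t => by rw [hI0]; ring

lemma fluxAt_kel_weight (hσ : σ < 1) (hL : 0 ≤ L) (hy : y ≠ c) (p : ℝ) :
    FluxAt σ (fun Y => (L / sqd c 0 Y) ^ p) y 0 := by
  have h := (fluxAt_sqd_rpow hσ hy (-p)).const_mul (L ^ p)
  rw [mul_zero] at h
  convert h using 2 with Y
  rw [Real.div_rpow hL (sqd_nonneg c 0 Y), Real.rpow_neg (sqd_nonneg c 0 Y), div_eq_mul_inv]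

lemma gexp_mul_pexp (h : (n : ℝ) - 2 * σ ≠ 0) : gexp n σ * pexp n σ = gexp n σ + 2 * σ := by
  unfold gexp pexp; field_simp; ring

/-- The Kelvin transform satisfies the same nonlinear boundary condition. -/
lemma Sol.fluxAt_kel (S : Sol n σ U) (hL : 0 < L) (hy : y ≠ c)
    (h2 : ‖(kinv c L (y, 0)).1‖ < 2) (h0 : (kinv c L (y, 0)).1 ≠ 0) :
    FluxAt σ (kel σ c L U) y (-(kel σ c L U (y, 0) ^ pexp n σ) / (2 * σ)) := by
  obtain ⟨hσ0, hσ1⟩ := S.mem_Ioo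
  have hs : 0 < sqd c 0 (y, (0 : ℝ)) := by
    have := norm_pos_iff.2 (sub_ne_zero.2 hy)
    simp only [sqd]; positivity
  have hI : (kinv c L (y, 0)).2 = 0 := by rw [kinv_snd, mul_zero]
  have hU : 0 ≤ U (kinv c L (y, 0)) := by
    refine S.nonneg _ ?_ hI.ge fun h => h0 (by rw [h]; rfl)
    simp only [sqd, hI, sub_zero]; nlinarith [norm_nonneg (kinv c L (y, 0)).1]
  have h : FluxAt σ (kel σ c L U) y _ :=
    (fluxAt_kel_weight hσ1 hL.le hy (gexp n σ)).mul hσ0 (S.flux_comp_kinv hL hy h2 h0)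
  have hq : 0 < L / sqd c 0 (y, (0 : ℝ)) := by positivity
  have e : kel σ c L U (y, 0) =
    (L / sqd c 0 (y, (0 : ℝ))) ^ gexp n σ * U (kinv c L (y, 0)) := rfl
  convert h using 1
  rw [e, Real.mul_rpow (by positivity) hU, ← Real.rpow_mul hq.le,
    gexp_mul_pexp S.two_n_pos.ne', Real.rpow_add hq]
  ring

end KelvinFlux

/-! ### The strong maximum principle -/

section StrongMax

variable {n : ℕ} {σ : ℝ} {U : Pt n → ℝ} {X Y : Pt n}

lemma continuousOn_sub_const_mul {V W : Pt n → ℝ} {K : Set (Pt n)} (hV : ContinuousOn V K)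
    (hW : ContinuousOn W K) (k : ℝ) : ContinuousOn (fun X => V X - k * W X) K :=
  hV.sub (continuousOn_const.mul hW)

lemma Lop_exp_sqd (c : EuclideanSpace ℝ (Fin n)) (τ α : ℝ) :
    Lop σ (fun Y => Real.exp (-α * sqd c τ Y)) X =
      Real.exp (-α * sqd c τ X) * (α ^ 2 * (4 * sqd c τ X) - α * Lop σ (sqd c τ) X) := by
  have hd : ∀ y : ℝ, HasDerivAt (fun y => Real.exp (-α * y)) (Real.exp (-α * y) * -α) y :=
    fun y => by simpa using ((hasDerivAt_id y).const_mul (-α)).exp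
  rw [Lop_comp σ (g := fun y => Real.exp (-α * y)) (g' := fun y => Real.exp (-α * y) * -α)
    (g'' := Real.exp (-α * sqd c τ X) * -α * -α) (contDiff_sqd c τ).contDiffAt
    (contDiff_const.mul (contDiff_sqd c τ)).exp.contDiffAt (Eventually.of_forall hd)
    ((hd _).mul_const _), sum_fderiv_sqd_sq]
  ring

lemma dist_le_of_sqd {R : ℝ} (hR : 0 ≤ R) (h : sqd X.1 X.2 Y ≤ R ^ 2) : dist Y X ≤ R := by
  rw [Prod.dist_eq, dist_eq_norm, Real.dist_eq]
  unfold sqd at h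
  exact max_le (abs_le_of_sq_le_sq' (by nlinarith [sq_nonneg (Y.2 - X.2)]) hR).2
    (abs_le_of_sq_le_sq (by nlinarith [sq_nonneg ‖Y.1 - X.1‖]) hR)

lemma sqd_lt_of_dist {R : ℝ} (h : dist Y X < R / 2) : sqd X.1 X.2 Y < R ^ 2 := by
  rw [Prod.dist_eq, max_lt_iff, dist_eq_norm, Real.dist_eq] at h
  unfold sqd
  have h0 := norm_nonneg (Y.1 - X.1)
  have h1 := abs_nonneg (Y.2 - X.2)
  rw [← sq_abs (Y.2 - X.2)]
  nlinarith

/-- Positivity at the centre of an interior ball spreads to a smaller ball. -/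
lemma Sol.pos_of_ball (S : Sol n σ U) {R : ℝ} (hR : 0 < R)
    (hball : Metric.closedBall X R ⊆ {X : Pt n | sqd 0 0 X < 4 ∧ 0 < X.2}) (hX : 0 < U X)
    (hY : dist Y X < R / 2) : 0 < U Y := by
  have hin : ∀ Z, sqd X.1 X.2 Z ≤ R ^ 2 → sqd 0 0 Z < 4 ∧ 0 < Z.2 := fun Z hZ =>
    hball (Metric.mem_closedBall.2 (dist_le_of_sqd hR.le hZ))
  have hX' := hball (Metric.mem_closedBall_self hR.le)
  have hXc : ContinuousAt U X := (S.smooth X hX'.1 hX'.2).continuousAt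
  obtain ⟨r, hr0, hr⟩ := Metric.eventually_nhds_iff.1 (hXc.eventually (lt_mem_nhds
    (show U X / 2 < U X by linarith)))
  obtain ⟨r₀, hr₀0, hr₀r, hr₀R⟩ : ∃ r₀ > 0, r₀ < r ∧ r₀ < R :=
    ⟨min r R / 2, by positivity, by linarith [min_le_left r R, lt_min hr0 hR],
      by linarith [min_le_right r R, lt_min hr0 hR]⟩
  have hsm : ∀ Z, sqd X.1 X.2 Z ≤ r₀ ^ 2 → U X / 2 < U Z := fun Z hZ =>
    hr ((dist_le_of_sqd hr₀0.le hZ).trans_lt hr₀r)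
  set P := sqd X.1 X.2 with hP
  have hPc : Continuous P := continuous_sqd _ _
  set K := {Z : Pt n | r₀ ^ 2 ≤ P Z ∧ P Z ≤ R ^ 2} with hK
  have hKc : IsCompact K := by
    refine Metric.isCompact_of_isClosed_isBounded ((isClosed_le continuous_const hPc).inter
      (isClosed_le hPc continuous_const)) ?_
    exact Metric.isBounded_closedBall.subset (t := Metric.closedBall X R) fun Z hZ =>
      Metric.mem_closedBall.2 (dist_le_of_sqd hR.le hZ.2)
  have hLc : ContinuousOn (Lop σ P) K := by
    have : Lop σ P = fun Z => 2 * (n + 1) + (1 - 2 * σ) / Z.2 * (2 * (Z.2 - X.2)) :=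
      funext fun Z => Lop_sqd σ _ _
    rw [this]
    refine continuousOn_const.add (ContinuousOn.mul (continuousOn_const.div
      continuous_snd.continuousOn fun Z hZ => (hin Z hZ.2).2.ne') ?_)
    exact (continuous_const.mul (continuous_snd.sub continuous_const)).continuousOn
  obtain ⟨M, hM⟩ := (hKc.image_of_continuousOn hLc).bddAbove
  have hM' : ∀ Z ∈ K, Lop σ P Z ≤ M := fun Z hZ => hM (Set.mem_image_of_mem _ hZ)
  set α : ℝ := (|M| + 1) / r₀ ^ 2 with hα
  have hα0 : 0 < α := by positivity
  set v : Pt n → ℝ := fun Z => Real.exp (-α * P Z) - Real.exp (-α * R ^ 2) with hv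
  have hvc : ContDiff ℝ 2 v := (contDiff_const.mul (contDiff_sqd _ _)).exp.sub contDiff_const
  have hLv : ∀ Z ∈ K, 0 ≤ Lop σ v Z := by
    intro Z hZ
    have e : Lop σ v Z = Lop σ (fun Y => Real.exp (-α * P Y)) Z := by
      rw [hv, Lop_sub σ (contDiff_const.mul (contDiff_sqd _ _)).exp.contDiffAt
        contDiffAt_const, Lop_const, sub_zero]
    rw [e, Lop_exp_sqd]
    refine mul_nonneg (Real.exp_nonneg _) ?_
    have h1 : |M| + 1 ≤ α * P Z := by
      have := mul_le_mul_of_nonneg_left hZ.1 hα0.le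
      rwa [hα, div_mul_cancel₀ _ (by positivity)] at this
    have h2 := (hM' Z hZ).trans (le_abs_self M)
    have h3 := abs_nonneg M
    have : 0 ≤ α * (4 * (α * P Z) - Lop σ P Z) := mul_nonneg hα0.le (by linarith)
    simp only [← hP]
    linarith
  have hv1 : ∀ Z, v Z ≤ 1 := fun Z => by
    have h1 : Real.exp (-α * P Z) ≤ 1 := Real.exp_le_one_iff.2 (by
      have : 0 ≤ α * P Z := mul_nonneg hα0.le (sqd_nonneg _ _ _)
      linarith)
    have h2 := Real.exp_pos (-α * R ^ 2)
    simp only [hv]; linarith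
  set k : ℝ := U X / 2 with hk
  have hk0 : 0 < k := by positivity
  have hUc : ContinuousOn U K := fun Z hZ =>
    (S.smooth Z (hin Z hZ.2).1 (hin Z hZ.2).2).continuousAt.continuousWithinAt
  have hne : ∀ Z ∈ K, Z ≠ 0 := fun Z hZ h => by
    have := (hin Z hZ.2).2; rw [h] at this; exact lt_irrefl _ this
  have hU0 : ∀ Z ∈ K, 0 ≤ U Z := fun Z hZ =>
    S.nonneg Z (hin Z hZ.2).1.le (hin Z hZ.2).2.le (hne Z hZ)
  have hmain := nonneg_of_superAt (B := k) (V := fun Z => U Z - k * v Z) S.two_le S.mem_Ioo hKc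
    (fun Z hZ => ⟨(hin Z hZ.2).2.le, by
      have := (hin Z hZ.2).1
      simp only [sqd, sub_zero] at this
      nlinarith [sq_nonneg ‖Z.1‖]⟩)
    ((continuousOn_sub_const_mul hUc hvc.continuous.continuousOn k).mono Set.sdiff_subset)
    (fun Z hZ _ => by
      have := hU0 Z hZ
      have := mul_le_mul_of_nonneg_left (hv1 Z) hk0.le
      linarith) ?_
  · by_cases hYr : P Y ≤ r₀ ^ 2
    · exact hk0.trans (hsm Y hYr)
    · have hYK : Y ∈ K := ⟨(not_le.1 hYr).le, (sqd_lt_of_dist hY).le⟩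
      have h1 := hmain Y hYK (hne Y hYK)
      have h2 : 0 < v Y := by
        simp only [hv, sub_pos, Real.exp_lt_exp]
        have := mul_lt_mul_of_pos_left (sqd_lt_of_dist hY) hα0
        linarith
      have := mul_pos hk0 h2
      linarith
  · intro Z hZ _ hneg
    have h1 : P Z < R ^ 2 := by
      refine lt_of_le_of_ne hZ.2 fun h => ?_
      have : v Z = 0 := by simp [hv, h]
      have := hU0 Z hZ
      rw [‹v Z = 0›, mul_zero] at hneg
      linarith
    have h2 : r₀ ^ 2 < P Z := by
      refine lt_of_le_of_ne hZ.1 fun h => ?_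
      have h3 := hsm Z h.symm.le
      have := mul_le_mul_of_nonneg_left (hv1 Z) hk0.le
      linarith
    have hZ' := hin Z hZ.2
    refine Or.inl ⟨hZ'.2, ?_, ?_, ?_⟩
    · exact Filter.mem_of_superset (((isOpen_lt continuous_const hPc).inter
        (isOpen_lt hPc continuous_const)).mem_nhds ⟨h2, h1⟩) fun W hW => ⟨hW.1.le, hW.2.le⟩
    · exact (S.smooth Z hZ'.1 hZ'.2).sub (contDiffAt_const.mul hvc.contDiffAt)
    · rw [Lop_sub σ (S.smooth Z hZ'.1 hZ'.2) (contDiffAt_const.mul hvc.contDiffAt),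
        Lop_const_mul σ _ hvc.contDiffAt, S.Lop_eq Z hZ'.1 hZ'.2]
      have := mul_nonneg hk0.le (hLv Z hZ)
      linarith

lemma isPreconnected_upper : IsPreconnected {X : Pt n | sqd 0 0 X < 4 ∧ 0 < X.2} := by
  have h : ConvexOn ℝ Set.univ (sqd (0 : EuclideanSpace ℝ (Fin n)) 0) := by
    have h1 : ConvexOn ℝ Set.univ fun X : Pt n => ‖X.1‖ ^ 2 :=
      ((convexOn_univ_norm.comp_linearMap (LinearMap.fst ℝ (EuclideanSpace ℝ (Fin n)) ℝ)).pow
        (fun _ _ => norm_nonneg _) 2)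
    have h2 : ConvexOn ℝ Set.univ fun X : Pt n => X.2 ^ 2 :=
      ((even_two.convexOn_pow (𝕜 := ℝ)).comp_linearMap
        (LinearMap.snd ℝ (EuclideanSpace ℝ (Fin n)) ℝ))
    have h3 := h1.add h2
    have e : sqd (0 : EuclideanSpace ℝ (Fin n)) 0 =
        (fun X : Pt n => ‖X.1‖ ^ 2) + fun X : Pt n => X.2 ^ 2 := by ext X; simp [sqd]
    rwa [e]
  have h1 := h.convex_lt 4
  have h2 : Convex ℝ {X : Pt n | 0 < X.2} :=
    convex_halfSpace_gt (LinearMap.snd ℝ (EuclideanSpace ℝ (Fin n)) ℝ).isLinear 0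
  convert (h1.inter h2).isPreconnected using 1
  ext X; simp

/-- In the interior a solution is positive or vanishes identically. -/
lemma Sol.interior_pos_or_zero (S : Sol n σ U) :
    (∀ X, sqd 0 0 X < 4 → 0 < X.2 → 0 < U X) ∨ ∀ X, sqd 0 0 X < 4 → 0 < X.2 → U X = 0 := by
  set Ω := {X : Pt n | sqd 0 0 X < 4 ∧ 0 < X.2} with hΩ
  have hU0 : ∀ X ∈ Ω, 0 ≤ U X := fun X hX => S.nonneg X hX.1.le hX.2.le fun h => by
    have := hX.2; rw [h] at this; exact lt_irrefl _ this
  by_cases hex : ∃ X ∈ Ω, 0 < U X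
  swap
  · right; push Not at hex
    exact fun X h1 h2 => le_antisymm (hex X ⟨h1, h2⟩) (hU0 X ⟨h1, h2⟩)
  left
  obtain ⟨X₁, hX₁, hpos⟩ := hex
  have hcont : ContinuousOn U Ω := fun X hX => (S.smooth X hX.1 hX.2).continuousAt.continuousWithinAt
  have hopen : IsOpen (Ω ∩ U ⁻¹' Set.Ioi 0) := hcont.isOpen_inter_preimage isOpen_upper isOpen_Ioi
  have hsub := isPreconnected_upper.subset_of_closure_inter_subset hopen
    ⟨X₁, hX₁, hX₁, hpos⟩ ?_
  · exact fun X h1 h2 => (hsub ⟨h1, h2⟩).2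
  rintro Y ⟨hYc, hY⟩
  refine ⟨hY, ?_⟩
  obtain ⟨r, hr, hball⟩ := Metric.nhds_basis_closedBall.mem_iff.1 (isOpen_upper.mem_nhds hY)
  obtain ⟨X, hX, hXY⟩ := Metric.mem_closure_iff.1 hYc (r / 8) (by positivity)
  refine S.pos_of_ball (X := X) (R := r / 2) (by positivity) ?_ hX.2 (by linarith)
  intro Z hZ
  refine hball (Metric.mem_closedBall.2 ?_)
  have := Metric.mem_closedBall.1 hZ
  have := dist_triangle Z X Y
  rw [dist_comm X Y] at this
  linarith

/-- A nontrivial solution is positive up to the flat boundary. -/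
lemma Sol.pos_of_interior_pos (S : Sol n σ U) (hpos : ∀ X, sqd 0 0 X < 4 → 0 < X.2 → 0 < U X)
    {x : EuclideanSpace ℝ (Fin n)} (hx : ‖x‖ < 2) (hx0 : x ≠ 0) : 0 < U (x, 0) := by
  obtain ⟨hσ0, hσ1⟩ := S.mem_Ioo
  obtain ⟨r, hr0, hr12, hr⟩ := Sol.exists_radius hx hx0
  set κ : ℝ := n / (2 - 2 * σ) with hκ
  have hσ2 : 0 < 2 - 2 * σ := by linarith
  have hκ0 : 0 ≤ κ := by positivity
  obtain ⟨h, hh0, hhr, hh⟩ : ∃ h : ℝ, 0 < h ∧ h ≤ r ∧ h ^ (2 * σ) + κ * h ^ 2 ≤ r ^ 2 := by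
    have c1 : Tendsto (fun h : ℝ => h ^ (2 * σ) + κ * h ^ 2) (𝓝[>] 0) (𝓝 0) := by
      have : Continuous fun h : ℝ => κ * h ^ 2 := by fun_prop
      simpa using (tendsto_rpow_nhdsGT_zero (q := 2 * σ) (by positivity)).add
        ((this.tendsto 0).mono_left (nhdsWithin_le_nhds (s := Set.Ioi 0)))
    have c2 : ∀ᶠ h : ℝ in 𝓝[>] 0, h ≤ r := nhdsWithin_le_nhds (Iic_mem_nhds hr0)
    obtain ⟨h, h1, h2, h3⟩ := ((c1.eventually (ge_mem_nhds (pow_pos hr0 2))).and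
      (c2.and self_mem_nhdsWithin)).exists
    exact ⟨h, h3, h2, h1⟩
  set K := {X : Pt n | ‖X.1 - x‖ ≤ r ∧ 0 ≤ X.2 ∧ X.2 ≤ h} with hK
  have hcn : Continuous fun X : Pt n => ‖X.1 - x‖ := by fun_prop
  have hK4 : ∀ X ∈ K, sqd x 0 X ≤ (2 * r) ^ 2 := fun X hX => by
    have h1 := hX.1
    have h2 := hX.2.2
    have h3 := hX.2.1
    simp only [sqd, sub_zero]
    nlinarith [norm_nonneg (X.1 - x)]
  have hKc : IsCompact K := by
    refine (isCompact_halfBall x ((2 * r) ^ 2)).of_isClosed_subset ?_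
      fun X hX => ⟨hK4 X hX, hX.2.1⟩
    exact (isClosed_le hcn continuous_const).inter ((isClosed_le continuous_const
      continuous_snd).inter (isClosed_le continuous_snd continuous_const))
  have hKin : ∀ X ∈ K, sqd 0 0 X < 4 ∧ X.1 ≠ 0 := fun X hX => hr X (hK4 X hX)
  have hne : ∀ X ∈ K, X ≠ 0 := fun X hX h => (hKin X hX).2 (by rw [h]; rfl)
  have hUc : ContinuousOn U K := S.cont.mono fun X hX => ⟨(hKin X hX).1.le, hX.2.1, hne X hX⟩
  have hU0 : ∀ X ∈ K, 0 ≤ U X := fun X hX => S.nonneg X (hKin X hX).1.le hX.2.1 (hne X hX)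
  obtain ⟨X₂, hX₂, hmin⟩ := (hKc.inter_right (isClosed_le (f := fun _ : Pt n => h) continuous_const
    continuous_snd)).exists_isMinOn ⟨(x, h), ⟨by simp [hr0.le], hh0.le, le_rfl⟩,
    le_refl h⟩
    (hUc.mono Set.inter_subset_left)
  have hm0 : 0 < U X₂ := hpos X₂ (hKin X₂ hX₂.1).1 (hh0.trans_le hX₂.2)
  set φ : Pt n → ℝ := fun X => X.2 ^ (2 * σ) + κ * X.2 ^ 2 - ‖X.1 - x‖ ^ 2 with hφ
  have hφc : Continuous φ := by
    refine ((continuous_snd.rpow_const fun _ => Or.inr (by positivity)).add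
      (by fun_prop)).sub (hcn.pow 2)
  have hφr : ∀ X ∈ K, φ X ≤ r ^ 2 - ‖X.1 - x‖ ^ 2 := fun X hX => by
    have h0 := hX.2.1
    have h1 : X.2 ^ (2 * σ) ≤ h ^ (2 * σ) := Real.rpow_le_rpow h0 hX.2.2 (by positivity)
    have h2 : κ * X.2 ^ 2 ≤ κ * h ^ 2 := by gcongr; exact hX.2.2
    simp only [hφ]; linarith
  set k : ℝ := U X₂ / r ^ 2 with hk
  have hk0 : 0 < k := by positivity
  have hkr : k * r ^ 2 = U X₂ := by rw [hk]; field_simp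
  have hφle : ∀ X ∈ K, k * φ X ≤ U X₂ := fun X hX => by
    rw [← hkr]
    have := hφr X hX
    gcongr
    nlinarith [sq_nonneg ‖X.1 - x‖]
  have hc1 : ∀ X : Pt n, 0 < X.2 → ContDiffAt ℝ 2 φ X := fun X hX =>
    ((contDiffAt_rpow_t _ hX).add (contDiffAt_const.mul (contDiffAt_snd.pow 2))).sub
      (contDiff_nsq x).contDiffAt
  have hLφ : ∀ X : Pt n, 0 < X.2 → Lop σ φ X = 0 := fun X hX => by
    rw [hφ, Lop_sub σ ((contDiffAt_rpow_t _ hX).add (contDiffAt_const.mul (contDiffAt_snd.pow 2)))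
      (contDiff_nsq x).contDiffAt, Lop_add σ (contDiffAt_rpow_t _ hX)
      (contDiffAt_const.mul (contDiffAt_snd.pow 2)), Lop_const_mul σ _ (contDiffAt_snd.pow 2),
      Lop_rpow_t σ hX, Lop_sq_t σ hX, Lop_nsq σ x hX, hκ]
    field_simp
    ring
  have hmain := nonneg_of_superAt (B := U X₂) (V := fun X => U X - k * φ X) S.two_le S.mem_Ioo hKc
    (fun X hX => ⟨hX.2.1, by linarith [hX.2.2]⟩)
    ((continuousOn_sub_const_mul hUc hφc.continuousOn k).mono Set.sdiff_subset)
    (fun X hX _ => by linarith [hU0 X hX, hφle X hX]) ?_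
  · by_contra hneg
    have hxK : ∀ t : ℝ, 0 ≤ t → t ≤ h → (x, t) ∈ K := fun t h1 h2 => ⟨by simp [hr0.le], h1, h2⟩
    have hz : U (x, 0) = 0 := le_antisymm (not_lt.1 hneg) (hU0 _ (hxK 0 le_rfl hh0.le))
    have hfl := S.flux x hx hx0
    rw [hz, Real.zero_rpow S.pexp_pos.ne', neg_zero, zero_div] at hfl
    refine absurd (ge_of_tendsto (b := k) hfl ?_) (not_le.2 hk0)
    filter_upwards [self_mem_nhdsWithin, nhdsWithin_le_nhds (Iic_mem_nhds hh0)] with t ht hth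
    have ht0 : 0 < t := ht
    have h1 := hmain (x, t) (hxK t ht0.le hth) (hne _ (hxK t ht0.le hth))
    simp only [hφ, sub_self, norm_zero] at h1
    have h2 : 0 < t ^ (2 * σ) := Real.rpow_pos_of_pos ht0 _
    rw [hz, sub_zero, le_div_iff₀ h2]
    have : 0 ≤ k * (κ * t ^ 2) := by positivity
    linarith
  · intro X hX _ hneg
    have hneg' : U X < k * φ X := by linarith
    have h1 : X.2 < h := by
      refine lt_of_le_of_ne hX.2.2 fun he => ?_
      have := hmin (a := X) ⟨hX, he.symm.le⟩
      have := hφle X hX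
      simp only [Set.mem_ofPred_eq] at *
      linarith
    have h2 : ‖X.1 - x‖ < r := by
      refine lt_of_le_of_ne hX.1 fun he => ?_
      have h3 := hφr X hX
      rw [he, sub_self] at h3
      have := mul_nonneg hk0.le (neg_nonneg.2 h3)
      linarith [hU0 X hX]
    have h3 : 0 < X.2 := by
      refine lt_of_le_of_ne hX.2.1 fun he => ?_
      have h4 : φ X ≤ 0 := by
        simp only [hφ, ← he]
        rw [Real.zero_rpow (by positivity)]
        nlinarith [sq_nonneg ‖X.1 - x‖]
      have := mul_nonneg hk0.le (neg_nonneg.2 h4)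
      linarith [hU0 X hX]
    have hsm := S.smooth X (hKin X hX).1 h3
    refine Or.inl ⟨h3, ?_, hsm.sub (contDiffAt_const.mul (hc1 X h3)), ?_⟩
    · exact Filter.mem_of_superset (((isOpen_lt hcn continuous_const).inter
        ((isOpen_lt continuous_const continuous_snd).inter
        (isOpen_lt continuous_snd continuous_const))).mem_nhds ⟨h2, h3, h1⟩)
        fun W hW => ⟨hW.1.le, hW.2.1.le, hW.2.2.le⟩
    · rw [Lop_sub σ hsm (contDiffAt_const.mul (hc1 X h3)), Lop_const_mul σ _ (hc1 X h3),
        S.Lop_eq X (hKin X hX).1 h3, hLφ X h3]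
      simp

/-- A solution is positive or its trace vanishes identically. -/
lemma Sol.pos_or_trace_zero (S : Sol n σ U) :
    (∀ X, sqd 0 0 X < 4 → 0 ≤ X.2 → X ≠ 0 → 0 < U X) ∨
      ∀ x : EuclideanSpace ℝ (Fin n), ‖x‖ < 2 → x ≠ 0 → U (x, 0) = 0 := by
  have h4 : ∀ x : EuclideanSpace ℝ (Fin n), sqd 0 0 (x, (0 : ℝ)) < 4 ↔ ‖x‖ < 2 := fun x => by
    simp only [sqd, sub_zero]
    constructor <;> intro h <;> nlinarith [norm_nonneg x]
  rcases S.interior_pos_or_zero with h | h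
  · refine Or.inl fun X h1 h2 h3 => ?_
    rcases h2.eq_or_lt with h0 | h0
    · have hX : X = (X.1, 0) := Prod.ext rfl h0.symm
      rw [hX] at h1 ⊢
      exact S.pos_of_interior_pos h ((h4 _).1 h1) fun hx => h3 (Prod.ext hx h0.symm)
    · exact h X h1 h0
  · refine Or.inr fun x hx hx0 => ?_
    refine tendsto_nhds_unique ((S.flux x hx hx0).tendsto S.mem_Ioo.1) ?_
    refine tendsto_const_nhds.congr' ?_
    filter_upwards [self_mem_nhdsWithin, ((tendsto_vertical x 0).mono_left
      nhdsWithin_le_nhds).eventually ((continuous_sqd 0 0).continuousAt.eventually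
      (gt_mem_nhds ((h4 x).2 hx)))] with t ht ht4
    exact (h _ ht4 ht).symm

/-- A positive solution is bounded below by its minimum over the unit half-sphere. -/
lemma Sol.ge_of_lid (S : Sol n σ U) {m : ℝ}
    (hlid : ∀ X, sqd 0 0 X = 1 → 0 ≤ X.2 → m ≤ U X) {X : Pt n} (hX : sqd 0 0 X ≤ 1)
    (hX2 : 0 ≤ X.2) (hX0 : X ≠ 0) : m ≤ U X := by
  have hσ0 := S.mem_Ioo.1
  have h := nonneg_of_superAt (B := m) (V := fun X => U X - m) S.two_le S.mem_Ioo
    (isCompact_halfBall 0 1) (fun X hX => ⟨hX.2, by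
      have := hX.1; simp only [sqd, sub_zero] at this; nlinarith [sq_nonneg ‖X.1‖]⟩)
    ((S.cont.mono fun X hX => ⟨hX.1.1.trans (by norm_num), hX.1.2, hX.2⟩).sub continuousOn_const)
    (fun X hX h0 => by linarith [S.nonneg X (hX.1.trans (by norm_num)) hX.2 h0]) ?_ X ⟨hX, hX2⟩ hX0
  · linarith
  intro Y hY hY0 hneg
  have h1 : sqd 0 0 Y < 1 := lt_of_le_of_ne hY.1 fun he => by linarith [hlid Y he hY.2]
  rcases hY.2.eq_or_lt with h0 | h0
  · have hYe : Y = (Y.1, 0) := Prod.ext rfl h0.symm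
    have hy0 : Y.1 ≠ 0 := fun hx => hY0 (Prod.ext hx h0.symm)
    have hy2 : ‖Y.1‖ < 2 := by
      simp only [sqd, sub_zero] at h1; nlinarith [norm_nonneg Y.1, sq_nonneg Y.2]
    refine Or.inr ⟨h0.symm, ?_, _, ?_, (S.flux _ hy2 hy0).sub (fluxAt_const S.mem_Ioo.2 m)⟩
    · have h1' : sqd 0 0 (Y.1, (0 : ℝ)) < 1 := by rwa [← hYe]
      filter_upwards [self_mem_nhdsWithin, ((tendsto_vertical Y.1 0).mono_left
        nhdsWithin_le_nhds).eventually ((continuous_sqd 0 0).continuousAt.eventually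
        (gt_mem_nhds h1'))] with t ht ht4
      exact ⟨ht4.le, le_of_lt ht⟩
    · rw [sub_zero, neg_div]
      have : 0 ≤ U (Y.1, 0) := by rw [← hYe]; exact S.nonneg Y (by linarith) hY.2 hY0
      have : 0 ≤ U (Y.1, 0) ^ pexp n σ / (2 * σ) := by positivity
      linarith
  · have hsm := S.smooth Y (by linarith) h0
    refine Or.inl ⟨h0, ?_, hsm.sub contDiffAt_const, ?_⟩
    · exact Filter.mem_of_superset (((isOpen_lt (continuous_sqd 0 0) continuous_const).inter
        (isOpen_lt continuous_const continuous_snd)).mem_nhds ⟨h1, h0⟩)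
        fun W hW => ⟨hW.1.le, hW.2.le⟩
    · rw [Lop_sub σ hsm contDiffAt_const, Lop_const, S.Lop_eq Y (by linarith) h0]; simp

end StrongMax

/-! ### The method of moving spheres -/

/-- A solution which is at least `m > 0` in the punctured unit half-ball. -/
structure PosSol (n : ℕ) (σ : ℝ) (U : Pt n → ℝ) (m : ℝ) : Prop extends Sol n σ U where
  m_pos : 0 < m
  ge : ∀ X, sqd 0 0 X ≤ 1 → 0 ≤ X.2 → X ≠ 0 → m ≤ U X

/-- On the part of the unit half-ball outside the sphere of squared radius `L` centred at `c`,
the Kelvin transform of `U` is at most `U`. -/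
def KelLe {n : ℕ} (σ : ℝ) (U : Pt n → ℝ) (c : EuclideanSpace ℝ (Fin n)) (L : ℝ) : Prop :=
  ∀ X : Pt n, sqd 0 0 X ≤ 1 → 0 ≤ X.2 → X ≠ 0 → L ≤ sqd c 0 X → kel σ c L U X ≤ U X

section MovingSpheres

variable {n : ℕ} {σ m μ L : ℝ} {U : Pt n → ℝ} {X : Pt n} {c : EuclideanSpace ℝ (Fin n)}

lemma rpow_sub_rpow_le {p u k M : ℝ} (hp : 1 ≤ p) (hu : 0 ≤ u) (huk : u ≤ k) (hkM : k ≤ M) :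
    k ^ p - u ^ p ≤ p * M ^ (p - 1) * (k - u) := by
  rcases (hu.trans huk).eq_or_lt with h | hk
  · have : u = k := by linarith
    simp [this]
  have h1 := one_add_mul_self_le_rpow_one_add (s := u / k - 1)
    (by have : 0 ≤ u / k := by positivity
        linarith) hp
  rw [add_sub_cancel, Real.div_rpow hu hk.le, le_div_iff₀ (by positivity)] at h1
  have h2 : k ^ p = k ^ (p - 1) * k := by
    rw [← Real.rpow_add_one hk.ne', sub_add_cancel]
  have h3 : k ^ p - u ^ p ≤ p * k ^ (p - 1) * (k - u) := by
    have : (1 + p * (u / k - 1)) * k ^ p = k ^ p + p * k ^ (p - 1) * (u - k) := by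
      rw [h2]; field_simp
    linarith
  refine h3.trans ?_
  have : k ^ (p - 1) ≤ M ^ (p - 1) := Real.rpow_le_rpow hk.le hkM (by linarith)
  gcongr

lemma Sol.one_le_pexp (S : Sol n σ U) : 1 ≤ pexp n σ := by
  rw [pexp, one_le_div S.two_n_pos]; linarith [S.mem_Ioo.1]

lemma Sol.gexp_pos (S : Sol n σ U) : 0 < gexp n σ := by
  have := S.two_n_pos; unfold gexp; linarith

lemma ne_zero_of_fst {X : Pt n} (h : X.1 ≠ 0) : X ≠ 0 := fun h0 => h (by rw [h0]; rfl)

/-- Points of a half-ball centred at `c ≠ 0` which does not reach the origin. -/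
lemma halfBall_avoids (hμc : μ < ‖c‖) (hc : ‖c‖ ≤ 1 / 4) (hμ : 0 ≤ μ)
    (hX : sqd c 0 X ≤ μ ^ 2) : sqd 0 0 X < 1 ∧ X.1 ≠ 0 := by
  constructor
  · have := sqd_triangle (c' := 0) hμ hX (b := ‖c‖) (by simp)
    nlinarith
  · intro h
    have := norm_sub_le_of_sqd hμ hX
    rw [h, zero_sub, norm_neg] at this
    linarith

lemma sqd_kinv_le (hL : 0 < L) (hX : L ≤ sqd c 0 X) : sqd c 0 (kinv c L X) ≤ L := by
  have hs := hL.trans_le hX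
  rw [sqd_kinv hs, div_le_iff₀ hs, sq]
  gcongr

lemma kinv_snd_nonneg (hL : 0 ≤ L) (hX : 0 ≤ X.2) : 0 ≤ (kinv c L X).2 := by
  rw [kinv_snd]; have := sqd_nonneg c 0 X; positivity

lemma kel_of_sqd_eq (hL : 0 < L) (hX : sqd c 0 X = L) : kel σ c L U X = U X := by
  simp [kel, kinv, hX, div_self hL.ne']

lemma Sol.continuousOn_kel (S : Sol n σ U) (hμc : μ < ‖c‖) (hc : ‖c‖ ≤ 1 / 4) (hμ : 0 < μ) :
    ContinuousOn (fun q : ℝ × Pt n => kel σ c q.1 U q.2)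
      {q | 0 < q.1 ∧ q.1 ≤ μ ^ 2 ∧ q.1 ≤ sqd c 0 q.2 ∧ 0 ≤ q.2.2} := by
  have hs : ∀ q ∈ {q : ℝ × Pt n | 0 < q.1 ∧ q.1 ≤ μ ^ 2 ∧ q.1 ≤ sqd c 0 q.2 ∧ 0 ≤ q.2.2},
      sqd c 0 q.2 ≠ 0 := fun q hq => (hq.1.trans_le hq.2.2.1).ne'
  have h1 : ContinuousOn (fun q : ℝ × Pt n => q.1 / sqd c 0 q.2)
      {q | 0 < q.1 ∧ q.1 ≤ μ ^ 2 ∧ q.1 ≤ sqd c 0 q.2 ∧ 0 ≤ q.2.2} :=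
    continuousOn_fst.div ((continuous_sqd c 0).comp continuous_snd).continuousOn hs
  refine (h1.rpow_const fun q _ => Or.inr S.gexp_pos.le).mul (S.cont.comp
    (continuousOn_const.add (h1.smul (continuousOn_snd.sub continuousOn_const))) ?_)
  intro q hq
  have h2 := halfBall_avoids hμc hc hμ.le ((sqd_kinv_le hq.1 hq.2.2.1).trans hq.2.1)
  exact ⟨by linarith [h2.1], kinv_snd_nonneg hq.1.le hq.2.2.2, ne_zero_of_fst h2.2⟩

lemma Sol.continuousOn_kel_right (S : Sol n σ U) (hμc : μ < ‖c‖) (hc : ‖c‖ ≤ 1 / 4) (hμ : 0 < μ)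
    (hL : 0 < L) (hLμ : L ≤ μ ^ 2) :
    ContinuousOn (kel σ c L U) {X | L ≤ sqd c 0 X ∧ 0 ≤ X.2} :=
  (S.continuousOn_kel hμc hc hμ).comp (f := fun X : Pt n => (L, X)) (by fun_prop)
    fun _ hX => ⟨hL, hLμ, hX.1, hX.2⟩

/-- `U` minus its Kelvin transform is a supersolution up to the boundary term. -/
lemma Sol.superAt_sub_kel (S : Sol n σ U) (hμc : μ < ‖c‖) (hc : ‖c‖ ≤ 1 / 4) (hμ : 0 < μ)
    (hL : 0 < L) (hLμ : L ≤ μ ^ 2) {K : Set (Pt n)} {O : Set (Pt n)} (hO : IsOpen O)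
    (hOK : ∀ Y ∈ O, 0 ≤ Y.2 → Y ∈ K) (hXO : X ∈ O) (hX : sqd 0 0 X < 1) (hX2 : 0 ≤ X.2)
    (hX0 : X ≠ 0) (hLX : L ≤ sqd c 0 X) {W : Pt n → ℝ} {b : ℝ}
    (hW : 0 < X.2 → ContDiffAt ℝ 2 W X ∧ Lop σ W X = 0)
    (hW' : X.2 = 0 → FluxAt σ W X.1 0)
    (hb : X.2 = 0 → (kel σ c L U X ^ pexp n σ - U X ^ pexp n σ) / (2 * σ) ≤ b) :
    SuperAt σ K (fun Y => U Y - kel σ c L U Y - W Y) b X := by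
  have hs := hL.trans_le hLX
  have hI := halfBall_avoids hμc hc hμ.le ((sqd_kinv_le hL hLX).trans hLμ)
  rcases hX2.eq_or_lt with h0 | h0
  · have hXe : X = (X.1, 0) := Prod.ext rfl h0.symm
    have hx0 : X.1 ≠ 0 := fun hx => hX0 (Prod.ext hx h0.symm)
    have hx2 : ‖X.1‖ < 2 := by
      simp only [sqd, sub_zero] at hX; nlinarith [norm_nonneg X.1, sq_nonneg X.2]
    have hXc : X.1 ≠ c := fun h => by
      rw [sqd, h, sub_self, ← h0] at hs; simp at hs
    have hI2 : ‖(kinv c L X).1‖ < 2 := by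
      have := hI.1
      simp only [sqd, sub_zero] at this
      nlinarith [norm_nonneg (kinv c L X).1, sq_nonneg (kinv c L X).2]
    refine Or.inr ⟨h0.symm, ?_, _, ?_, ((S.flux _ hx2 hx0).sub (S.fluxAt_kel hL hXc
      (by rwa [← hXe]) (by rw [← hXe]; exact hI.2))).sub (hW' h0.symm)⟩
    · have hO' : (X.1, (0 : ℝ)) ∈ O := by rwa [← hXe]
      filter_upwards [self_mem_nhdsWithin, ((tendsto_vertical X.1 0).mono_left
        nhdsWithin_le_nhds).eventually (hO.mem_nhds hO')] with t ht ht4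
      exact hOK _ ht4 (le_of_lt ht)
    · have := hb h0.symm
      rw [← hXe]
      refine le_trans (le_of_eq ?_) this
      ring
  · have hsm := S.smooth X (by linarith) h0
    have hI2 : 0 < (kinv c L X).2 := by rw [kinv_snd]; positivity
    have hsmI := S.smooth _ (by linarith [hI.1]) hI2
    have hk := contDiffAt_kel (σ := σ) hL.le hs hsmI
    obtain ⟨hW1, hW2⟩ := hW h0
    refine Or.inl ⟨h0, ?_, (hsm.sub hk).sub hW1, ?_⟩
    · exact Filter.mem_of_superset ((hO.inter (isOpen_lt continuous_const
        continuous_snd)).mem_nhds ⟨hXO, h0⟩) fun Y hY => hOK Y hY.1 hY.2.le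
    · rw [Lop_sub σ (hsm.sub hk) hW1, Lop_sub σ hsm hk, Lop_kel hL h0 hsmI,
        S.Lop_eq X (by linarith) h0, S.Lop_eq _ (by linarith [hI.1]) hI2, hW2]
      simp

/-- `U` is bounded on half-balls which stay away from the origin. -/
lemma Sol.exists_bound (S : Sol n σ U) (hμc : μ < ‖c‖) (hc : ‖c‖ ≤ 1 / 4) (hμ : 0 < μ) :
    ∃ M > 0, ∀ X, sqd c 0 X ≤ μ ^ 2 → 0 ≤ X.2 → U X ≤ M := by
  have hUc : ContinuousOn U {X : Pt n | sqd c 0 X ≤ μ ^ 2 ∧ 0 ≤ X.2} := S.cont.mono fun X hX => by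
    have := halfBall_avoids hμc hc hμ.le hX.1
    exact ⟨by linarith, hX.2, ne_zero_of_fst this.2⟩
  obtain ⟨M, hM⟩ := ((isCompact_halfBall c (μ ^ 2)).image_of_continuousOn hUc).bddAbove
  exact ⟨max M 1, by positivity, fun X h1 h2 =>
    (hM (Set.mem_image_of_mem U ⟨h1, h2⟩)).trans (le_max_left _ _)⟩

lemma kel_le_of_bound (S : Sol n σ U) {M R : ℝ} (hM0 : 0 ≤ M)
    (hM : ∀ X, sqd c 0 X ≤ μ ^ 2 → 0 ≤ X.2 → U X ≤ M) (hL : 0 < L) (hLμ : L ≤ μ ^ 2)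
    (hR : 0 < R) (hLR : L ≤ R) (hX : R ≤ sqd c 0 X) (hX2 : 0 ≤ X.2) :
    kel σ c L U X ≤ (L / R) ^ gexp n σ * M := by
  have h1 := hM _ ((sqd_kinv_le hL (hLR.trans hX)).trans hLμ) (kinv_snd_nonneg hL.le hX2)
  have h2 : (L / sqd c 0 X) ^ gexp n σ ≤ (L / R) ^ gexp n σ :=
    Real.rpow_le_rpow (by have := hR.trans_le hX; positivity) (by gcongr) S.gexp_pos.le
  have h3 : 0 ≤ (L / sqd c 0 X) ^ gexp n σ :=
    Real.rpow_nonneg (div_nonneg hL.le (sqd_nonneg c 0 X)) _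
  exact (mul_le_mul_of_nonneg_left h1 h3).trans (mul_le_mul_of_nonneg_right h2 hM0)

/-- Comparison in thin shells around the sphere of inversion. -/
lemma PosSol.exists_shell (S : PosSol n σ U m) (hμc : μ < ‖c‖) (hc : ‖c‖ ≤ 1 / 4) (hμ : 0 < μ) :
    ∃ θ > 0, ∀ L R, 0 < L → L ≤ μ ^ 2 → L ≤ R → R < ‖c‖ ^ 2 → R ≤ L + θ →
      (∀ X, sqd c 0 X = R → 0 ≤ X.2 → kel σ c L U X ≤ U X) →
      ∀ X, L ≤ sqd c 0 X → sqd c 0 X ≤ R → 0 ≤ X.2 → kel σ c L U X ≤ U X := by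
  have hσ0 := S.mem_Ioo.1
  obtain ⟨M, hM0, hM⟩ := S.exists_bound hμc hc hμ
  set p := pexp n σ with hp
  have hp1 : 1 ≤ p := S.one_le_pexp
  set C : ℝ := p * M ^ (p - 1) / (2 * σ) with hC
  obtain ⟨θ, hθ, hshell⟩ := exists_thin_shell (n := n) S.mem_Ioo (C := C) (by positivity)
  refine ⟨θ, hθ, fun L R hL hLμ hLR hRc hRθ hbd X hLX hXR hX2 => ?_⟩
  set K : Set (Pt n) := {Y | L ≤ sqd c 0 Y ∧ sqd c 0 Y ≤ R ∧ 0 ≤ Y.2} with hK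
  have hR0 : 0 < R := hL.trans_le hLR
  have hcs := continuous_sqd c 0
  have hKc : IsCompact K := by
    refine (isCompact_halfBall c R).of_isClosed_subset ((isClosed_le continuous_const hcs).inter
      ((isClosed_le hcs continuous_const).inter (isClosed_le continuous_const continuous_snd)))
      fun Y hY => ⟨hY.2.1, hY.2.2⟩
  have hav : ∀ Y ∈ K, sqd 0 0 Y < 1 ∧ Y ≠ 0 := fun Y hY => by
    have := halfBall_avoids (X := Y) (μ := √R) (by rwa [Real.sqrt_lt' ((hμ.trans hμc))]) hc
      (Real.sqrt_nonneg _) (by rw [Real.sq_sqrt hR0.le]; exact hY.2.1)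
    exact ⟨this.1, ne_zero_of_fst this.2⟩
  have h := hshell K c L (fun Y => U Y - kel σ c L U Y - 0) hKc
    (fun Y hY => ⟨hY.2.2, hY.1, hY.2.1.trans hRθ⟩)
    (((S.cont.mono fun Y hY => ⟨by linarith [(hav Y hY).1], hY.2.2, (hav Y hY).2⟩).sub
      ((S.continuousOn_kel_right hμc hc hμ hL hLμ).mono fun Y hY => ⟨hY.1, hY.2.2⟩)).sub
        continuousOn_const) ?_ X ⟨hLX, hXR, hX2⟩
  · linarith
  intro Y hY hneg
  have hneg' : U Y < kel σ c L U Y := by linarith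
  have hO : IsOpen {Z : Pt n | L < sqd c 0 Z ∧ sqd c 0 Z < R} :=
    (isOpen_lt continuous_const hcs).inter (isOpen_lt hcs continuous_const)
  refine S.superAt_sub_kel hμc hc hμ hL hLμ (K := K) hO
    (fun Z hZ hZ2 => ⟨hZ.1.le, hZ.2.le, hZ2⟩)
    ⟨lt_of_le_of_ne hY.1 fun h => ?_, lt_of_le_of_ne hY.2.1 fun h => ?_⟩ (hav Y hY).1 hY.2.2
    (hav Y hY).2 hY.1 (fun _ => ⟨contDiffAt_const, Lop_const σ 0⟩)
    (fun _ => fluxAt_const S.mem_Ioo.2 0) fun _ => ?_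
  · rw [kel_of_sqd_eq hL h.symm] at hneg'; exact lt_irrefl _ hneg'
  · exact absurd hneg' (not_lt.2 (hbd Y h hY.2.2))
  · have hk : kel σ c L U Y ≤ M := by
      have := kel_le_of_bound S.toSol hM0.le hM hL hLμ hL le_rfl hY.1 hY.2.2
      rwa [div_self hL.ne', Real.one_rpow, one_mul] at this
    have := rpow_sub_rpow_le hp1 (S.nonneg Y (by linarith [(hav Y hY).1]) hY.2.2 (hav Y hY).2)
      hneg'.le hk
    rw [hC, div_le_iff₀ (by positivity)]
    have e : -(p * M ^ (p - 1) / (2 * σ)) * (U Y - kel σ c L U Y - 0) * (2 * σ) =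
      p * M ^ (p - 1) * (kel σ c L U Y - U Y) := by field_simp; ring
    rw [e]; exact this

/-- Quantitative strict comparison away from the sphere of inversion. -/
lemma PosSol.exists_strict (S : PosSol n σ U m) (hμc : μ < ‖c‖) (hc : ‖c‖ ≤ 1 / 4) (hμ : 0 < μ)
    (hL : 0 < L) (hLμ : L ≤ μ ^ 2) (hle : KelLe σ U c L)
    (hlid : ∀ X, sqd 0 0 X = 1 → 0 ≤ X.2 → kel σ c L U X < U X) :
    ∃ c₁ > 0, ∀ X, sqd 0 0 X ≤ 1 → 0 ≤ X.2 → X ≠ 0 → L ≤ sqd c 0 X →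
      c₁ * (L ^ (-gexp n σ) - sqd c 0 X ^ (-gexp n σ)) ≤ U X - kel σ c L U X := by
  have hσ0 := S.mem_Ioo.1
  have hγ := S.gexp_pos
  have hcs := continuous_sqd c 0
  have hcs0 := continuous_sqd (0 : EuclideanSpace ℝ (Fin n)) 0
  have hfar : ∀ X : Pt n, sqd 0 0 X = 1 → L < sqd c 0 X := fun X hX => by
    by_contra! h
    have := (halfBall_avoids hμc hc hμ.le (h.trans hLμ)).1
    linarith
  have hUc : ContinuousOn U {X : Pt n | sqd 0 0 X ≤ 1 ∧ 0 ≤ X.2 ∧ X ≠ 0} :=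
    S.cont.mono fun X hX => ⟨by linarith [hX.1], hX.2⟩
  have hkc := S.continuousOn_kel_right hμc hc hμ hL hLμ
  obtain ⟨c₀, hc₀, hc₀'⟩ : ∃ c₀ > 0, ∀ X, sqd 0 0 X = 1 → 0 ≤ X.2 →
      c₀ ≤ U X - kel σ c L U X := by
    have hlc : IsCompact {X : Pt n | sqd 0 0 X = 1 ∧ 0 ≤ X.2} :=
      (isCompact_halfBall 0 1).of_isClosed_subset ((isClosed_eq hcs0 continuous_const).inter
        (isClosed_le continuous_const continuous_snd)) fun X hX => ⟨hX.1.le, hX.2⟩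
    obtain ⟨X₁, hX₁, hmin⟩ := hlc.exists_isMinOn ⟨((0 : EuclideanSpace ℝ (Fin n)), (1 : ℝ)),
      by simp [sqd], by simp⟩ ((hUc.mono fun X hX => ⟨hX.1.le, hX.2, by
        rintro rfl; simp [sqd] at hX⟩).sub (hkc.mono fun X hX => ⟨(hfar X hX.1).le, hX.2⟩))
    exact ⟨_, sub_pos.2 (hlid X₁ hX₁.1 hX₁.2), fun X h1 h2 => hmin (a := X) ⟨h1, h2⟩⟩
  set c₁ : ℝ := c₀ * L ^ gexp n σ with hc₁
  have hLg : 0 < L ^ gexp n σ := by positivity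
  have hc₁0 : 0 < c₁ := by positivity
  have hc₁L : c₁ * L ^ (-gexp n σ) = c₀ := by
    rw [hc₁, Real.rpow_neg hL.le, mul_assoc, mul_inv_cancel₀ hLg.ne', mul_one]
  refine ⟨c₁, hc₁0, ?_⟩
  set K : Set (Pt n) := {X | sqd 0 0 X ≤ 1 ∧ 0 ≤ X.2 ∧ L ≤ sqd c 0 X} with hK
  have hKc : IsCompact K :=
    (isCompact_halfBall 0 1).of_isClosed_subset ((isClosed_le hcs0 continuous_const).inter
      ((isClosed_le continuous_const continuous_snd).inter (isClosed_le continuous_const hcs)))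
      fun X hX => ⟨hX.1, hX.2.1⟩
  set W : Pt n → ℝ := fun X => c₁ * (L ^ (-gexp n σ) - sqd c 0 X ^ (-gexp n σ)) with hW
  have hWle : ∀ X ∈ K, W X ≤ c₀ := fun X hX => by
    rw [← hc₁L, hW]
    have : 0 ≤ sqd c 0 X ^ (-gexp n σ) := Real.rpow_nonneg (sqd_nonneg c 0 X) _
    exact mul_le_mul_of_nonneg_left (by linarith) hc₁0.le
  have hmain := nonneg_of_superAt (B := c₀) (V := fun X => U X - kel σ c L U X - W X) S.two_le
    S.mem_Ioo hKc (fun X hX => ⟨hX.2.1, by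
      have := hX.1; simp only [sqd, sub_zero] at this; nlinarith [sq_nonneg ‖X.1‖]⟩)
    (((hUc.mono fun X hX => ⟨hX.1.1, hX.1.2.1, hX.2⟩).sub
      (hkc.mono fun X hX => ⟨hX.1.2.2, hX.1.2.1⟩)).sub (continuousOn_const.mul
      (continuousOn_const.sub (hcs.continuousOn.rpow_const fun X hX =>
        Or.inl (hL.trans_le hX.1.2.2).ne'))))
    (fun X hX h0 => by
      have := hle X hX.1 hX.2.1 h0 hX.2.2
      have := hWle X hX
      linarith) ?_
  · intro X h1 h2 h3 h4
    have := hmain X ⟨h1, h2, h4⟩ h3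
    linarith
  intro X hX hX0 hneg
  have hw := hle X hX.1 hX.2.1 hX0 hX.2.2
  have hX1 : sqd 0 0 X < 1 := lt_of_le_of_ne hX.1 fun h => by
    linarith [hc₀' X h hX.2.1, hWle X hX]
  have hXL : L < sqd c 0 X := lt_of_le_of_ne hX.2.2 fun h => by
    have : W X = 0 := by simp only [hW]; rw [← h]; ring
    linarith
  have hs := hL.trans hXL
  have hO : IsOpen {Z : Pt n | sqd 0 0 Z < 1 ∧ L < sqd c 0 Z} :=
    (isOpen_lt hcs0 continuous_const).inter (isOpen_lt continuous_const hcs)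
  refine S.superAt_sub_kel hμc hc hμ hL hLμ (K := K) hO
    (fun Z hZ hZ2 => ⟨hZ.1.le, hZ2, hZ.2.le⟩)
    ⟨hX1, hXL⟩ hX1 hX.2.1 hX0 hX.2.2 (fun h0 => ?_) (fun h0 => ?_) fun h0 => ?_
  · have hd := contDiffAt_sqd_rpow c 0 (-gexp n σ) hs
    refine ⟨contDiffAt_const.mul (contDiffAt_const.sub hd), ?_⟩
    rw [hW, Lop_const_mul σ _ (contDiffAt_const.sub hd), Lop_sub σ contDiffAt_const hd, Lop_const,
      gexp, Lop_sqd_rpow σ c h0 hs]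
    simp
  · have hXc : X.1 ≠ c := fun h => by
      rw [sqd, h, sub_self, h0] at hs; simp at hs
    simpa using ((fluxAt_const S.mem_Ioo.2 (L ^ (-gexp n σ))).sub
      (fluxAt_sqd_rpow S.mem_Ioo.2 hXc (-gexp n σ))).const_mul c₁
  · refine div_nonpos_of_nonpos_of_nonneg (sub_nonpos.2 ?_) (by positivity)
    refine Real.rpow_le_rpow ?_ hw S.pexp_pos.le
    have hI := halfBall_avoids hμc hc hμ.le ((sqd_kinv_le hL hX.2.2).trans hLμ)
    exact mul_nonneg (Real.rpow_nonneg (div_nonneg hL.le hs.le) _)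
      (S.nonneg _ (by linarith [hI.1]) (kinv_snd_nonneg hL.le hX.2.1) (ne_zero_of_fst hI.2))

/-- The spheres can be started. -/
lemma PosSol.exists_kelLe (S : PosSol n σ U m) (hμc : μ < ‖c‖) (hc : ‖c‖ ≤ 1 / 4) (hμ : 0 < μ) :
    ∃ L > 0, L ≤ μ ^ 2 ∧ KelLe σ U c L := by
  obtain ⟨M, hM0, hM⟩ := S.exists_bound hμc hc hμ
  obtain ⟨θ, hθ, hsh⟩ := S.exists_shell hμc hc hμ
  have hγ := S.gexp_pos
  have hm := S.m_pos
  set R : ℝ := min θ (μ ^ 2) with hR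
  have hR0 : 0 < R := lt_min hθ (by positivity)
  have hmM : m ≤ M := by
    have hcc : sqd c 0 (c, (0 : ℝ)) ≤ μ ^ 2 := by simp [sqd]; positivity
    have h := halfBall_avoids hμc hc hμ.le hcc
    exact (S.ge (c, 0) h.1.le le_rfl (ne_zero_of_fst h.2)).trans (hM _ hcc le_rfl)
  set L : ℝ := R * (m / M) ^ (1 / gexp n σ) with hL
  have hL0 : 0 < L := by positivity
  have hLR : L ≤ R := mul_le_of_le_one_right hR0.le
    (Real.rpow_le_one (by positivity) (by rwa [div_le_one hM0]) (by positivity))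
  have hRμ : R ≤ μ ^ 2 := min_le_right _ _
  have hfar : ∀ X, R ≤ sqd c 0 X → 0 ≤ X.2 → kel σ c L U X ≤ m := fun X h1 h2 => by
    refine (kel_le_of_bound S.toSol hM0.le hM hL0 (hLR.trans hRμ) hR0 hLR h1 h2).trans
      (le_of_eq ?_)
    rw [hL, mul_div_cancel_left₀ _ hR0.ne', ← Real.rpow_mul (by positivity),
      one_div_mul_cancel hγ.ne', Real.rpow_one, div_mul_cancel₀ _ hM0.ne']
  refine ⟨L, hL0, hLR.trans hRμ, fun X h1 h2 h3 h4 => ?_⟩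
  rcases le_total R (sqd c 0 X) with h | h
  · exact (hfar X h h2).trans (S.ge X h1 h2 h3)
  · refine hsh L R hL0 (hLR.trans hRμ) hLR (by nlinarith) ?_ (fun Y hY hY2 => ?_) X h4 h h2
    · linarith [min_le_left θ (μ ^ 2)]
    · have := halfBall_avoids hμc hc hμ.le (hY.le.trans hRμ)
      exact (hfar Y hY.ge hY2).trans (S.ge Y this.1.le hY2 (ne_zero_of_fst this.2))

/-- The spheres can be moved further. -/
lemma PosSol.kelLe_step (S : PosSol n σ U m) (hμc : μ < ‖c‖) (hc : ‖c‖ ≤ 1 / 4) (hμ : 0 < μ)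
    (hL : 0 < L) (hLμ : L < μ ^ 2) (hle : KelLe σ U c L)
    (hlid : ∀ X, sqd 0 0 X = 1 → 0 ≤ X.2 → kel σ c L U X < U X) :
    ∃ L', L < L' ∧ L' ≤ μ ^ 2 ∧ KelLe σ U c L' := by
  obtain ⟨c₁, hc₁, hstrict⟩ := S.exists_strict hμc hc hμ hL hLμ.le hle hlid
  obtain ⟨θ, hθ, hsh⟩ := S.exists_shell hμc hc hμ
  have hγ := S.gexp_pos
  have hcs := continuous_sqd c 0
  set R : ℝ := L + min θ (μ ^ 2 - L) with hR
  have hLR : L < R := by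
    have : 0 < min θ (μ ^ 2 - L) := lt_min hθ (by linarith)
    linarith
  have hRμ : R ≤ μ ^ 2 := by linarith [min_le_right θ (μ ^ 2 - L)]
  have hRθ : R ≤ L + θ := by linarith [min_le_left θ (μ ^ 2 - L)]
  set c₂ : ℝ := c₁ * (L ^ (-gexp n σ) - R ^ (-gexp n σ)) with hc₂
  have hc₂0 : 0 < c₂ :=
    mul_pos hc₁ (sub_pos.2 (Real.rpow_lt_rpow_of_neg hL hLR (by linarith)))
  set Q : Set (Pt n) := {X | sqd 0 0 X ≤ 1 ∧ 0 ≤ X.2 ∧ R ≤ sqd c 0 X} with hQ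
  have hQc : IsCompact Q :=
    (isCompact_halfBall 0 1).of_isClosed_subset
      ((isClosed_le (continuous_sqd 0 0) continuous_const).inter
      ((isClosed_le continuous_const continuous_snd).inter (isClosed_le continuous_const hcs)))
      fun X hX => ⟨hX.1, hX.2.1⟩
  have huc := (isCompact_Icc (a := L) (b := R)).prod hQc |>.uniformContinuousOn_of_continuous
    ((S.continuousOn_kel hμc hc hμ).mono fun q hq => ⟨hL.trans_le hq.1.1, hq.1.2.trans hRμ,
      hq.1.2.trans hq.2.2.2, hq.2.2.1⟩)
  obtain ⟨δ, hδ, hδ'⟩ := Metric.uniformContinuousOn_iff.1 huc c₂ hc₂0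
  obtain ⟨L', hL'1, hL'2, hL'3⟩ : ∃ L', L < L' ∧ L' ≤ R ∧ L' < L + δ :=
    ⟨min R (L + δ / 2), lt_min hLR (by linarith), min_le_left _ _,
      (min_le_right _ _).trans_lt (by linarith)⟩
  have hfar : ∀ X, sqd 0 0 X ≤ 1 → 0 ≤ X.2 → X ≠ 0 → R ≤ sqd c 0 X →
      kel σ c L' U X ≤ U X := fun X h1 h2 h3 h4 => by
    have k1 := hδ' (L', X) ⟨⟨hL'1.le, hL'2⟩, h1, h2, h4⟩ (L, X) ⟨⟨le_rfl, hLR.le⟩, h1, h2, h4⟩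
      (by rw [Prod.dist_eq, dist_self, Real.dist_eq, abs_of_pos (by linarith)]
          exact max_lt (by linarith) hδ)
    rw [Real.dist_eq] at k1
    have k2 := hstrict X h1 h2 h3 (hLR.le.trans h4)
    have k3 : sqd c 0 X ^ (-gexp n σ) ≤ R ^ (-gexp n σ) :=
      Real.rpow_le_rpow_of_nonpos (hL.trans hLR) h4 (by linarith)
    have k4 : c₂ ≤ c₁ * (L ^ (-gexp n σ) - sqd c 0 X ^ (-gexp n σ)) := by
      rw [hc₂]; gcongr
    linarith [(abs_lt.1 k1).2]
  refine ⟨L', hL'1, hL'2.trans hRμ, fun X h1 h2 h3 h4 => ?_⟩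
  rcases le_total R (sqd c 0 X) with h | h
  · exact hfar X h1 h2 h3 h
  · refine hsh L' R (hL.trans hL'1) (hL'2.trans hRμ) hL'2 (by nlinarith) (by linarith)
      (fun Y hY hY2 => ?_) X h4 h h2
    have := halfBall_avoids hμc hc hμ.le (hY.le.trans hRμ)
    exact hfar Y this.1.le hY2 (ne_zero_of_fst this.2) hY.ge

/-- The method of moving spheres: the spheres can be moved up to radius `μ` as long as the
inequality is strict on the unit half-sphere. -/
lemma PosSol.kelLe_of_lid (S : PosSol n σ U m) (hμc : μ < ‖c‖) (hc : ‖c‖ ≤ 1 / 4) (hμ : 0 < μ)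
    (hlid : ∀ L, 0 < L → L ≤ μ ^ 2 → ∀ X, sqd 0 0 X = 1 → 0 ≤ X.2 → kel σ c L U X < U X) :
    KelLe σ U c (μ ^ 2) := by
  obtain ⟨L₀, hL₀, hL₀μ, hle₀⟩ := S.exists_kelLe hμc hc hμ
  refine IsClosed.mem_of_ge_of_forall_exists_gt (a := L₀) (b := μ ^ 2) (s := {L | KelLe σ U c L})
    ?_ hle₀ hL₀μ ?_
  · refine isClosed_of_closure_subset fun L hL => ?_
    have hLI : L ∈ Set.Icc L₀ (μ ^ 2) :=
      isClosed_Icc.closure_subset (closure_mono Set.inter_subset_right hL)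
    have hL0 : 0 < L := hL₀.trans_le hLI.1
    refine ⟨fun X h1 h2 h3 h4 => ?_, hLI⟩
    rcases h4.eq_or_lt with h | h
    · rw [kel_of_sqd_eq hL0 h.symm]
    set s := {L | KelLe σ U c L} ∩ Set.Icc L₀ (μ ^ 2) with hs
    have hne : (𝓝[s ∩ Set.Iio (sqd c 0 X)] L).NeBot := by
      rw [Set.inter_comm, nhdsWithin_inter_of_mem (nhdsWithin_le_nhds (Iio_mem_nhds h))]
      exact mem_closure_iff_nhdsWithin_neBot.1 hL
    have hcont : ContinuousOn (fun L => kel σ c L U X) {L | 0 < L ∧ L ≤ μ ^ 2 ∧ L ≤ sqd c 0 X} :=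
      (S.continuousOn_kel hμc hc hμ).comp (f := fun L : ℝ => (L, X)) (by fun_prop)
        fun L hL => ⟨hL.1, hL.2.1, hL.2.2, h2⟩
    have ht : Tendsto (fun L => kel σ c L U X) (𝓝[s ∩ Set.Iio (sqd c 0 X)] L)
        (𝓝 (kel σ c L U X)) :=
      (hcont L ⟨hL0, hLI.2, h4⟩).mono_left (nhdsWithin_mono _ fun l hl =>
        ⟨hL₀.trans_le hl.1.2.1, hl.1.2.2, le_of_lt hl.2⟩)
    refine le_of_tendsto ht ?_
    filter_upwards [self_mem_nhdsWithin] with l hl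
    exact hl.1.1 X h1 h2 h3 (le_of_lt hl.2)
  · rintro L ⟨hLs, hL⟩
    have hL0 : 0 < L := hL₀.trans_le hL.1
    obtain ⟨L', h1, h2, h3⟩ := S.kelLe_step hμc hc hμ hL0 hL.2 hLs (hlid L hL0 hL.2.le)
    exact ⟨L', h3, h1, h2⟩

end MovingSpheres

/-! ### Barriers and bubbles -/

/-- An explicit solution of the extension equation with flux `-f`. -/
def barrier {n : ℕ} (σ : ℝ) (y : EuclideanSpace ℝ (Fin n)) (e g f : ℝ) (X : Pt n) : ℝ :=
  e + g * (n / (2 - 2 * σ) * X.2 ^ 2 - ‖X.1 - y‖ ^ 2) - f * X.2 ^ (2 * σ)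

section Bubbles

variable {n : ℕ} {σ m μ L e g f : ℝ} {U : Pt n → ℝ} {X : Pt n} {c y : EuclideanSpace ℝ (Fin n)}

lemma contDiffAt_barrier (hX : 0 < X.2) : ContDiffAt ℝ 2 (barrier σ y e g f) X :=
  (contDiffAt_const.add (contDiffAt_const.mul ((contDiffAt_const.mul (contDiffAt_snd.pow 2)).sub
    (contDiff_nsq y).contDiffAt))).sub (contDiffAt_const.mul (contDiffAt_rpow_t _ hX))

lemma Lop_barrier (hσ : σ < 1) (hX : 0 < X.2) : Lop σ (barrier σ y e g f) X = 0 := by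
  have h1 : ContDiffAt ℝ 2 (fun Y : Pt n => Y.2 ^ 2) X := contDiffAt_snd.pow 2
  have h2 : ContDiffAt ℝ 2 (fun Y : Pt n => ‖Y.1 - y‖ ^ 2) X := (contDiff_nsq y).contDiffAt
  have h3 := contDiffAt_rpow_t (2 * σ) hX
  have h4 := (contDiffAt_const (c := n / (2 - 2 * σ))).mul h1
  unfold barrier
  rw [Lop_sub σ (contDiffAt_const.add (contDiffAt_const.mul (h4.sub h2)))
    (contDiffAt_const.mul h3), Lop_add σ contDiffAt_const (contDiffAt_const.mul (h4.sub h2)),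
    Lop_const_mul σ _ (h4.sub h2), Lop_sub σ h4 h2, Lop_const_mul σ _ h1, Lop_const_mul σ _ h3,
    Lop_const, Lop_sq_t σ hX, Lop_nsq σ y hX, Lop_rpow_t σ hX]
  have h5 : 2 - 2 * σ ≠ 0 := by linarith
  have h6 : (n : ℝ) / (2 - 2 * σ) * (4 - 4 * σ) = 2 * n := by
    rw [show 4 - 4 * σ = (2 - 2 * σ) * 2 by ring, ← mul_assoc, div_mul_cancel₀ _ h5, mul_comm]
  rw [h6]
  ring

lemma fluxAt_barrier (hσ : σ ∈ Set.Ioo (0 : ℝ) 1) {x : EuclideanSpace ℝ (Fin n)} :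
    FluxAt σ (barrier σ y e g f) x (-f) := by
  have h := ((fluxAt_const hσ.2 e).add ((((fluxAt_sq_t hσ.2).const_mul (n / (2 - 2 * σ))).sub
    (fluxAt_nsq (x := x) hσ.2 y)).const_mul g)).sub ((fluxAt_rpow_t hσ.1).const_mul f)
  have e1 : -f = 0 + g * (n / (2 - 2 * σ) * 0 - 0) - f * 1 := by ring
  rw [e1]
  exact h

lemma continuous_barrier (hσ : 0 < σ) : Continuous (barrier (n := n) σ y e g f) := by
  unfold barrier
  have : Continuous fun X : Pt n => X.2 ^ (2 * σ) :=
    continuous_snd.rpow_const fun _ => Or.inr (by linarith)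
  fun_prop

/-- Comparison of a solution with a barrier. -/
lemma Sol.barrier_le (S : Sol n σ U) {K O : Set (Pt n)} (hK : IsCompact K) (hO : IsOpen O)
    (hOK : ∀ X ∈ O, 0 ≤ X.2 → X ∈ K)
    (hKs : ∀ X ∈ K, sqd 0 0 X < 4 ∧ 0 ≤ X.2 ∧ X ≠ 0)
    (hout : ∀ X ∈ K, X ∉ O → barrier σ y e g f X ≤ U X)
    (hflux : ∀ X ∈ K, X.2 = 0 → 2 * σ * f ≤ U X ^ pexp n σ) :
    ∀ X ∈ K, barrier σ y e g f X ≤ U X := by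
  have hσ0 := S.mem_Ioo.1
  have hc : ContinuousOn (fun X => U X - barrier σ y e g f X) K :=
    (S.cont.mono fun X hX => ⟨(hKs X hX).1.le, (hKs X hX).2⟩).sub
      (continuous_barrier hσ0).continuousOn
  obtain ⟨B, hB⟩ := (hK.image_of_continuousOn hc).bddBelow
  intro X hX
  refine sub_nonneg.1 (nonneg_of_superAt (B := -B) S.two_le S.mem_Ioo hK (fun X hX =>
    ⟨(hKs X hX).2.1, ?_⟩) (hc.mono Set.sdiff_subset) (fun X hX _ => ?_) (fun X hX _ hneg => ?_)
    X hX (hKs X hX).2.2)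
  · have := (hKs X hX).1
    simp only [sqd, sub_zero] at this
    nlinarith [sq_nonneg ‖X.1‖]
  · rw [neg_neg]; exact hB (Set.mem_image_of_mem _ hX)
  · have hXO : X ∈ O := by
      by_contra h
      linarith [hout X hX h]
    obtain ⟨h4, h2, h0⟩ := hKs X hX
    rcases h2.eq_or_lt with ht | ht
    · have hXe : X = (X.1, 0) := Prod.ext rfl ht.symm
      refine Or.inr ⟨ht.symm, ?_, _, ?_, (S.flux X.1 ?_ fun hx => h0 (Prod.ext hx ht.symm)).sub
        (fluxAt_barrier S.mem_Ioo)⟩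
      · have hO' : (X.1, (0 : ℝ)) ∈ O := by rwa [← hXe]
        filter_upwards [self_mem_nhdsWithin, ((tendsto_vertical X.1 0).mono_left
          nhdsWithin_le_nhds).eventually (hO.mem_nhds hO')] with t ht ht4
        exact hOK _ ht4 (le_of_lt ht)
      · rw [← hXe]
        have := hflux X hX ht.symm
        have : f ≤ U X ^ pexp n σ / (2 * σ) := by rw [le_div_iff₀ (by positivity)]; linarith
        rw [neg_div]; linarith
      · simp only [sqd, sub_zero] at h4; nlinarith [norm_nonneg X.1, sq_nonneg X.2]
    · have hs := S.smooth X h4 ht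
      refine Or.inl ⟨ht, ?_, hs.sub (contDiffAt_barrier ht), ?_⟩
      · exact Filter.mem_of_superset ((hO.inter (isOpen_lt continuous_const
          continuous_snd)).mem_nhds ⟨hXO, ht⟩) fun Y hY => hOK Y hY.1 hY.2.le
      · rw [Lop_sub σ hs (contDiffAt_barrier ht), S.Lop_eq X h4 ht,
          Lop_barrier S.mem_Ioo.2 ht, sub_zero]

/-- A lower bound at height `2t` propagates to the boundary. -/
lemma Sol.half_le_trace (S : Sol n σ U) {R t a : ℝ} (hR : 0 < R) (ht : 0 < t) (ha : 0 ≤ a)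
    (hin : ∀ X : Pt n, ‖X.1 - y‖ ≤ R → 0 ≤ X.2 → X.2 ≤ 2 * t → sqd 0 0 X < 4 ∧ X ≠ 0)
    (htop : ∀ x, ‖x - y‖ ≤ R → a ≤ U (x, 2 * t))
    (htR : 8 * (n / (2 - 2 * σ)) * t ^ 2 ≤ R ^ 2) : a / 2 ≤ U (y, 0) := by
  have hσ0 := S.mem_Ioo.1
  have hσ1 := S.mem_Ioo.2
  set k : ℝ := n / (2 - 2 * σ) with hk
  have hn : Continuous fun X : Pt n => ‖X.1 - y‖ := by fun_prop
  have key := S.barrier_le (y := y) (e := a - a / R ^ 2 * (k * (2 * t) ^ 2)) (g := a / R ^ 2)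
    (f := 0) (K := {X | ‖X.1 - y‖ ≤ R ∧ 0 ≤ X.2 ∧ X.2 ≤ 2 * t})
    (O := {X | ‖X.1 - y‖ < R ∧ X.2 < 2 * t}) ?_
    ((isOpen_lt hn continuous_const).inter (isOpen_lt continuous_snd continuous_const))
    (fun X hX hX2 => ⟨hX.1.le, hX2, hX.2.le⟩)
    (fun X hX => ⟨(hin X hX.1 hX.2.1 hX.2.2).1, hX.2.1, (hin X hX.1 hX.2.1 hX.2.2).2⟩) ?_ ?_
    (y, 0) ⟨by simpa using hR.le, le_rfl, by positivity⟩
  · refine le_trans ?_ key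
    simp only [barrier, sub_self, norm_zero, ← hk]
    have : a / R ^ 2 * (k * (2 * t) ^ 2) ≤ a / 2 := by
      rw [div_mul_eq_mul_div, div_le_iff₀ (by positivity)]
      nlinarith
    simp only [zero_mul, ne_eq, OfNat.ofNat_ne_zero, not_false_eq_true, zero_pow, mul_zero]
    linarith
  · have : {X : Pt n | ‖X.1 - y‖ ≤ R ∧ 0 ≤ X.2 ∧ X.2 ≤ 2 * t} =
        Metric.closedBall y R ×ˢ Set.Icc 0 (2 * t) := by
      ext X; simp [dist_eq_norm]
    rw [this]
    exact (isCompact_closedBall _ _).prod isCompact_Icc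
  · intro X hX hXO
    have h4 := hin X hX.1 hX.2.1 hX.2.2
    have hg : 0 ≤ a / R ^ 2 := by positivity
    have hk0 : 0 ≤ k := div_nonneg (Nat.cast_nonneg n) (by linarith)
    have h2t : k * X.2 ^ 2 ≤ k * (2 * t) ^ 2 := by
      have := hX.2.1; have := hX.2.2; gcongr
    simp only [barrier, zero_mul, sub_zero, ← hk]
    by_cases h : ‖X.1 - y‖ < R
    · have hXt : X.2 = 2 * t := le_antisymm hX.2.2 (not_lt.1 fun h' => hXO ⟨h, h'⟩)
      have := htop X.1 hX.1
      rw [← hXt] at this ⊢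
      have : 0 ≤ a / R ^ 2 * ‖X.1 - y‖ ^ 2 := by positivity
      change _ ≤ U (X.1, X.2)
      linarith
    · have hXR : ‖X.1 - y‖ = R := le_antisymm hX.1 (not_lt.1 h)
      refine le_trans ?_ (S.nonneg X h4.1.le hX.2.1 h4.2)
      rw [hXR]
      have : a / R ^ 2 * R ^ 2 = a := by field_simp
      nlinarith [mul_le_mul_of_nonneg_left h2t hg]
  · intro X hX _
    have h4 := hin X hX.1 hX.2.1 hX.2.2
    rw [mul_zero]
    exact Real.rpow_nonneg (S.nonneg X h4.1.le hX.2.1 h4.2) _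

/-- A lower bound of the trace on a ball yields a lower bound inside. -/
lemma Sol.le_of_trace (S : Sol n σ U) {R t F : ℝ} (hR : 0 < R) (ht : 0 ≤ t) (htR : t ≤ R)
    (hF : 0 ≤ F) (hin : ∀ X : Pt n, sqd y 0 X ≤ R ^ 2 → 0 ≤ X.2 → sqd 0 0 X < 4 ∧ X ≠ 0)
    (htr : ∀ x, ‖x - y‖ ≤ R → F ≤ U (x, 0) ^ pexp n σ) :
    F / (2 * σ) * (R ^ (2 * σ) / (1 + n / (2 - 2 * σ)) - t ^ (2 * σ)) ≤ U (y, t) := by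
  have hσ0 := S.mem_Ioo.1
  have hσ1 := S.mem_Ioo.2
  set k : ℝ := n / (2 - 2 * σ) with hk
  have hk0 : 0 ≤ k := div_nonneg (Nat.cast_nonneg n) (by linarith)
  set D : ℝ := F / (2 * σ) with hD
  have hD0 : 0 ≤ D := by positivity
  set b : ℝ := R ^ (2 * σ) / (1 + k) with hb
  have hb0 : 0 ≤ b := by positivity
  have hcs := continuous_sqd y 0
  have key := S.barrier_le (y := y) (e := D * b) (g := D * (b / R ^ 2)) (f := D)
    (K := {X | sqd y 0 X ≤ R ^ 2 ∧ 0 ≤ X.2}) (O := {X | sqd y 0 X < R ^ 2})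
    (isCompact_halfBall y _) (isOpen_lt hcs continuous_const) (fun X hX hX2 => ⟨le_of_lt hX, hX2⟩)
    (fun X hX => ⟨(hin X hX.1 hX.2).1, hX.2, (hin X hX.1 hX.2).2⟩) ?_ ?_
    (y, t) ⟨by simp only [sqd, sub_self, norm_zero, sub_zero]; nlinarith, ht⟩
  · refine le_trans ?_ key
    simp only [barrier, sub_self, norm_zero, ← hk]
    have : 0 ≤ D * (b / R ^ 2) * (k * t ^ 2 - 0 ^ 2) := by
      have : k * t ^ 2 - 0 ^ 2 = k * t ^ 2 := by ring
      rw [this]; positivity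
    linarith
  · intro X hX hXO
    have h4 := hin X hX.1 hX.2
    have hXR : sqd y 0 X = R ^ 2 := le_antisymm hX.1 (not_lt.1 hXO)
    refine le_trans ?_ (S.nonneg X h4.1.le hX.2 h4.2)
    have hn : ‖X.1 - y‖ ^ 2 = R ^ 2 - X.2 ^ 2 := by
      rw [← hXR]; simp [sqd]
    have e1 : barrier σ y (D * b) (D * (b / R ^ 2)) D X =
        D * (R ^ (2 * σ) * (X.2 / R) ^ 2 - X.2 ^ (2 * σ)) := by
      rw [barrier, hn, ← hk, hb]
      field_simp
      ring
    rw [e1]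
    refine mul_nonpos_of_nonneg_of_nonpos hD0 (sub_nonpos.2 ?_)
    have hXR' : X.2 ≤ R := (le_abs_self _).trans (abs_le_of_sqd hR.le hX.1)
    have h1 : (X.2 / R) ^ (2 : ℝ) ≤ (X.2 / R) ^ (2 * σ) :=
      Real.rpow_le_rpow_of_exponent_ge' (div_nonneg hX.2 hR.le) ((div_le_one hR).2 hXR')
        (by linarith) (by linarith)
    rw [Real.rpow_two, Real.div_rpow hX.2 hR.le, le_div_iff₀ (by positivity)] at h1
    linarith
  · intro X hX hX2
    have hx := htr X.1 (norm_sub_le_of_sqd hR.le hX.1)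
    have : 2 * σ * D = F := by rw [hD]; field_simp
    rw [this]
    change _ ≤ U (X.1, X.2) ^ _
    rwa [hX2]

end Bubbles

section Descent

variable {n : ℕ} {σ m μ A : ℝ} {U : Pt n → ℝ} {X : Pt n} {c y : EuclideanSpace ℝ (Fin n)}

/-- If the spheres centred at `c` get stuck, then `U` is large near `c`. -/
lemma PosSol.exists_large (S : PosSol n σ U m) (hA : ∀ X, sqd 0 0 X = 1 → 0 ≤ X.2 → U X ≤ A)
    (hμc : μ < ‖c‖) (hc : ‖c‖ ≤ 1 / 4) (hμ : 0 < μ) (h : ¬ KelLe σ U c (μ ^ 2)) :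
    ∃ Y : Pt n, ∃ δ > 0, U Y = δ ^ (-gexp n σ) ∧ 0 ≤ Y.2 ∧ Y.2 ≤ A ^ (1 / gexp n σ) * δ ∧
      δ ≤ 2 * m ^ (-(1 / gexp n σ)) * μ ^ 2 ∧ ‖Y.1 - c‖ ≤ 2 * μ ^ 2 := by
  have hγ := S.gexp_pos
  have hm := S.m_pos
  obtain ⟨L, hL, hLμ, X, hX1, hX2, hUX⟩ : ∃ L, 0 < L ∧ L ≤ μ ^ 2 ∧ ∃ X : Pt n, sqd 0 0 X = 1 ∧
      0 ≤ X.2 ∧ U X ≤ kel σ c L U X := by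
    by_contra! hcon
    exact h (S.kelLe_of_lid hμc hc hμ hcon)
  obtain ⟨L₀, hL₀, hL₀μ, hle₀⟩ := S.exists_kelLe hμc hc hμ
  have hX0 : X ≠ 0 := by rintro rfl; simp [sqd] at hX1
  have hs : 1 / 2 ≤ sqd c 0 X := by
    by_contra! hcon
    have h1 : sqd c 0 X ≤ (3 / 4) ^ 2 := by linarith
    have h2 := sqd_triangle (c' := 0) (by norm_num) h1 (b := ‖c‖) (by simp)
    have h3 : sqd c 0 X < (3 / 4) ^ 2 := by linarith
    obtain ⟨a, ha0, ha, ha'⟩ : ∃ a : ℝ, 0 ≤ a ∧ a < 3 / 4 ∧ sqd c 0 X ≤ a ^ 2 :=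
      ⟨√(sqd c 0 X), Real.sqrt_nonneg _, (Real.sqrt_lt' (by norm_num)).2 h3,
        (Real.sq_sqrt (sqd_nonneg c 0 X)).ge⟩
    have h4 := sqd_triangle (c' := 0) ha0 ha' (b := ‖c‖) (by simp)
    rw [hX1] at h4
    nlinarith [norm_nonneg c]
  have hμs : μ ^ 2 ≤ sqd c 0 X := by nlinarith
  have hcont : ContinuousOn (fun L => kel σ c L U X) (Set.uIcc L₀ L) :=
    (S.continuousOn_kel hμc hc hμ).comp (f := fun L : ℝ => (L, X)) (by fun_prop) fun l hl => by
      have h1 : l ≤ μ ^ 2 := hl.2.trans (max_le hL₀μ hLμ)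
      exact ⟨(lt_min hL₀ hL).trans_le hl.1, h1, h1.trans hμs, hX2⟩
  obtain ⟨l, hl, hlU⟩ := intermediate_value_uIcc hcont (Set.mem_uIcc_of_le
    (hle₀ X hX1.le hX2 hX0 (hL₀μ.trans hμs)) hUX)
  have hl0 : 0 < l := (lt_min hL₀ hL).trans_le hl.1
  have hlμ : l ≤ μ ^ 2 := hl.2.trans (max_le hL₀μ hLμ)
  have hs0 : 0 < sqd c 0 X := by linarith
  have hmv := S.ge X hX1.le hX2 hX0
  have hvA := hA X hX1 hX2
  simp only [kel] at hlU
  set s := sqd c 0 X with hs_def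
  set v := U X with hv
  have hv0 : 0 < v := hm.trans_le hmv
  have hls : 0 < l / s := by positivity
  have hlsμ : l / s ≤ 2 * μ ^ 2 := by
    rw [div_le_iff₀ hs0]
    nlinarith [sq_nonneg μ]
  refine ⟨kinv c l X, v ^ (-(1 / gexp n σ)) * (l / s), by positivity, ?_,
    kinv_snd_nonneg hl0.le hX2, ?_, ?_, ?_⟩
  · rw [Real.mul_rpow (by positivity) hls.le, ← Real.rpow_mul hv0.le,
      show -(1 / gexp n σ) * -gexp n σ = 1 by field_simp, Real.rpow_one, ← hlU,
      Real.rpow_neg hls.le]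
    have : (l / s) ^ gexp n σ ≠ 0 := by positivity
    field_simp
  · rw [kinv_snd, ← hs_def, ← mul_assoc]
    have hX2' : X.2 ≤ 1 := by
      simp only [sqd, sub_zero] at hX1
      nlinarith [sq_nonneg ‖X.1‖]
    have h1 : v ^ (1 / gexp n σ) ≤ A ^ (1 / gexp n σ) :=
      Real.rpow_le_rpow hv0.le hvA (by positivity)
    have h2 : v ^ (1 / gexp n σ) * v ^ (-(1 / gexp n σ)) = 1 := by
      rw [← Real.rpow_add hv0, add_neg_cancel, Real.rpow_zero]
    have h3 : 1 ≤ A ^ (1 / gexp n σ) * v ^ (-(1 / gexp n σ)) :=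
      h2.symm.le.trans (by gcongr)
    nlinarith [mul_le_mul_of_nonneg_right h3 hls.le, mul_le_mul_of_nonneg_left hX2' hls.le]
  · have : v ^ (-(1 / gexp n σ)) ≤ m ^ (-(1 / gexp n σ)) :=
      Real.rpow_le_rpow_of_nonpos hm hmv (by simp only [neg_nonpos]; positivity)
    calc v ^ (-(1 / gexp n σ)) * (l / s) ≤ m ^ (-(1 / gexp n σ)) * (2 * μ ^ 2) := by gcongr
      _ = _ := by ring
  · have e : sqd c 0 (kinv c l X) ≤ (2 * μ ^ 2) ^ 2 := by
      rw [sqd_kinv hs0, ← hs_def, div_le_iff₀ hs0]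
      nlinarith [sq_nonneg (μ ^ 2), mul_le_mul hlμ hlμ hl0.le (by positivity)]
    exact norm_sub_le_of_sqd (by positivity) e

lemma exists_bubble_radius (hσ : σ ∈ Set.Ioo (0 : ℝ) 1) (n : ℕ) (C : ℝ) :
    ∃ ρ, 2 * C ≤ ρ ∧ 1 ≤ ρ ∧ 32 * (n / (2 - 2 * σ)) * C ^ 2 ≤ ρ ^ 2 ∧
      1 < (2⁻¹ ^ (gexp n σ + 1)) ^ pexp n σ / (2 * σ) *
        ((ρ / 2) ^ (2 * σ) / (1 + n / (2 - 2 * σ)) - C ^ (2 * σ)) := by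
  have hσ0 := hσ.1
  have hk : (0 : ℝ) < 1 + n / (2 - 2 * σ) := by
    have : (0 : ℝ) ≤ n / (2 - 2 * σ) := div_nonneg (Nat.cast_nonneg n) (by linarith [hσ.2])
    linarith
  have h1 : Tendsto (fun ρ : ℝ => (2⁻¹ ^ (gexp n σ + 1)) ^ pexp n σ / (2 * σ) *
        ((ρ / 2) ^ (2 * σ) / (1 + n / (2 - 2 * σ)) - C ^ (2 * σ))) atTop atTop := by
    refine Tendsto.const_mul_atTop (by positivity) (tendsto_atTop_add_const_right _ _ ?_)
    exact ((tendsto_rpow_atTop (by positivity)).comp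
      (tendsto_id.atTop_div_const two_pos)).atTop_div_const hk
  have h2 : Tendsto (fun ρ : ℝ => ρ ^ 2) atTop atTop := tendsto_pow_atTop two_ne_zero
  obtain ⟨ρ, h⟩ := ((eventually_ge_atTop (2 * C)).and ((eventually_ge_atTop 1).and
    ((h2.eventually_ge_atTop (32 * (n / (2 - 2 * σ)) * C ^ 2)).and
      (h1.eventually_gt_atTop 1)))).exists
  exact ⟨ρ, h⟩

lemma lt_bubble (hσ : σ ∈ Set.Ioo (0 : ℝ) 1) (hn : (0 : ℝ) < n - 2 * σ) {C ρ δ t : ℝ}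
    (hC : 0 ≤ C) (hρ0 : 0 ≤ ρ) (hδ : 0 < δ) (ht : 0 ≤ t) (htC : t ≤ C * δ)
    (hρ : 1 < (2⁻¹ ^ (gexp n σ + 1)) ^ pexp n σ / (2 * σ) *
        ((ρ / 2) ^ (2 * σ) / (1 + n / (2 - 2 * σ)) - C ^ (2 * σ))) :
    δ ^ (-gexp n σ) < (2⁻¹ ^ gexp n σ * δ ^ (-gexp n σ) / 2) ^ pexp n σ / (2 * σ) *
      ((ρ * δ / 2) ^ (2 * σ) / (1 + n / (2 - 2 * σ)) - t ^ (2 * σ)) := by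
  have hσ0 := hσ.1
  have hp : (2⁻¹ ^ gexp n σ * δ ^ (-gexp n σ) / 2) ^ pexp n σ =
      (2⁻¹ ^ (gexp n σ + 1)) ^ pexp n σ * (δ ^ (-gexp n σ) * (δ ^ (2 * σ))⁻¹) := by
    have e1 : 2⁻¹ ^ gexp n σ * δ ^ (-gexp n σ) / 2 = 2⁻¹ ^ (gexp n σ + 1) * δ ^ (-gexp n σ) := by
      rw [Real.rpow_add_one (by norm_num)]; ring
    rw [e1, Real.mul_rpow (by positivity) (by positivity), ← Real.rpow_mul hδ.le, neg_mul,
      gexp_mul_pexp hn.ne', neg_add, Real.rpow_add hδ, Real.rpow_neg hδ.le (2 * σ)]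
  have hR : (ρ * δ / 2) ^ (2 * σ) = (ρ / 2) ^ (2 * σ) * δ ^ (2 * σ) := by
    rw [← Real.mul_rpow (by positivity) hδ.le, div_mul_eq_mul_div]
  have ht' : t ^ (2 * σ) ≤ C ^ (2 * σ) * δ ^ (2 * σ) := by
    rw [← Real.mul_rpow hC hδ.le]; exact Real.rpow_le_rpow ht htC (by positivity)
  have hD : 0 < δ ^ (2 * σ) := by positivity
  have h0 : 0 < δ ^ (-gexp n σ) := by positivity
  calc
    δ ^ (-gexp n σ) < δ ^ (-gexp n σ) * ((2⁻¹ ^ (gexp n σ + 1)) ^ pexp n σ / (2 * σ) *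
        ((ρ / 2) ^ (2 * σ) / (1 + n / (2 - 2 * σ)) - C ^ (2 * σ))) :=
          lt_mul_of_one_lt_right h0 hρ
    _ = (2⁻¹ ^ gexp n σ * δ ^ (-gexp n σ) / 2) ^ pexp n σ / (2 * σ) *
        ((ρ * δ / 2) ^ (2 * σ) / (1 + n / (2 - 2 * σ)) - C ^ (2 * σ) * δ ^ (2 * σ)) := by
          rw [hp, hR]; field_simp
    _ ≤ _ := by gcongr

lemma mul_le_of_kelLe {z : EuclideanSpace ℝ (Fin n)} {t : ℝ} (hw : 0 < ‖z - y‖ ^ 2 + t ^ 2)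
    (hk : KelLe σ U (y - (z - y)) (2 * (‖z - y‖ ^ 2 + t ^ 2))) (hz : sqd 0 0 (z, 2 * t) ≤ 1)
    (ht : 0 ≤ t) (hz0 : z ≠ 0) : 2⁻¹ ^ gexp n σ * U (y, t) ≤ U (z, 2 * t) := by
  set q := ‖z - y‖ ^ 2 + t ^ 2 with hq
  set x := y - (z - y) with hx
  have hzx : z - x = (2 : ℝ) • (z - y) := by rw [hx, two_smul]; abel
  have hsq : sqd x 0 (z, 2 * t) = 4 * q := by
    simp only [sqd, hzx, norm_smul, Real.norm_eq_abs, abs_two, sub_zero, hq]; ring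
  have := hk (z, 2 * t) hz (by positivity) (ne_zero_of_fst hz0) (by rw [hsq]; linarith)
  rw [kel, kinv, hsq, show 2 * q / (4 * q) = 2⁻¹ by field_simp; norm_num] at this
  have e : ((x, (0 : ℝ)) + (2⁻¹ : ℝ) • ((z, 2 * t) - (x, (0 : ℝ))) : Pt n) = (y, t) := by
    ext1
    · simp only [Prod.fst_add, Prod.smul_fst, Prod.fst_sub, hzx, smul_smul]
      rw [inv_mul_cancel₀ two_ne_zero, one_smul, hx]; abel
    · simp
  rwa [e] at this

/-- Near a point where `U` is large, there is a sphere at which moving spheres get stuck. -/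
lemma PosSol.exists_not_kelLe (S : PosSol n σ U m) {C : ℝ} (hC : 0 ≤ C) :
    ∃ Λ ≥ 1, ∀ Y : Pt n, ∀ δ > 0, U Y = δ ^ (-gexp n σ) → 0 ≤ Y.2 → Y.2 ≤ C * δ →
      2 * (Λ * δ) < ‖Y.1‖ → ‖Y.1‖ ≤ 1 / 8 → Λ * δ ≤ 1 / 8 →
      ∃ c μ, ‖c - Y.1‖ ≤ Λ * δ ∧ 0 < μ ∧ μ ≤ Λ * δ ∧ ¬ KelLe σ U c (μ ^ 2) := by
  have hγ := S.gexp_pos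
  have hσ0 := S.mem_Ioo.1
  obtain ⟨ρ, hρC, hρ1, hρk, hρ⟩ := exists_bubble_radius S.mem_Ioo n C
  refine ⟨2 * (ρ + C), by linarith, fun Y δ hδ hUY hY2 hYC hΛ1 hY8 hΛ8 => ?_⟩
  by_contra! hcon
  obtain ⟨y, t⟩ := Y
  simp only at hY2 hYC hΛ1 hY8 hcon
  set h : ℝ := δ ^ (-gexp n σ) with hh
  have hh0 : 0 < h := by positivity
  have hρδ : ρ * δ ≤ 2 * (ρ + C) * δ / 2 := by nlinarith [mul_nonneg hC hδ.le]
  have hCδ : 2 * (C * δ) ≤ 2 * (ρ + C) * δ := by nlinarith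
  set a : ℝ := 2⁻¹ ^ gexp n σ * h with ha
  have ha0 : 0 < a := by positivity
  have hah : a ≤ h := mul_le_of_le_one_left hh0.le
    (Real.rpow_le_one (by norm_num) (by norm_num) hγ.le)
  have step1 : ∀ z, ‖z - y‖ ≤ ρ * δ → a ≤ U (z, 2 * t) := by
    intro z hz
    by_cases hzy : z = y ∧ t = 0
    · obtain ⟨rfl, rfl⟩ := hzy
      rw [mul_zero, hUY]; exact hah
    have hw : 0 < ‖z - y‖ ^ 2 + t ^ 2 := by
      by_contra! hw
      refine hzy ⟨?_, ?_⟩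
      · have : ‖z - y‖ = 0 := by nlinarith [sq_nonneg t, sq_nonneg ‖z - y‖]
        exact sub_eq_zero.1 (norm_eq_zero.1 this)
      · nlinarith [sq_nonneg t, sq_nonneg ‖z - y‖]
    have hzn : ‖z‖ ≤ ‖y‖ + ‖z - y‖ := by
      have := norm_add_le y (z - y); rwa [add_sub_cancel] at this
    have hzn' : ‖y‖ - ‖z - y‖ ≤ ‖z‖ := by
      have := norm_sub_norm_le y z; rw [norm_sub_rev] at this; linarith
    have hz0 : 0 < ‖z‖ := by linarith
    have hkle := hcon (y - (z - y)) (√(2 * (‖z - y‖ ^ 2 + t ^ 2)))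
      (by rw [sub_sub_cancel_left, norm_neg]; linarith) (by positivity) (by
        have h1 : ‖z - y‖ ^ 2 ≤ (ρ * δ) ^ 2 := by gcongr
        have h2 : t ^ 2 ≤ (C * δ) ^ 2 := by gcongr
        have h3 : 0 ≤ (ρ * δ) * (C * δ) := by positivity
        refine (Real.sqrt_le_left (by positivity)).2 ?_
        linarith [sq_nonneg (ρ * δ), sq_nonneg (C * δ),
          show (2 * (ρ + C) * δ) ^ 2 = 4 * (ρ * δ) ^ 2 + 8 * ((ρ * δ) * (C * δ)) +
            4 * (C * δ) ^ 2 by ring])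
    rw [Real.sq_sqrt (by positivity)] at hkle
    have := mul_le_of_kelLe hw hkle (by
      have h1 : ‖z‖ ^ 2 ≤ (1 / 4) ^ 2 := by gcongr; linarith
      have h2 : (2 * t) ^ 2 ≤ (1 / 8) ^ 2 := by gcongr; linarith
      simp only [sqd, sub_zero]; linarith) hY2 (norm_pos_iff.1 hz0)
    rwa [hUY] at this
  set R : ℝ := ρ * δ / 2 with hR
  have hR0 : 0 < R := by positivity
  have hyR : ∀ X : Pt n, ‖X.1 - y‖ ≤ 2 * R → 0 ≤ X.2 → X.2 ≤ 1 / 4 → sqd 0 0 X < 4 ∧ X ≠ 0 := by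
    intro X hX hX2 hX4
    have h1 := norm_add_le y (X.1 - y)
    rw [add_sub_cancel] at h1
    have h2 := norm_sub_norm_le y X.1
    rw [norm_sub_rev] at h2
    refine ⟨?_, ne_zero_of_fst (norm_pos_iff.1 (by linarith))⟩
    have h3 : ‖X.1‖ ^ 2 ≤ (1 / 4) ^ 2 := by gcongr; linarith
    have h4 : X.2 ^ 2 ≤ (1 / 4) ^ 2 := by gcongr
    simp only [sqd, sub_zero]; linarith
  have step2 : ∀ x, ‖x - y‖ ≤ R → a / 2 ≤ U (x, 0) := by
    intro x hx
    rcases hY2.eq_or_lt with ht | ht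
    · have := step1 x (by linarith)
      rw [← ht, mul_zero] at this
      linarith
    refine S.half_le_trace hR0 ht ha0.le (fun X h1 h2 h3 => ?_) (fun z hz => step1 z ?_) ?_
    · have := norm_sub_le_norm_sub_add_norm_sub X.1 x y
      exact hyR X (by linarith) h2 (by linarith)
    · have := norm_sub_le_norm_sub_add_norm_sub z x y; linarith
    · have hk0 : (0 : ℝ) ≤ n / (2 - 2 * σ) :=
        div_nonneg (Nat.cast_nonneg n) (by linarith [S.mem_Ioo.2])
      have h1 : t ^ 2 ≤ (C * δ) ^ 2 := by gcongr
      have h2 := mul_le_mul_of_nonneg_left h1 hk0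
      have h3 := mul_le_mul_of_nonneg_right hρk (sq_nonneg δ)
      rw [hR, show (ρ * δ / 2) ^ 2 = ρ ^ 2 * δ ^ 2 / 4 by ring]
      rw [mul_pow] at h2
      linarith
  have step3 := S.le_of_trace (y := y) hR0 hY2 (by rw [hR]; nlinarith) (F := (a / 2) ^ pexp n σ)
    (by positivity) (fun X h1 h2 => ?_) fun x hx =>
      Real.rpow_le_rpow (by positivity) (step2 x hx) S.pexp_pos.le
  · rw [hUY] at step3
    exact absurd step3 (not_le.2 (lt_bubble S.mem_Ioo S.two_n_pos hC (by positivity) hδ hY2 hYC hρ))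
  · have h3 := norm_sub_le_of_sqd hR0.le h1
    have h4 := (abs_le.1 (abs_le_of_sqd hR0.le h1)).2
    exact hyR X (by linarith) h2 (by linarith)

end Descent

section Harnack

variable {n : ℕ} {σ m μ A : ℝ} {U : Pt n → ℝ} {X : Pt n} {c y : EuclideanSpace ℝ (Fin n)}

/-- An infinite descent rules out large values of `U` away from the origin. -/
lemma PosSol.exists_no_large (S : PosSol n σ U m) (hA0 : 0 ≤ A)
    (hA : ∀ X, sqd 0 0 X = 1 → 0 ≤ X.2 → U X ≤ A) :
    ∃ Λ ≥ 1, ∀ r > 0, ∀ (Y : Pt n) (δ : ℝ), 0 < δ →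
      2 * m ^ (-(1 / gexp n σ)) * Λ ^ 2 * δ ≤ 1 / 2 → A ^ (1 / gexp n σ) * δ ≤ 1 / 8 →
      U Y = δ ^ (-gexp n σ) → 0 ≤ Y.2 → Y.2 ≤ A ^ (1 / gexp n σ) * δ →
      r + 6 * (Λ * δ) ≤ ‖Y.1‖ → ¬ ‖Y.1‖ + 6 * (Λ * δ) ≤ 1 / 8 := by
  have hγ := S.gexp_pos
  have hm := S.m_pos
  obtain ⟨Λ, hΛ, hbub⟩ := S.exists_not_kelLe (C := A ^ (1 / gexp n σ)) (by positivity)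
  refine ⟨Λ, hΛ, fun r hr Y δ hδ hD hC hUY hY2 hYC hYr hY8 => ?_⟩
  set C := A ^ (1 / gexp n σ) with hCdef
  set D := 2 * m ^ (-(1 / gexp n σ)) with hDdef
  have hD0 : 0 < D := by positivity
  obtain ⟨M, hM⟩ : ∃ M > 0, ∀ X : Pt n, r ≤ ‖X.1‖ → ‖X.1‖ ≤ 1 / 8 → 0 ≤ X.2 → X.2 ≤ 1 / 8 →
      U X ≤ M := by
    have hKc : IsCompact {X : Pt n | (‖X.1‖ ≤ 1 / 8 ∧ 0 ≤ X.2 ∧ X.2 ≤ 1 / 8) ∧ r ≤ ‖X.1‖} := by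
      have : {X : Pt n | ‖X.1‖ ≤ 1 / 8 ∧ 0 ≤ X.2 ∧ X.2 ≤ 1 / 8} =
          Metric.closedBall 0 (1 / 8) ×ˢ Set.Icc 0 (1 / 8) := by
        ext X; simp
      refine IsCompact.inter_right (s := {X : Pt n | ‖X.1‖ ≤ 1 / 8 ∧ 0 ≤ X.2 ∧ X.2 ≤ 1 / 8}) ?_
        (isClosed_le continuous_const continuous_fst.norm)
      rw [this]
      exact (isCompact_closedBall _ _).prod isCompact_Icc
    obtain ⟨M, hM⟩ := (hKc.image_of_continuousOn (f := U) (S.cont.mono fun X hX => ⟨by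
      have h1 : ‖X.1‖ ^ 2 ≤ (1 / 8) ^ 2 := by gcongr; exact hX.1.1
      have h2 : X.2 ^ 2 ≤ (1 / 8) ^ 2 := by
        have := hX.1.2.1; gcongr; exact hX.1.2.2
      simp only [sqd, sub_zero]; linarith, hX.1.2.1,
      ne_zero_of_fst (norm_pos_iff.1 (hr.trans_le hX.2))⟩)).bddAbove
    exact ⟨max M 1, by positivity, fun X h1 h2 h3 h4 =>
      (hM (Set.mem_image_of_mem U ⟨⟨h2, h3, h4⟩, h1⟩)).trans (le_max_left _ _)⟩
  set η : ℝ := M ^ (-(1 / gexp n σ)) with hη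
  have hη0 : 0 < η := Real.rpow_pos_of_pos hM.1 _
  have key : ∀ k : ℕ, ∀ (Y : Pt n) (δ : ℝ), 0 < δ → δ ≤ 2 ^ k * (η / 2) →
      D * Λ ^ 2 * δ ≤ 1 / 2 → C * δ ≤ 1 / 8 → U Y = δ ^ (-gexp n σ) → 0 ≤ Y.2 → Y.2 ≤ C * δ →
      r + 6 * (Λ * δ) ≤ ‖Y.1‖ → ¬ ‖Y.1‖ + 6 * (Λ * δ) ≤ 1 / 8 := by
    intro k
    induction k with
    | zero =>
      intro Y δ hδ hδη hD hC hUY hY2 hYC hYr hY8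
      have hΛδ : 0 < Λ * δ := by positivity
      have h1 := hM.2 Y (by linarith) (by linarith) hY2 (by linarith)
      rw [hUY] at h1
      have h2 : η ^ (-gexp n σ) = M := by
        rw [hη, ← Real.rpow_mul hM.1.le, show -(1 / gexp n σ) * -gexp n σ = 1 by field_simp,
          Real.rpow_one]
      have h3 : η ^ (-gexp n σ) < δ ^ (-gexp n σ) :=
        Real.rpow_lt_rpow_of_neg hδ (by rw [pow_zero, one_mul] at hδη; linarith) (by linarith)
      linarith
    | succ k ih =>
      intro Y δ hδ hδη hD hC hUY hY2 hYC hYr hY8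
      have hΛδ : 0 < Λ * δ := by positivity
      obtain ⟨c, μ, hcY, hμ, hμΛ, hnot⟩ := hbub Y δ hδ hUY hY2 hYC (by linarith) (by linarith)
        (by linarith)
      have hc1 := norm_sub_norm_le Y.1 c
      rw [norm_sub_rev] at hc1
      have hc2 := norm_sub_norm_le c Y.1
      obtain ⟨Y', δ', hδ', hUY', hY2', hYC', hδμ, hYc⟩ :=
        S.exists_large hA (by linarith) (by linarith) hμ hnot
      have hμ2 : μ ^ 2 ≤ (Λ * δ) ^ 2 := by gcongr
      have hδδ : δ' ≤ δ / 2 := by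
        have h1 : D * μ ^ 2 ≤ D * (Λ * δ) ^ 2 := by gcongr
        have h2 : D * Λ ^ 2 * δ * δ ≤ 1 / 2 * δ := by gcongr
        linarith [show D * (Λ * δ) ^ 2 = D * Λ ^ 2 * δ * δ by ring]
      have hμ3 : (Λ * δ) ^ 2 ≤ Λ * δ := by nlinarith
      have hYY : ‖Y'.1 - Y.1‖ ≤ 3 * (Λ * δ) := by
        have := norm_sub_le_norm_sub_add_norm_sub Y'.1 c Y.1
        linarith
      have h3 := norm_sub_norm_le Y'.1 Y.1
      have h4 := norm_sub_norm_le Y.1 Y'.1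
      rw [norm_sub_rev] at h4
      have h5 : Λ * δ' ≤ Λ * (δ / 2) := by gcongr
      have h6 : D * Λ ^ 2 * δ' ≤ D * Λ ^ 2 * δ := by gcongr; linarith
      have h7 : C * δ' ≤ C * δ := by gcongr; linarith
      refine ih Y' δ' hδ' ?_ (by linarith) (by linarith) hUY' hY2' hYC' (by linarith)
        (by linarith)
      rw [pow_succ] at hδη
      linarith
  obtain ⟨k, hk⟩ := pow_unbounded_of_one_lt (δ / (η / 2)) one_lt_two
  exact key k Y δ hδ ((div_le_iff₀ (by positivity)).1 hk.le) hD hC hUY hY2 hYC hYr hY8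

/-- All spheres centred near the origin can be moved up to the origin. -/
lemma PosSol.exists_forall_kelLe (S : PosSol n σ U m) (hA0 : 0 ≤ A)
    (hA : ∀ X, sqd 0 0 X = 1 → 0 ≤ X.2 → U X ≤ A) :
    ∃ ε > 0, ε ≤ 1 / 16 ∧ ∀ c : EuclideanSpace ℝ (Fin n), ‖c‖ ≤ ε → ∀ μ, 0 < μ → μ < ‖c‖ →
      KelLe σ U c (μ ^ 2) := by
  have hm := S.m_pos
  obtain ⟨Λ, hΛ, hno⟩ := S.exists_no_large hA0 hA
  set C := A ^ (1 / gexp n σ) with hC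
  set D := 2 * m ^ (-(1 / gexp n σ)) with hD
  have hC0 : 0 ≤ C := by positivity
  have hD0 : 0 < D := by positivity
  set ε : ℝ := 1 / (16 * (1 + 6 * (Λ * D) + C * D)) with hε
  have hΛD : 0 ≤ Λ * D := by positivity
  have hCD : 0 ≤ C * D := by positivity
  have hε0 : 0 < ε := by positivity
  have hsum : ε + 6 * (Λ * D * ε) + C * D * ε = 1 / 16 := by rw [hε]; field_simp
  have hΛε : 0 ≤ Λ * D * ε := by positivity
  have hCε : 0 ≤ C * D * ε := by positivity
  refine ⟨ε, hε0, by linarith, fun c hc μ hμ hμc => ?_⟩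
  by_contra hnot
  obtain ⟨Y, δ, hδ, hUY, hY2, hYC, hδμ, hYc⟩ := S.exists_large hA hμc (by linarith) hμ hnot
  have hc0 : 0 < ‖c‖ := hμ.trans hμc
  have hμ2 : μ ^ 2 ≤ ‖c‖ * ε := by rw [sq]; exact mul_le_mul hμc.le (hμc.le.trans hc) hμ.le hc0.le
  have hδ2 : δ ≤ D * (‖c‖ * ε) := hδμ.trans (mul_le_mul_of_nonneg_left hμ2 hD0.le)
  have h1 := norm_sub_norm_le Y.1 c
  have h2 := norm_sub_norm_le c Y.1
  rw [norm_sub_rev] at h2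
  have hΛδ : Λ * δ ≤ Λ * D * ε * ‖c‖ :=
    (mul_le_mul_of_nonneg_left hδ2 (by linarith)).trans (by linarith)
  have hCδ : C * δ ≤ C * D * ε * ‖c‖ :=
    (mul_le_mul_of_nonneg_left hδ2 hC0).trans (by linarith)
  have h3 : Λ * D * ε * ‖c‖ ≤ 1 / 96 * ‖c‖ := by gcongr; linarith
  have h4 : C * D * ε * ‖c‖ ≤ 1 / 16 * ‖c‖ := by gcongr; linarith
  have h5 : ‖c‖ * ε ≤ ‖c‖ * (1 / 16) := by gcongr; linarith
  refine hno (‖c‖ / 2) (by linarith) Y δ hδ ?_ (by linarith) hUY hY2 hYC (by linarith)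
    (by linarith)
  calc D * Λ ^ 2 * δ ≤ D * Λ ^ 2 * (D * (ε * ε)) := by
        gcongr
        exact hδ2.trans (by gcongr)
    _ = (Λ * D * ε) ^ 2 := by ring
    _ ≤ (1 / 96) ^ 2 := by gcongr; linarith
    _ ≤ 1 / 2 := by norm_num

/-- The sharp Harnack inequality on small spheres. -/
lemma PosSol.exists_harnack (S : PosSol n σ U m) (hA0 : 0 ≤ A)
    (hA : ∀ X, sqd 0 0 X = 1 → 0 ≤ X.2 → U X ≤ A) :
    ∃ K > 0, ∃ r₀ ∈ Set.Ioo (0 : ℝ) (1 / 2), ∀ x y : EuclideanSpace ℝ (Fin n), x ≠ 0 →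
      ‖x‖ < r₀ → ‖y‖ = ‖x‖ → U (y, 0) ≤ (1 + K * ‖x‖) * U (x, 0) := by
  have hγ := S.gexp_pos
  obtain ⟨ε, hε, hε16, hkel⟩ := S.exists_forall_kelLe hA0 hA
  set s := ε / 2 with hs
  have hs0 : 0 < s := by positivity
  refine ⟨(gexp n σ + 1) * 3 ^ gexp n σ * (2 / s), by positivity, s, ⟨hs0, by linarith⟩,
    fun x y hx0 hx hyx => ?_⟩
  have hx0' : 0 < ‖x‖ := norm_pos_iff.2 hx0
  have hsq1 : sqd 0 0 ((x, 0) : Pt n) ≤ 1 := by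
    simp only [sqd, sub_zero]; nlinarith
  have hUx : 0 ≤ U (x, 0) := S.nonneg _ (by linarith) le_rfl (ne_zero_of_fst hx0)
  set d := ‖y - x‖ with hd
  have hd2 : d ≤ 2 * ‖x‖ := by
    have := norm_sub_le y x; rw [hyx] at this; linarith
  have hd0 : 0 ≤ d := norm_nonneg _
  have main : U (y, 0) ≤ (1 + d / s) ^ gexp n σ * U (x, 0) := by
    rcases hd0.eq_or_lt with h | hdpos
    · have : y = x := sub_eq_zero.1 (norm_eq_zero.1 (hd.symm.trans h.symm))
      rw [← h, this]; simp
    set c := y + (s / d) • (y - x) with hc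
    have hinner : ⟪y, y - x⟫ = d ^ 2 / 2 := by
      rw [hd, ← real_inner_self_eq_norm_sq, inner_sub_right, inner_sub_left, inner_sub_right,
        inner_sub_right, real_inner_self_eq_norm_sq, real_inner_self_eq_norm_sq, hyx,
        real_inner_comm x y]
      ring
    have hcn : ‖c‖ ^ 2 = ‖x‖ ^ 2 + s * (s + d) := by
      rw [hc, norm_add_sq_real, norm_smul, inner_smul_right, hinner, ← hd, hyx, mul_pow,
        Real.norm_eq_abs, sq_abs]
      field_simp
      ring
    have hcle : ‖c‖ ≤ ε := by
      have := norm_add_le y ((s / d) • (y - x))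
      rw [norm_smul, ← hd, Real.norm_eq_abs, abs_of_pos (by positivity),
        div_mul_cancel₀ _ hdpos.ne', hyx] at this
      linarith
    have hxc : x - c = (-((s + d) / d)) • (y - x) := by
      rw [hc, add_div, div_self hdpos.ne', neg_smul, add_smul, one_smul]; abel
    have hsqd : sqd c 0 ((x, 0) : Pt n) = (s + d) ^ 2 := by
      simp only [sqd, hxc, norm_smul, ← hd, norm_neg, Real.norm_eq_abs]
      rw [abs_of_pos (by positivity), div_mul_cancel₀ _ hdpos.ne']; ring
    have hle := hkel c hcle (√(s * (s + d))) (by positivity) (by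
      rw [Real.sqrt_lt' (by
        by_contra! h0
        have : ‖c‖ = 0 := le_antisymm h0 (norm_nonneg c)
        rw [this] at hcn
        have : 0 < s * (s + d) := by positivity
        nlinarith), hcn]
      have : 0 < ‖x‖ ^ 2 := by positivity
      linarith)
    rw [Real.sq_sqrt (by positivity)] at hle
    have h := hle (x, 0) hsq1 le_rfl (ne_zero_of_fst hx0) (by rw [hsqd]; nlinarith)
    have e1 : s * (s + d) / (s + d) ^ 2 = s / (s + d) := by field_simp
    have e2 : kinv c (s * (s + d)) (x, 0) = (y, 0) := by
      rw [kinv, hsqd, e1]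
      ext1
      · simp only [Prod.fst_add, Prod.smul_fst, Prod.fst_sub, hxc, smul_smul]
        rw [show s / (s + d) * -((s + d) / d) = -(s / d) by field_simp, hc, neg_smul]
        abel
      · simp
    rw [kel, e2, hsqd, e1] at h
    have e3 : 1 + d / s = (s / (s + d))⁻¹ := by field_simp
    rw [e3, Real.inv_rpow (by positivity), ← div_eq_inv_mul, le_div_iff₀ (by positivity)]
    linarith
  refine main.trans (mul_le_mul_of_nonneg_right ?_ hUx)
  set τ := d / s with hτ
  have hτ0 : 0 ≤ τ := by positivity
  have hτ2 : τ ≤ 2 := by rw [hτ, div_le_iff₀ hs0]; linarith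
  have h1 := rpow_sub_rpow_le (p := gexp n σ + 1) (u := 1) (k := 1 + τ) (M := 3) (by linarith)
    zero_le_one (by linarith) (by linarith)
  rw [Real.one_rpow, add_sub_cancel_left, add_sub_cancel_right] at h1
  have h2 : (1 + τ) ^ gexp n σ ≤ (1 + τ) ^ (gexp n σ + 1) :=
    Real.rpow_le_rpow_of_exponent_le (by linarith) (by linarith)
  have h3 : τ ≤ 2 / s * ‖x‖ := by
    rw [hτ, div_mul_eq_mul_div]; gcongr
  have h4 : (gexp n σ + 1) * 3 ^ gexp n σ * τ ≤ (gexp n σ + 1) * 3 ^ gexp n σ * (2 / s * ‖x‖) := by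
    gcongr
  linarith

end Harnack

section SphereMeasure

/-- Normalization is Lipschitz away from the unit ball. -/
lemma norm_normalize_sub_le {E : Type*} [NormedAddCommGroup E] [NormedSpace ℝ E] {a b : E}
    (ha : 1 ≤ ‖a‖) (hb : 1 ≤ ‖b‖) : ‖‖a‖⁻¹ • a - ‖b‖⁻¹ • b‖ ≤ 2 * ‖a - b‖ := by
  have ha0 : 0 < ‖a‖ := by linarith
  have hb0 : 0 < ‖b‖ := by linarith
  have e : ‖a‖⁻¹ • a - ‖b‖⁻¹ • b = ‖a‖⁻¹ • (a - b) + (‖a‖⁻¹ - ‖b‖⁻¹) • b := by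
    rw [smul_sub, sub_smul]; abel
  have h1 : ‖(‖a‖⁻¹ - ‖b‖⁻¹) • b‖ = ‖a‖⁻¹ * |‖b‖ - ‖a‖| := by
    rw [inv_sub_inv ha0.ne' hb0.ne', norm_smul, Real.norm_eq_abs, abs_div,
      abs_of_pos (mul_pos ha0 hb0)]
    field_simp
  have h2 := abs_norm_sub_norm_le b a
  rw [norm_sub_rev] at h2
  have h3 : ‖a‖⁻¹ ≤ 1 := inv_le_one_of_one_le₀ ha
  rw [e]
  refine (norm_add_le _ _).trans ?_
  rw [h1, norm_smul, norm_inv, norm_norm]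
  have h4 : ‖a‖⁻¹ * ‖a - b‖ ≤ 1 * ‖a - b‖ := by gcongr
  have h5 : ‖a‖⁻¹ * |‖b‖ - ‖a‖| ≤ 1 * ‖a - b‖ := by gcongr
  linarith

variable {k : ℕ} {r : ℝ}

/-- The radial projection of a face of the cube to the sphere of radius `r`. -/
def cubeFace (r : ℝ) (i : Fin (k + 1)) (s : ℝ) (w : Fin k → ℝ) : EuclideanSpace ℝ (Fin (k + 1)) :=
  r • (‖WithLp.toLp 2 (Fin.insertNth (α := fun _ => ℝ) i s w)‖⁻¹ •
    WithLp.toLp 2 (Fin.insertNth (α := fun _ => ℝ) i s w))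

lemma exists_lipschitzWith_cubeFace (r : ℝ) (i : Fin (k + 1)) {s : ℝ} (hs : |s| = 1) :
    ∃ K, LipschitzWith K (cubeFace r i s) := by
  obtain ⟨L, hL⟩ : ∃ L, LipschitzWith L
      (WithLp.toLp 2 : (Fin (k + 1) → ℝ) → EuclideanSpace ℝ (Fin (k + 1))) :=
    ⟨_, PiLp.lipschitzWith_toLp 2 fun _ => ℝ⟩
  have h1 : ∀ w : Fin k → ℝ, 1 ≤ ‖(WithLp.toLp 2 (Fin.insertNth (α := fun _ => ℝ) i s w) :
      EuclideanSpace ℝ (Fin (k + 1)))‖ := fun w => by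
    have := PiLp.norm_apply_le (WithLp.toLp 2 (Fin.insertNth (α := fun _ => ℝ) i s w) :
      EuclideanSpace ℝ (Fin (k + 1))) i
    simpa [hs] using this
  refine ⟨‖r‖₊ * (2 * L), LipschitzWith.of_dist_le_mul fun w v => ?_⟩
  have hd := hL.dist_le_mul (Fin.insertNth (α := fun _ => ℝ) i s w)
    (Fin.insertNth (α := fun _ => ℝ) i s v)
  rw [Fin.dist_insertNth_insertNth, dist_self, max_eq_right dist_nonneg, dist_eq_norm] at hd
  rw [dist_eq_norm, cubeFace, cubeFace, ← smul_sub, norm_smul]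
  push_cast
  rw [mul_assoc]
  gcongr
  linarith [norm_normalize_sub_le (h1 w) (h1 v)]

/-- The sphere is covered by the projections of the faces of the cube. -/
lemma sphere_subset_iUnion_cubeFace (hr : 0 < r) :
    Metric.sphere (0 : EuclideanSpace ℝ (Fin (k + 1))) r ⊆
      ⋃ i, cubeFace r i 1 '' Metric.closedBall 0 1 ∪ cubeFace r i (-1) '' Metric.closedBall 0 1 := by
  intro x hx
  have hxr : ‖x‖ = r := by simpa using hx
  obtain ⟨i, hi⟩ := Finite.exists_max fun j => |x j|
  have hxi : 0 < |x i| := by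
    by_contra! h
    have hx0 : x = 0 := by
      ext j
      exact abs_nonpos_iff.1 ((hi j).trans h)
    rw [hx0, norm_zero] at hxr
    exact hr.ne hxr
  set w : Fin k → ℝ := fun j => |x i|⁻¹ * x (i.succAbove j) with hw
  have hwb : w ∈ Metric.closedBall 0 1 := by
    rw [mem_closedBall_zero_iff, pi_norm_le_iff_of_nonneg zero_le_one]
    intro j
    rw [hw, Real.norm_eq_abs, abs_mul, abs_inv, abs_abs, inv_mul_le_iff₀ hxi, mul_one]
    exact hi _
  have key : ∀ s, s = |x i|⁻¹ * x i → cubeFace r i s w = x := fun s hs => by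
    have e : (WithLp.toLp 2 (Fin.insertNth (α := fun _ => ℝ) i s w) :
        EuclideanSpace ℝ (Fin (k + 1))) = |x i|⁻¹ • x := by
      ext j
      refine Fin.succAboveCases i ?_ (fun j => ?_) j <;> simp [hs, hw]
    rw [cubeFace, e, norm_smul, norm_inv, Real.norm_eq_abs, abs_abs, hxr, smul_smul, smul_smul]
    convert one_smul ℝ x
    field_simp
  refine Set.mem_iUnion.2 ⟨i, ?_⟩
  rcases lt_or_ge 0 (x i) with h | h
  · refine Or.inl ⟨w, hwb, key _ ?_⟩
    rw [abs_of_pos h, inv_mul_cancel₀ h.ne']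
  · have h0 : x i < 0 := lt_of_le_of_ne h (abs_pos.1 hxi)
    refine Or.inr ⟨w, hwb, key _ ?_⟩
    rw [abs_of_neg h0, inv_neg, neg_mul, inv_mul_cancel₀ h0.ne]

lemma hausdorffMeasure_eq_volume (k : ℕ) : (μH[(k : ℝ)] : Measure (Fin k → ℝ)) = volume := by
  simpa using hausdorffMeasure_pi_real (ι := Fin k)

lemma hausdorffMeasure_sphere_ne_top (hr : 0 < r) :
    (μH[(k : ℝ)] : Measure (EuclideanSpace ℝ (Fin (k + 1)))) (Metric.sphere 0 r) ≠ ⊤ := by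
  have hface : ∀ (i : Fin (k + 1)) (s : ℝ), |s| = 1 →
      μH[(k : ℝ)] (cubeFace r i s '' Metric.closedBall 0 1) < ⊤ := fun i s hs => by
    obtain ⟨K, hK⟩ := exists_lipschitzWith_cubeFace r i hs
    refine (hK.hausdorffMeasure_image_le k.cast_nonneg _).trans_lt ?_
    rw [hausdorffMeasure_eq_volume]
    exact ENNReal.mul_lt_top (ENNReal.rpow_lt_top_of_nonneg k.cast_nonneg ENNReal.coe_ne_top)
      measure_closedBall_lt_top
  refine ((measure_mono (sphere_subset_iUnion_cubeFace hr)).trans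
    (measure_iUnion_fintype_le _ _) |>.trans_lt ?_).ne
  refine ENNReal.sum_lt_top.2 fun i _ => (measure_union_le _ _).trans_lt ?_
  exact ENNReal.add_lt_top.2 ⟨hface i 1 (by simp), hface i (-1) (by simp)⟩

lemma hausdorffMeasure_sphere_ne_zero (hr : 0 < r) :
    (μH[(k : ℝ)] : Measure (EuclideanSpace ℝ (Fin (k + 1)))) (Metric.sphere 0 r) ≠ 0 := by
  have hlip : LipschitzWith 1
      (fun (x : EuclideanSpace ℝ (Fin (k + 1))) (j : Fin k) => x j.succ) := by
    refine LipschitzWith.of_dist_le_mul fun x y => ?_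
    rw [NNReal.coe_one, one_mul, dist_pi_le_iff dist_nonneg]
    intro j
    rw [dist_eq_norm, dist_eq_norm]
    exact PiLp.norm_apply_le (x - y) j.succ
  have hle := hlip.hausdorffMeasure_image_le (d := k) k.cast_nonneg (Metric.sphere 0 r)
  rw [hausdorffMeasure_eq_volume, ENNReal.coe_one, ENNReal.one_rpow, one_mul] at hle
  set O : Set (Fin k → ℝ) := {w | ∑ j, w j ^ 2 < r ^ 2} with hO
  have hOo : IsOpen O := isOpen_lt (by fun_prop) continuous_const
  have hOn : O.Nonempty := ⟨0, by simp [hO, pow_pos hr]⟩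
  refine ((hOo.measure_pos volume hOn).trans_le ((measure_mono ?_).trans hle)).ne'
  intro w hw
  refine ⟨WithLp.toLp 2 (Fin.cons √(r ^ 2 - ∑ j, w j ^ 2) w), ?_, by ext j; simp⟩
  have hw' : ∑ j, w j ^ 2 < r ^ 2 := hw
  rw [mem_sphere_zero_iff_norm, EuclideanSpace.norm_eq, Real.sqrt_eq_iff_eq_sq (by positivity) hr.le]
  simp [Fin.sum_univ_succ, Real.sq_sqrt (sub_nonneg.2 hw'.le)]

end SphereMeasure

section Radial

variable {n : ℕ} {σ m : ℝ} {U : Pt n → ℝ}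

/-- Spherical averages of continuous functions lie between bounds for the function. -/
lemma sphAvg_mem_Icc (hn : 2 ≤ n) {u : EuclideanSpace ℝ (Fin n) → ℝ} {a b r : ℝ} (hr : 0 < r)
    (hu : ContinuousOn u (Metric.sphere 0 r)) (hab : ∀ y, ‖y‖ = r → u y ∈ Set.Icc a b) :
    sphAvg n u r ∈ Set.Icc a b := by
  obtain ⟨k, rfl⟩ : ∃ k, n = k + 1 := ⟨n - 1, by omega⟩
  have hk : ((k + 1 : ℕ) : ℝ) - 1 = k := by push_cast; ring
  rw [sphAvg, hk]
  have hm : MeasurableSet (Metric.sphere (0 : EuclideanSpace ℝ (Fin (k + 1))) r) :=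
    Metric.isClosed_sphere.measurableSet
  have hfs : ∀ᵐ y ∂(μH[(k : ℝ)]).restrict (Metric.sphere (0 : EuclideanSpace ℝ (Fin (k + 1))) r),
      u y ∈ Set.Icc a b :=
    (ae_restrict_iff' hm).2 (Eventually.of_forall fun y hy => hab y (by simpa using hy))
  have htop := hausdorffMeasure_sphere_ne_top (k := k) hr
  refine (convex_Icc a b).set_average_mem isClosed_Icc (hausdorffMeasure_sphere_ne_zero hr) htop
    hfs (IntegrableOn.of_bound htop.lt_top (hu.aestronglyMeasurable hm) (max |a| |b|) ?_)
  exact hfs.mono fun y hy => abs_le_max_abs_abs hy.1 hy.2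

/-- A positive solution has positive lower and upper bounds on the unit half-sphere. -/
lemma Sol.exists_posSol (S : Sol n σ U) (hpos : ∀ X, sqd 0 0 X < 4 → 0 ≤ X.2 → X ≠ 0 → 0 < U X) :
    ∃ m A, PosSol n σ U m ∧ 0 ≤ A ∧ ∀ X, sqd 0 0 X = 1 → 0 ≤ X.2 → U X ≤ A := by
  have hlc : IsCompact {X : Pt n | sqd 0 0 X = 1 ∧ 0 ≤ X.2} :=
    (isCompact_halfBall 0 1).of_isClosed_subset
      ((isClosed_eq (continuous_sqd 0 0) continuous_const).inter
        (isClosed_le continuous_const continuous_snd)) fun X hX => ⟨hX.1.le, hX.2⟩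
  have hne : ({X : Pt n | sqd 0 0 X = 1 ∧ 0 ≤ X.2}).Nonempty :=
    ⟨((0 : EuclideanSpace ℝ (Fin n)), (1 : ℝ)), by simp [sqd], by simp⟩
  have h0 : ∀ X : Pt n, sqd 0 0 X = 1 → X ≠ 0 := by
    rintro X hX rfl; simp [sqd] at hX
  have hc : ContinuousOn U {X : Pt n | sqd 0 0 X = 1 ∧ 0 ≤ X.2} :=
    S.cont.mono fun X hX => ⟨by linarith [hX.1], hX.2, h0 X hX.1⟩
  obtain ⟨Y, hY, hmin⟩ := hlc.exists_isMinOn hne hc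
  obtain ⟨Z, hZ, hmax⟩ := hlc.exists_isMaxOn hne hc
  have hp : ∀ X : Pt n, sqd 0 0 X = 1 → 0 ≤ X.2 → 0 < U X := fun X h1 h2 =>
    hpos X (by linarith) h2 (h0 X h1)
  exact ⟨U Y, U Z, { S with
    m_pos := hp Y hY.1 hY.2
    ge := fun X h1 h2 h3 => S.ge_of_lid (fun X h1 h2 => hmin (a := X) ⟨h1, h2⟩) h1 h2 h3 },
    (hp Z hZ.1 hZ.2).le, fun X h1 h2 => hmax (a := X) ⟨h1, h2⟩⟩

lemma Sol.continuousOn_trace_sphere (S : Sol n σ U) {r : ℝ} (hr : 0 < r) (hr2 : r < 2) :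
    ContinuousOn (fun y => U (y, 0)) (Metric.sphere 0 r) :=
  S.cont.comp (by fun_prop) fun y hy => by
    have hy' : ‖y‖ = r := by simpa using hy
    refine ⟨?_, le_rfl, ne_zero_of_fst (norm_pos_iff.1 (hy' ▸ hr))⟩
    simp only [sqd, sub_zero, hy']
    nlinarith

end Radial

/-- The trace `u` of a nonnegative solution of the extension problem
on the punctured half-ball `𝔅_2^+` is asymptotically radially symmetric at the origin:
`|u(x) - ū(|x|)| ≤ C |x| ū(|x|)` for all small `x ≠ 0`. -/
theorem stmt_2 (n : ℕ) (hn : 2 ≤ n) (σ : ℝ) (hσ : σ ∈ Set.Ioo (0 : ℝ) 1)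
    (U : Pt n → ℝ) (hU : ExtSol n σ 2 U) :
    ∃ C : ℝ, 0 < C ∧ ∃ r₀ ∈ Set.Ioo (0 : ℝ) (1 / 2),
      ∀ x : EuclideanSpace ℝ (Fin n), 0 < ‖x‖ → ‖x‖ < r₀ →
        |U (x, 0) - sphAvg n (fun y => U (y, 0)) ‖x‖| ≤
          C * ‖x‖ * sphAvg n (fun y => U (y, 0)) ‖x‖ := by
  have S : Sol n σ U := hU.sol hn hσ
  rcases S.pos_or_trace_zero with hpos | hzero
  · obtain ⟨m, A, P, hA0, hA⟩ := S.exists_posSol hpos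
    obtain ⟨K, hK, r₀, hr₀, hharnack⟩ := P.exists_harnack hA0 hA
    refine ⟨K * (1 + K), by positivity, r₀, hr₀, fun x hx hxr => ?_⟩
    have hq : 0 < 1 + K * ‖x‖ := by positivity
    have hx1 : ‖x‖ ≤ 1 := by linarith [hr₀.2]
    obtain ⟨h1, h2⟩ := sphAvg_mem_Icc hn hx (S.continuousOn_trace_sphere hx (by linarith))
      (a := U (x, 0) / (1 + K * ‖x‖)) (b := (1 + K * ‖x‖) * U (x, 0)) fun y hy =>
      ⟨(div_le_iff₀' hq).2 (hy ▸ hharnack y x (norm_pos_iff.1 (hy ▸ hx)) (hy ▸ hxr) hy.symm),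
        hharnack x y (norm_pos_iff.1 hx) hxr hy⟩
    have hu : 0 < U (x, 0) := hpos _ (by simp only [sqd, sub_zero]; nlinarith) le_rfl
      (ne_zero_of_fst (norm_pos_iff.1 hx))
    set a := sphAvg n (fun y => U (y, 0)) ‖x‖
    have ha : 0 < a := (div_pos hu hq).trans_le h1
    rw [div_le_iff₀' hq] at h1
    have h3 : K * ‖x‖ * a ≤ K * ‖x‖ * (1 + K) * a := by
      have : 0 < K * (K * ‖x‖ * a) := by positivity
      linarith
    have h4 : K * ‖x‖ * U (x, 0) ≤ K * ‖x‖ * ((1 + K) * a) := by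
      gcongr
      refine h1.trans ?_
      gcongr
      nlinarith
    rw [abs_le]
    constructor <;> linarith
  · refine ⟨1, one_pos, 1 / 4, by norm_num, fun x hx hxr => ?_⟩
    obtain ⟨h1, h2⟩ := sphAvg_mem_Icc hn hx (S.continuousOn_trace_sphere hx (by linarith))
      (a := 0) (b := 0) fun y hy => by
        simp [hzero y (by linarith) (norm_pos_iff.1 (hy ▸ hx))]
    rw [le_antisymm h2 h1, hzero x (by linarith) (norm_pos_iff.1 hx)]
    simp
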